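/- arXiv:1906.07071 — 16 statements merged into one kernel-verified Lean document; each statement's English description precedes it below -/
import Mathlib

section
/- Let p ∈ C be the attacker's preferred candidate, (M, ṽ) a regular manipulation in favor of p, and B_D a natural number (the defender's budget). Suppose (M, ṽ) is winning, i.e., for every R ⊆ M with |R| ≤ B_D, the PV winner of the recounted profile is either p or some candidate b with SW(b) < SW(p), or with SW(b) = SW(p) and p ≻ b. Then for every R ⊆ M with |R| ≤ B_D, the PV winner of the recounted profile is p itself. -/
/-!
Statement 0: Under Plurality over Voters (PV), if a regular manipulation
`(M, ṽ)` in favor of `p` is winning (every optimal-for-defender recount of at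
most `B_D` districts of `M` yields either `p` or a candidate with strictly
smaller social welfare, or equal social welfare and lower tie-break priority),
then in fact for every recount `R ⊆ M` with `|R| ≤ B_D` the PV winner of the
recounted profile is `p` itself.

Tie-breaking: `b < a` means `a ≻ b` (`a` has higher priority).
-/

namespace PVRecount0

variable {D C : Type*}

/-- Total PV score of candidate `a` in profile `v`. -/
def score [Fintype D] (v : D → C → ℕ) (a : C) : ℕ := ∑ i, v i a

/-- `a` beats `b` under PV (ties broken by the linear order: `b < a` means `a ≻ b`). -/
def beats [Fintype D] [LT C] (v : D → C → ℕ) (a b : C) : Prop :=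
  score v b < score v a ∨ (score v a = score v b ∧ b < a)

/-- `a` is the PV winner of profile `v`. -/
def winner [Fintype D] [LT C] (v : D → C → ℕ) (a : C) : Prop :=
  ∀ b, b ≠ a → beats v a b

/-- The recounted profile: true votes on districts in `R`, distorted votes elsewhere. -/
def recount [DecidableEq D] (v vt : D → C → ℕ) (R : Finset D) : D → C → ℕ :=
  fun i a => if i ∈ R then v i a else vt i a

theorem stmt0 [Fintype D] [DecidableEq D] [Fintype C] [LinearOrder C]
    (v vt : D → C → ℕ) (p : C) (M : Finset D) (BD : ℕ)
    -- `(M, ṽ)` is a manipulation: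
    (hout : ∀ i ∉ M, ∀ a, vt i a = v i a)
    (htot : ∀ i, ∑ a, vt i a = ∑ a, v i a)
    -- regularity: in every district, every candidate other than `p` does not gain votes
    (hreg : ∀ i, ∀ a, a ≠ p → vt i a ≤ v i a)
    -- the manipulation is winning: every recount of at most `BD` districts of `M`
    -- yields `p` or a candidate the defender likes less than `p`
    (hwin : ∀ R ⊆ M, R.card ≤ BD → ∀ c, winner (recount v vt R) c →
      c = p ∨ score v c < score v p ∨ (score v c = score v p ∧ c < p)) :
    ∀ R ⊆ M, R.card ≤ BD → winner (recount v vt R) p := by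
  intro R hR hc
  have hvp : ∀ i, v i p ≤ vt i p := by
    intro i
    have h := htot i
    rw [← Finset.add_sum_erase _ _ (Finset.mem_univ p),
      ← Finset.add_sum_erase _ (v i) (Finset.mem_univ p)] at h
    have h2 : ∑ a ∈ Finset.univ.erase p, vt i a ≤ ∑ a ∈ Finset.univ.erase p, v i a :=
      Finset.sum_le_sum fun a ha => hreg i a (Finset.ne_of_mem_erase ha)
    omega
  have hp : score v p ≤ score (recount v vt R) p := by
    refine Finset.sum_le_sum fun i _ => ?_
    unfold recount
    split_ifs
    · exact le_rfl
    · exact hvp i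
  obtain ⟨c, -, hmax⟩ := Finset.exists_max_image Finset.univ
    (fun a => toLex (score (recount v vt R) a, a)) ⟨p, Finset.mem_univ p⟩
  have hw : winner (recount v vt R) c := by
    intro b hb
    have h := hmax b (Finset.mem_univ b)
    rw [Prod.Lex.toLex_le_toLex] at h
    rcases h with h | ⟨h1, h2⟩
    · exact Or.inl h
    · exact Or.inr ⟨h1.symm, lt_of_le_of_ne h2 hb⟩
  by_cases hcp : c = p
  · exact hcp ▸ hw
  exfalso
  have hcs : score (recount v vt R) c ≤ score v c := by
    refine Finset.sum_le_sum fun i _ => ?_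
    unfold recount
    split_ifs
    · exact le_rfl
    · exact hreg i c hcp
  rcases hw p (Ne.symm hcp) with h | ⟨h, hlt⟩ <;>
    rcases hwin R hR hc c hw with h' | h' | ⟨h', hlt'⟩
  · exact hcp h'
  · omega
  · omega
  · exact hcp h'
  · omega
  · exact lt_asymm hlt hlt'


end PVRecount0
end

section
/- Let p ∈ C be the attacker's preferred candidate and (M, ṽ) a manipulation that is regular for PD, i.e., p is the district winner of every district in M under ṽ. Let B_D be the defender's budget. Suppose (M, ṽ) is winning, i.e., for every R ⊆ M with |R| ≤ B_D, the PD winner of the recounted profile is either p or some candidate b with SW(b) < SW(p), or with SW(b) = SW(p) and p ≻ b. Then for every R ⊆ M with |R| ≤ B_D, the PD winner of the recounted profile is p itself. -/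
/-!
Statement 1: Under Plurality over Districts (PD) with positive rational district
weights, if a PD-regular manipulation `(M, ṽ)` in favor of `p` (i.e. `p` is the
district winner of every district of `M` under `ṽ`) is winning, then for every
recount `R ⊆ M` with `|R| ≤ B_D` the PD winner of the recounted profile is `p`.

Tie-breaking: `b < a` means `a ≻ b`.
-/

namespace PDRecount1

variable {D C : Type*}

/-- `a` beats `b` inside district `i` (plurality over votes in the district,
ties broken by the linear order on candidates). -/
def distBeats [LT C] (v : D → C → ℕ) (i : D) (a b : C) : Prop :=
  v i b < v i a ∨ (v i a = v i b ∧ b < a)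

/-- `a` is the district winner of district `i` in profile `v`. -/
def IsDistWinner [LT C] (v : D → C → ℕ) (i : D) (a : C) : Prop :=
  ∀ b, b ≠ a → distBeats v i a b

open Classical in
/-- Total PD weight of candidate `a`: the sum of the weights of the districts it wins. -/
noncomputable def pdWeight [Fintype D] [LT C] (w : D → ℚ) (v : D → C → ℕ) (a : C) : ℚ :=
  ∑ i, if IsDistWinner v i a then w i else 0

/-- `a` beats `b` under PD (ties broken by the linear order: `b < a` means `a ≻ b`). -/
noncomputable def pdBeats [Fintype D] [LT C] (w : D → ℚ) (v : D → C → ℕ) (a b : C) : Prop :=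
  pdWeight w v b < pdWeight w v a ∨ (pdWeight w v a = pdWeight w v b ∧ b < a)

/-- `a` is the PD winner of profile `v`. -/
noncomputable def pdWinner [Fintype D] [LT C] (w : D → ℚ) (v : D → C → ℕ) (a : C) : Prop :=
  ∀ b, b ≠ a → pdBeats w v a b

/-- The recounted profile: true votes on districts in `R`, distorted votes elsewhere. -/
def recount [DecidableEq D] (v vt : D → C → ℕ) (R : Finset D) : D → C → ℕ :=
  fun i a => if i ∈ R then v i a else vt i a

/-- A PD winner always exists when there is at least one candidate. -/
theorem exists_pdWinner [Fintype D] [Fintype C] [LinearOrder C]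
    (w : D → ℚ) (v : D → C → ℕ) (p : C) : ∃ c, pdWinner w v c := by
  obtain ⟨c, -, hc⟩ := Finset.exists_max_image Finset.univ
    (fun a : C => toLex (pdWeight w v a, a)) ⟨p, Finset.mem_univ p⟩
  refine ⟨c, fun b hb => ?_⟩
  have h := hc b (Finset.mem_univ b)
  rw [Prod.Lex.toLex_le_toLex] at h
  rcases h with h | ⟨h, h'⟩
  · exact Or.inl h
  · exact Or.inr ⟨h.symm, lt_of_le_of_ne h' hb⟩

theorem stmt1 [Fintype D] [DecidableEq D] [Fintype C] [LinearOrder C]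
    (w : D → ℚ) (hw : ∀ i, 0 < w i)
    (v vt : D → C → ℕ) (p : C) (M : Finset D) (BD : ℕ)
    -- `(M, ṽ)` is a manipulation:
    (hout : ∀ i ∉ M, ∀ a, vt i a = v i a)
    (htot : ∀ i, ∑ a, vt i a = ∑ a, v i a)
    -- regular for PD: `p` is the district winner of every district of `M` under `ṽ`
    (hreg : ∀ i ∈ M, IsDistWinner vt i p)
    -- the manipulation is winning:
    (hwin : ∀ R ⊆ M, R.card ≤ BD → ∀ c, pdWinner w (recount v vt R) c →
      c = p ∨ pdWeight w v c < pdWeight w v p ∨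
        (pdWeight w v c = pdWeight w v p ∧ c < p)) :
    ∀ R ⊆ M, R.card ≤ BD → pdWinner w (recount v vt R) p := by
  intro R hR hcard
  obtain ⟨c, hc⟩ := exists_pdWinner w (recount v vt R) p
  by_cases hcp : c = p
  · exact hcp ▸ hc
  exfalso
  -- districts whose votes agree with the true profile have the same district winner
  have hsame : ∀ i, (i ∈ R ∨ i ∉ M) → ∀ a,
      (IsDistWinner (recount v vt R) i a ↔ IsDistWinner v i a) := by
    intro i hi a
    have e : ∀ b, recount v vt R i b = v i b := by
      intro b
      unfold recount
      split_ifs with h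
      · rfl
      · exact hout i (hi.resolve_left h) b
    simp only [IsDistWinner, distBeats, e]
  -- in the remaining districts the winner is `p`
  have hp : ∀ i, ¬ (i ∈ R ∨ i ∉ M) → IsDistWinner (recount v vt R) i p := by
    intro i hi b hb
    push Not at hi
    have := hreg i hi.2 b hb
    simpa only [distBeats, recount, hi.1, if_false] using this
  have hnc : ∀ i, ¬ (i ∈ R ∨ i ∉ M) → ¬ IsDistWinner (recount v vt R) i c := by
    intro i hi h
    have h1 := h p (Ne.symm hcp)
    have h2 := hp i hi c hcp
    rcases h1 with h1 | ⟨h1, h1'⟩ <;> rcases h2 with h2 | ⟨h2, h2'⟩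
    · omega
    · omega
    · omega
    · exact lt_asymm h1' h2'
  have hwc : pdWeight w (recount v vt R) c ≤ pdWeight w v c := by
    unfold pdWeight
    refine Finset.sum_le_sum fun i _ => ?_
    have := (hw i).le
    by_cases hi : i ∈ R ∨ i ∉ M
    · have e := hsame i hi c
      by_cases h : IsDistWinner v i c
      · rw [if_pos h, if_pos (e.2 h)]
      · rw [if_neg h, if_neg (fun h1 => h (e.1 h1))]
    · rw [if_neg (hnc i hi)]
      split_ifs
      · first | exact this | exact le_rfl
      · first | exact this | exact le_rfl
  have hwp : pdWeight w v p ≤ pdWeight w (recount v vt R) p := by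
    unfold pdWeight
    refine Finset.sum_le_sum fun i _ => ?_
    have := (hw i).le
    by_cases hi : i ∈ R ∨ i ∉ M
    · have e := hsame i hi p
      by_cases h : IsDistWinner v i p
      · rw [if_pos h, if_pos (e.2 h)]
      · rw [if_neg h, if_neg (fun h1 => h (e.1 h1))]
    · rw [if_pos (hp i hi)]
      split_ifs
      · first | exact this | exact le_rfl
      · first | exact this | exact le_rfl
  rcases hc p (Ne.symm hcp) with h1 | ⟨h1, h1'⟩ <;>
    rcases (hwin R hR hcard c hc).resolve_left hcp with h2 | ⟨h2, h2'⟩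
  · linarith
  · linarith
  · linarith
  · exact lt_asymm h1' h2'

end PDRecount1
end

section
/- Let p be the attacker's preferred candidate, (M, ṽ) a regular manipulation in favor of p, B_D a natural number, and A = {a ∈ C : SW(a) > SW(p), or SW(a) = SW(p) and a ≻ p}. For each a ∈ A let G_a ⊆ M with |G_a| = min(B_D, |M|) be a set of districts with the largest values of κ_a(i) = (v_{i,a} − v_{i,p}) − (ṽ_{i,a} − ṽ_{i,p}), i.e., κ_a(g) ≥ κ_a(o) for all g ∈ G_a and o ∈ M \ G_a. Then there exists R ⊆ M with |R| ≤ B_D such that the PV winner of the recounted profile lies in A if and only if there exists a ∈ A such that the PV winner of the profile recounted on G_a lies in A. (Equivalently, the greedy recounting procedure outputs p if and only if (M, ṽ) is a winning strategy for the attacker.) -/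
/-!
Statement 3 (Lemma: greedy recounting is correct against regular manipulations
under PV): Let `(M, ṽ)` be a regular manipulation in favor of `p`, `B_D` the
defender's budget, and `A` the set of candidates preferred to `p` by the
defender. For each `a ∈ A` let `G a ⊆ M` be a set of `min(B_D, |M|)` districts
with the largest `κ_a`-values. Then some recount `R ⊆ M` with `|R| ≤ B_D`
produces a winner in `A` iff for some `a ∈ A` recounting `G a` produces a
winner in `A`.

Tie-breaking: `b < a` means `a ≻ b`.
-/

namespace PVGreedyCorrect3

variable {D C : Type*}

/-- Total PV score of candidate `a` in profile `v`. -/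
def score [Fintype D] (v : D → C → ℕ) (a : C) : ℕ := ∑ i, v i a

/-- `a` beats `b` under PV (ties broken by the linear order: `b < a` means `a ≻ b`). -/
def beats [Fintype D] [LT C] (v : D → C → ℕ) (a b : C) : Prop :=
  score v b < score v a ∨ (score v a = score v b ∧ b < a)

/-- `a` is the PV winner of profile `v`. -/
def winner [Fintype D] [LT C] (v : D → C → ℕ) (a : C) : Prop :=
  ∀ b, b ≠ a → beats v a b

/-- The recounted profile: true votes on districts in `R`, distorted votes elsewhere. -/
def recount [DecidableEq D] (v vt : D → C → ℕ) (R : Finset D) : D → C → ℕ :=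
  fun i a => if i ∈ R then v i a else vt i a

/-- `κ_a(i) = (v_{i,a} − v_{i,p}) − (ṽ_{i,a} − ṽ_{i,p})`. -/
def kappa (v vt : D → C → ℕ) (a p : C) (i : D) : ℤ :=
  ((v i a : ℤ) - (v i p : ℤ)) - ((vt i a : ℤ) - (vt i p : ℤ))

theorem vt_p_ge [Fintype C] [DecidableEq C] (v vt : D → C → ℕ) (p : C)
    (htot : ∀ i, ∑ c, vt i c = ∑ c, v i c)
    (hreg : ∀ i, ∀ c, c ≠ p → vt i c ≤ v i c) (i : D) : v i p ≤ vt i p := by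
  have h := htot i
  rw [← Finset.add_sum_erase _ _ (Finset.mem_univ p),
    ← Finset.add_sum_erase _ (v i) (Finset.mem_univ p)] at h
  have h2 : ∑ c ∈ Finset.univ.erase p, vt i c ≤ ∑ c ∈ Finset.univ.erase p, v i c :=
    Finset.sum_le_sum fun c hc => hreg i c (Finset.ne_of_mem_erase hc)
  omega

theorem sum_greedy [DecidableEq D] (f : D → ℤ) (hf : ∀ i, 0 ≤ f i) (M R G : Finset D)
    (hR : R ⊆ M) (hc : R.card ≤ G.card)
    (hG : ∀ g ∈ G, ∀ o ∈ M \ G, f o ≤ f g) : ∑ i ∈ R, f i ≤ ∑ i ∈ G, f i := by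
  have key : ∑ i ∈ R \ G, f i ≤ ∑ i ∈ G \ R, f i := by
    rcases (R \ G).eq_empty_or_nonempty with h | h
    · rw [h, Finset.sum_empty]
      exact Finset.sum_nonneg fun i _ => hf i
    · obtain ⟨o, ho, hmax⟩ := Finset.exists_max_image (R \ G) f h
      have hcard : (R \ G).card ≤ (G \ R).card := Finset.card_sdiff_le_card_sdiff_iff.2 hc
      have h1 := Finset.sum_le_card_nsmul (R \ G) f (f o) hmax
      have h2 := Finset.card_nsmul_le_sum (G \ R) f (f o) (fun g hg =>
        hG g (Finset.mem_sdiff.1 hg).1 o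
          (Finset.mem_sdiff.2 ⟨hR (Finset.mem_sdiff.1 ho).1, (Finset.mem_sdiff.1 ho).2⟩))
      exact h1.trans ((nsmul_le_nsmul_left (hf o) hcard).trans h2)
  have e1 := Finset.sum_inter_add_sum_sdiff R G f
  have e2 := Finset.sum_inter_add_sum_sdiff G R f
  rw [Finset.inter_comm] at e2
  linarith

theorem score_diff [Fintype D] [DecidableEq D] (v vt : D → C → ℕ) (c p : C) (R : Finset D) :
    (score (recount v vt R) c : ℤ) - score (recount v vt R) p =
      ∑ i, ((vt i c : ℤ) - vt i p) + ∑ i ∈ R, kappa v vt c p i := by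
  have : ∑ i ∈ R, kappa v vt c p i = ∑ i, if i ∈ R then kappa v vt c p i else 0 := by
    simp
  rw [this, ← Finset.sum_add_distrib]
  unfold score
  push_cast
  rw [← Finset.sum_sub_distrib]
  refine Finset.sum_congr rfl fun i _ => ?_
  unfold recount kappa
  split_ifs <;> ring

theorem exists_winner [Fintype D] [Fintype C] [LinearOrder C] (u : D → C → ℕ) (p : C) :
    ∃ w, winner u w := by
  obtain ⟨w, -, hw⟩ := Finset.exists_max_image (Finset.univ : Finset C)
    (fun c => toLex (score u c, c)) ⟨p, Finset.mem_univ p⟩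
  refine ⟨w, fun b hb => ?_⟩
  have h := hw b (Finset.mem_univ b)
  rw [Prod.Lex.toLex_le_toLex] at h
  rcases h with h | ⟨h1, h2⟩
  · exact Or.inl h
  · exact Or.inr ⟨h1.symm, lt_of_le_of_ne h2 hb⟩

theorem beats_asymm [Fintype D] [LinearOrder C] (u : D → C → ℕ) (a b : C)
    (h1 : beats u a b) (h2 : beats u b a) : False := by
  rcases h1 with h1 | ⟨h1, h1'⟩ <;> rcases h2 with h2 | ⟨h2, h2'⟩
  · omega
  · omega
  · omega
  · exact lt_asymm h1' h2'

theorem stmt3 [Fintype D] [DecidableEq D] [Fintype C] [LinearOrder C]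
    (v vt : D → C → ℕ) (p : C) (M : Finset D) (BD : ℕ)
    -- `(M, ṽ)` is a manipulation:
    (hout : ∀ i ∉ M, ∀ c, vt i c = v i c)
    (htot : ∀ i, ∑ c, vt i c = ∑ c, v i c)
    -- regularity: no candidate other than `p` gains votes in any district
    (hreg : ∀ i, ∀ c, c ≠ p → vt i c ≤ v i c)
    -- `A` is the set of candidates that the defender prefers to `p`:
    (A : Finset C)
    (hA : ∀ a, a ∈ A ↔
      (score v p < score v a ∨ (score v a = score v p ∧ p < a)))
    -- for each `a ∈ A`, `G a ⊆ M` consists of `min(B_D, |M|)` districts with largest `κ_a`: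
    (G : C → Finset D)
    (hG : ∀ a ∈ A, G a ⊆ M ∧ (G a).card = min BD M.card ∧
      ∀ g ∈ G a, ∀ o ∈ M \ G a, kappa v vt a p o ≤ kappa v vt a p g) :
    (∃ R ⊆ M, R.card ≤ BD ∧ ∃ c ∈ A, winner (recount v vt R) c) ↔
      (∃ a ∈ A, ∃ c ∈ A, winner (recount v vt (G a)) c) := by
  constructor
  · rintro ⟨R, hRM, hRc, c, hcA, hw⟩
    obtain ⟨hGM, hGc, hGk⟩ := hG c hcA
    have hp := vt_p_ge v vt p htot hreg
    have hcp : c ≠ p := by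
      rintro rfl
      rcases (hA c).1 hcA with h | ⟨_, h⟩
      · exact lt_irrefl _ h
      · exact lt_irrefl _ h
    have hsum := sum_greedy (kappa v vt c p) (fun i => by
      have h1 := hp i
      have h2 := hreg i c hcp
      unfold kappa
      omega) M R (G c) hRM (by
        rw [hGc]
        exact le_min hRc (Finset.card_le_card hRM)) hGk
    have d1 := score_diff v vt c p R
    have d2 := score_diff v vt c p (G c)
    have hb : beats (recount v vt (G c)) c p := by
      rcases hw p hcp.symm with h | ⟨h, h'⟩
      · left; omega
      · rcases lt_or_eq_of_le hsum with hs | hs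
        · left; omega
        · right; exact ⟨by omega, h'⟩
    obtain ⟨w, hww⟩ := exists_winner (recount v vt (G c)) p
    refine ⟨c, hcA, w, ?_, hww⟩
    have hwp : w ≠ p := by
      rintro rfl
      exact beats_asymm _ _ _ hb (hww c hcp)
    have hbw := hww p hwp.symm
    have s1 : score v p ≤ score (recount v vt (G c)) p := by
      refine Finset.sum_le_sum fun i _ => ?_
      unfold recount
      split_ifs
      · exact le_rfl
      · exact hp i
    have s2 : score (recount v vt (G c)) w ≤ score v w := by
      refine Finset.sum_le_sum fun i _ => ?_
      unfold recount
      split_ifs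
      · exact le_rfl
      · exact hreg i w hwp
    rw [hA]
    rcases hbw with h | ⟨h, h'⟩
    · left; omega
    · rcases lt_or_eq_of_le (s1.trans (h.symm.le.trans s2)) with hs | hs
      · exact Or.inl hs
      · exact Or.inr ⟨hs.symm, h'⟩
  · rintro ⟨a, ha, h⟩
    obtain ⟨h1, h2, -⟩ := hG a ha
    exact ⟨G a, h1, h2.le.trans (min_le_left _ _), h⟩

end PVGreedyCorrect3
end

section
/- Let p be the attacker's preferred candidate and (M, ṽ) a regular manipulation in favor of p such that p is the PV winner of ṽ; let B_D be a natural number and A = {a ∈ C : SW(a) > SW(p), or SW(a) = SW(p) and a ≻ p}. For each a ∈ A let G_a ⊆ M with |G_a| = min(B_D, |M|) be a set of districts with the largest values of κ_a(i) = (v_{i,a} − v_{i,p}) − (ṽ_{i,a} − ṽ_{i,p}). Let the set of provisional winners consist of p together with every candidate b ∈ A such that b is the PV winner of the profile recounted on G_a for some a ∈ A, and let a* be a provisional winner with maximum SW. Then for every candidate c and every R ⊆ M with |R| ≤ B_D such that c is the PV winner of the profile recounted on R, it holds that SW(a*) ≥ SW(c)/2. (Greedy recounting is a 1/2-approximation algorithm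 for the defender under PV and regular manipulations.) -/
/-!
Statement 4 (Greedy recounting is a 1/2-approximation under PV and regular
manipulations): with the greedy sets `G a` for `a ∈ A`, let the provisional
winners be `p` together with every `b ∈ A` that wins the profile recounted on
some `G a` (`a ∈ A`), and let `a*` be a provisional winner of maximum social
welfare. Then for every candidate `c` made the winner by some recount `R ⊆ M`
with `|R| ≤ B_D` we have `SW(a*) ≥ SW(c)/2`.

Tie-breaking: `b < a` means `a ≻ b`.
-/

namespace PVGreedyApprox4

variable {D C : Type*}

/-- Total PV score of candidate `a` in profile `v`. -/
def score [Fintype D] (v : D → C → ℕ) (a : C) : ℕ := ∑ i, v i a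

/-- `a` beats `b` under PV (ties broken by the linear order: `b < a` means `a ≻ b`). -/
def beats [Fintype D] [LT C] (v : D → C → ℕ) (a b : C) : Prop :=
  score v b < score v a ∨ (score v a = score v b ∧ b < a)

/-- `a` is the PV winner of profile `v`. -/
def winner [Fintype D] [LT C] (v : D → C → ℕ) (a : C) : Prop :=
  ∀ b, b ≠ a → beats v a b

/-- The recounted profile: true votes on districts in `R`, distorted votes elsewhere. -/
def recount [DecidableEq D] (v vt : D → C → ℕ) (R : Finset D) : D → C → ℕ :=
  fun i a => if i ∈ R then v i a else vt i a

/-- `κ_a(i) = (v_{i,a} − v_{i,p}) − (ṽ_{i,a} − ṽ_{i,p})`. -/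
def kappa (v vt : D → C → ℕ) (a p : C) (i : D) : ℤ :=
  ((v i a : ℤ) - (v i p : ℤ)) - ((vt i a : ℤ) - (vt i p : ℤ))

theorem exists_winner [Fintype D] [Fintype C] [LinearOrder C] (r : D → C → ℕ) (c : C) :
    ∃ w, winner r w := by
  obtain ⟨w, -, hw⟩ := Finset.exists_max_image (Finset.univ : Finset C)
    (fun a => toLex (score r a, a)) ⟨c, Finset.mem_univ c⟩
  refine ⟨w, fun b hb => ?_⟩
  have h := hw b (Finset.mem_univ b)
  rw [Prod.Lex.le_iff] at h
  rcases h with h | ⟨h1, h2⟩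
  · exact Or.inl h
  · exact Or.inr ⟨h1.symm, lt_of_le_of_ne h2 hb⟩

theorem greedy_sum [DecidableEq D] (k : D → ℤ) (hk : ∀ i, 0 ≤ k i) (M G R : Finset D)
    (hR : R ⊆ M) (hc : R.card ≤ G.card)
    (hg : ∀ g ∈ G, ∀ o ∈ M \ G, k o ≤ k g) : ∑ i ∈ R, k i ≤ ∑ i ∈ G, k i := by
  have key : ∑ i ∈ R \ G, k i ≤ ∑ i ∈ G \ R, k i := by
    rcases (R \ G).eq_empty_or_nonempty with h | h
    · rw [h, Finset.sum_empty]
      exact Finset.sum_nonneg fun i _ => hk i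
    · obtain ⟨o, ho, hmax⟩ := Finset.exists_max_image (R \ G) k h
      have ho' := Finset.mem_sdiff.1 ho
      have h1 : ∑ i ∈ R \ G, k i ≤ (R \ G).card • k o := Finset.sum_le_card_nsmul _ _ _ hmax
      have h2 : (G \ R).card • k o ≤ ∑ i ∈ G \ R, k i :=
        Finset.card_nsmul_le_sum _ _ _ fun g hgm =>
          hg g (Finset.mem_sdiff.1 hgm).1 o (Finset.mem_sdiff.2 ⟨hR ho'.1, ho'.2⟩)
      have h3 : (R \ G).card ≤ (G \ R).card := by
        have e1 := Finset.card_sdiff_add_card_inter R G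
        have e2 := Finset.card_sdiff_add_card_inter G R
        rw [Finset.inter_comm G R] at e2
        omega
      exact h1.trans ((nsmul_le_nsmul_left (hk o) h3).trans h2)
  have e1 := Finset.sum_inter_add_sum_sdiff R G k
  have e2 := Finset.sum_inter_add_sum_sdiff G R k
  rw [Finset.inter_comm G R] at e2
  linarith

theorem score_recount_diff [Fintype D] [DecidableEq D] (v vt : D → C → ℕ) (a p : C)
    (R : Finset D) :
    (score (recount v vt R) a : ℤ) - score (recount v vt R) p
      = (score vt a : ℤ) - score vt p + ∑ i ∈ R, kappa v vt a p i := by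
  have h : ∑ i ∈ R, kappa v vt a p i = ∑ i, if i ∈ R then kappa v vt a p i else 0 := by
    simp
  rw [h]
  simp only [score, Nat.cast_sum, ← Finset.sum_sub_distrib, ← Finset.sum_add_distrib]
  refine Finset.sum_congr rfl fun i _ => ?_
  unfold recount kappa
  split_ifs <;> ring

theorem stmt4 [Fintype D] [DecidableEq D] [Fintype C] [LinearOrder C]
    (v vt : D → C → ℕ) (p : C) (M : Finset D) (BD : ℕ)
    -- `(M, ṽ)` is a manipulation:
    (hout : ∀ i ∉ M, ∀ c, vt i c = v i c)
    (htot : ∀ i, ∑ c, vt i c = ∑ c, v i c)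
    -- regularity: no candidate other than `p` gains votes in any district
    (hreg : ∀ i, ∀ c, c ≠ p → vt i c ≤ v i c)
    -- `p` is the PV winner of the distorted profile `ṽ`:
    (hpwin : winner vt p)
    -- `A` is the set of candidates that the defender prefers to `p`:
    (A : Finset C)
    (hA : ∀ a, a ∈ A ↔
      (score v p < score v a ∨ (score v a = score v p ∧ p < a)))
    -- for each `a ∈ A`, `G a ⊆ M` consists of `min(B_D, |M|)` districts with largest `κ_a`:
    (G : C → Finset D)
    (hG : ∀ a ∈ A, G a ⊆ M ∧ (G a).card = min BD M.card ∧
      ∀ g ∈ G a, ∀ o ∈ M \ G a, kappa v vt a p o ≤ kappa v vt a p g)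
    -- `astar` is a provisional winner of maximum social welfare, where the provisional
    -- winners are `p` together with any `b ∈ A` winning after recounting some `G a`:
    (astar : C)
    (hprov : astar = p ∨ (astar ∈ A ∧ ∃ a ∈ A, winner (recount v vt (G a)) astar))
    (hmax : ∀ b, (b = p ∨ (b ∈ A ∧ ∃ a ∈ A, winner (recount v vt (G a)) b)) →
      score v b ≤ score v astar) :
    ∀ c, ∀ R ⊆ M, R.card ≤ BD → winner (recount v vt R) c →
      score v c ≤ 2 * score v astar := by
  have hp : ∀ i, v i p ≤ vt i p := by
    intro i
    have h := htot i
    rw [← Finset.add_sum_erase _ _ (Finset.mem_univ p),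
      ← Finset.add_sum_erase _ (v i) (Finset.mem_univ p)] at h
    have h2 : ∑ c ∈ Finset.univ.erase p, vt i c ≤ ∑ c ∈ Finset.univ.erase p, v i c :=
      Finset.sum_le_sum fun c hc => hreg i c (Finset.ne_of_mem_erase hc)
    omega
  have hpc : ∀ c, c ≠ p → ∀ i, v i p + v i c ≤ vt i p + vt i c := by
    intro c hc i
    have hm : c ∈ Finset.univ.erase p := Finset.mem_erase.2 ⟨hc, Finset.mem_univ c⟩
    have h := htot i
    rw [← Finset.add_sum_erase _ _ (Finset.mem_univ p),
      ← Finset.add_sum_erase _ (v i) (Finset.mem_univ p),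
      ← Finset.add_sum_erase _ _ hm, ← Finset.add_sum_erase _ (v i) hm] at h
    have h2 : ∑ d ∈ (Finset.univ.erase p).erase c, vt i d
        ≤ ∑ d ∈ (Finset.univ.erase p).erase c, v i d :=
      Finset.sum_le_sum fun d hd =>
        hreg i d (Finset.ne_of_mem_erase (Finset.mem_of_mem_erase hd))
    omega
  intro c R hRM hRc hcw
  have hps : score v p ≤ score v astar := hmax p (Or.inl rfl)
  by_cases hcA : c ∈ A
  swap
  · have : ¬ score v p < score v c := fun h => hcA ((hA c).2 (Or.inl h))
    omega
  have hcp : c ≠ p := by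
    rintro rfl
    rcases (hA c).1 hcA with h | h
    · exact lt_irrefl _ h
    · exact lt_irrefl _ h.2
  obtain ⟨-, hGc, hGk⟩ := hG c hcA
  have hcard : R.card ≤ (G c).card := by
    rw [hGc]; exact le_min hRc (Finset.card_le_card hRM)
  have hk : ∀ i, 0 ≤ kappa v vt c p i := by
    intro i
    have h1 := hp i
    have h2 := hreg i c hcp
    unfold kappa
    omega
  have hsum := greedy_sum (kappa v vt c p) hk M (G c) R hRM hcard hGk
  have d1 := score_recount_diff v vt c p R
  have d2 := score_recount_diff v vt c p (G c)
  have hle : ∀ d, d ≠ p → score (recount v vt (G c)) d ≤ score v d := by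
    intro d hd
    refine Finset.sum_le_sum fun i _ => ?_
    have := hreg i d hd
    unfold recount
    split_ifs <;> omega
  have hge : score v p ≤ score (recount v vt (G c)) p := by
    refine Finset.sum_le_sum fun i _ => ?_
    have := hp i
    unfold recount
    split_ifs <;> omega
  have hboth : score v p + score v c
      ≤ score (recount v vt (G c)) p + score (recount v vt (G c)) c := by
    unfold score
    rw [← Finset.sum_add_distrib, ← Finset.sum_add_distrib]
    refine Finset.sum_le_sum fun i _ => ?_
    have := hpc c hcp i
    unfold recount
    split_ifs <;> omega
  have hcbp : beats (recount v vt (G c)) c p := by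
    rcases hcw p hcp.symm with h | ⟨h, h'⟩
    · left; omega
    · rcases Nat.lt_or_ge (score (recount v vt (G c)) p) (score (recount v vt (G c)) c) with h2 | h2
      · exact Or.inl h2
      · exact Or.inr ⟨by omega, h'⟩
  obtain ⟨w, hw⟩ := exists_winner (recount v vt (G c)) c
  have hwp : w ≠ p := by
    rintro rfl
    rcases hw c hcp with h | ⟨h, h'⟩ <;> rcases hcbp with h2 | ⟨h2, h2'⟩
    · omega
    · omega
    · omega
    · exact lt_asymm h' h2'
  have hwle := hle w hwp
  have hwbp := hw p hwp.symm
  have hwA : w ∈ A := by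
    rw [hA]
    rcases hwbp with h | ⟨h, h'⟩
    · left; omega
    · rcases Nat.lt_or_ge (score v p) (score v w) with h2 | h2
      · exact Or.inl h2
      · exact Or.inr ⟨by omega, h'⟩
  have hws := hmax w (Or.inr ⟨hwA, c, hcA, hw⟩)
  have hwp' : score (recount v vt (G c)) p ≤ score (recount v vt (G c)) w := by
    rcases hwbp with h | ⟨h, -⟩ <;> omega
  have hwc : score (recount v vt (G c)) c ≤ score (recount v vt (G c)) w := by
    by_cases hcw' : c = w
    · rw [hcw']
    · rcases hw c hcw' with h | ⟨h, -⟩ <;> omega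
  omega

end PVGreedyApprox4
end

section
/- Let X be a multiset of ℓ ≥ 1 positive integers, each divisible by 4, let y = Σ_{x∈X} x, and let z ≥ 1 be an integer. Consider the PV election with candidates {a, b, p} and the following districts (votes listed as (a, b, p)): for each x ∈ X a district with true votes (0, 2xℓ, 0) distorted to (0, 0, 2xℓ); 2zℓ districts with true votes (1, 0, 0) distorted to (0, 0, 1); and two undistorted districts with votes (2zℓ + yℓ + 2ℓ, 0, 0) and (0, 2zℓ, 0). Then there exists a set R of at most ℓ − 1 distorted districts such that a is the PV winner of the profile recounted on R, if and only if there exists a subset X' ⊆ X with Σ_{x∈X'} x = y/2. -/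
/-!
Statement 5: correctness of the Partition-based instance used in the
inapproximability proof for PV recounting. Candidates `{a, b, p}`; districts:
for each `x ∈ X` a district with true votes `(0, 2xℓ, 0)` distorted to
`(0, 0, 2xℓ)`; `2zℓ` districts with true votes `(1,0,0)` distorted to
`(0,0,1)`; two undistorted districts `(2zℓ + yℓ + 2ℓ, 0, 0)` and `(0, 2zℓ, 0)`.
Candidate `a` can be restored by recounting at most `ℓ − 1` distorted districts
iff some subset of `X` sums to `y/2`.

The multiset `X` (of `ℓ` positive integers, each divisible by 4) is modeled as
a function `X : Fin ℓ → ℕ`.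
-/

namespace PVPartition5

variable {C : Type*}

/-- Total PV score of candidate `a` in profile `v`. -/
def score {D : Type*} [Fintype D] (v : D → C → ℕ) (a : C) : ℕ := ∑ i, v i a

/-- `a` beats `b` under PV (ties broken by the linear order: `b < a` means `a ≻ b`). -/
def beats {D : Type*} [Fintype D] [LT C] (v : D → C → ℕ) (a b : C) : Prop :=
  score v b < score v a ∨ (score v a = score v b ∧ b < a)

/-- `a` is the PV winner of profile `v`. -/
def winner {D : Type*} [Fintype D] [LT C] (v : D → C → ℕ) (a : C) : Prop :=
  ∀ b, b ≠ a → beats v a b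

/-- The recounted profile: true votes on districts in `R`, distorted votes elsewhere. -/
def recount {D : Type*} [DecidableEq D] (v vt : D → C → ℕ) (R : Finset D) : D → C → ℕ :=
  fun i a => if i ∈ R then v i a else vt i a

theorem stmt5 [Fintype C] [LinearOrder C]
    (a b p : C) (hab : a ≠ b) (hap : a ≠ p) (hbp : b ≠ p)
    (hC : ∀ c : C, c = a ∨ c = b ∨ c = p)
    (ℓ z : ℕ) (hℓ : 1 ≤ ℓ) (hz : 1 ≤ z)
    (X : Fin ℓ → ℕ) (hXpos : ∀ i, 0 < X i) (hX4 : ∀ i, 4 ∣ X i)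
    (y : ℕ) (hy : y = ∑ i, X i)
    -- the true and distorted profiles
    (v vt : (Fin ℓ ⊕ Fin (2 * z * ℓ) ⊕ Fin 2) → C → ℕ)
    -- districts indexed by `X`: true votes `(0, 2xℓ, 0)`, distorted `(0, 0, 2xℓ)`
    (hv1 : ∀ i : Fin ℓ, ∀ c, v (Sum.inl i) c = if c = b then 2 * X i * ℓ else 0)
    (hvt1 : ∀ i : Fin ℓ, ∀ c, vt (Sum.inl i) c = if c = p then 2 * X i * ℓ else 0)
    -- `2zℓ` districts: true votes `(1, 0, 0)`, distorted `(0, 0, 1)`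
    (hv2 : ∀ j : Fin (2 * z * ℓ), ∀ c, v (Sum.inr (Sum.inl j)) c = if c = a then 1 else 0)
    (hvt2 : ∀ j : Fin (2 * z * ℓ), ∀ c, vt (Sum.inr (Sum.inl j)) c = if c = p then 1 else 0)
    -- two undistorted districts `(2zℓ + yℓ + 2ℓ, 0, 0)` and `(0, 2zℓ, 0)`
    (hv3 : ∀ c, v (Sum.inr (Sum.inr 0)) c = if c = a then 2 * z * ℓ + y * ℓ + 2 * ℓ else 0)
    (hv4 : ∀ c, v (Sum.inr (Sum.inr 1)) c = if c = b then 2 * z * ℓ else 0)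
    (hvt34 : ∀ j : Fin 2, ∀ c, vt (Sum.inr (Sum.inr j)) c = v (Sum.inr (Sum.inr j)) c) :
    (∃ R : Finset (Fin ℓ ⊕ Fin (2 * z * ℓ) ⊕ Fin 2),
        (∀ j : Fin 2, Sum.inr (Sum.inr j) ∉ R) ∧ R.card ≤ ℓ - 1 ∧
        winner (recount v vt R) a) ↔
      (∃ S : Finset (Fin ℓ), 2 * ∑ i ∈ S, X i = y) := by
  classical
  have key : ∀ R : Finset (Fin ℓ ⊕ Fin (2 * z * ℓ) ⊕ Fin 2),
      score (recount v vt R) a = 2 * z * ℓ + y * ℓ + 2 * ℓ +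
        (Finset.univ.filter (fun j => Sum.inr (Sum.inl j) ∈ R)).card ∧
      score (recount v vt R) b = 2 * z * ℓ +
        2 * (∑ i ∈ Finset.univ.filter (fun i => Sum.inl i ∈ R), X i) * ℓ ∧
      score (recount v vt R) p +
        2 * (∑ i ∈ Finset.univ.filter (fun i => Sum.inl i ∈ R), X i) * ℓ +
        (Finset.univ.filter (fun j => Sum.inr (Sum.inl j) ∈ R)).card
        = 2 * y * ℓ + 2 * z * ℓ := by
    intro R
    refine ⟨?_, ?_, ?_⟩
    · simp only [score, recount, Fintype.sum_sum_type, Fin.sum_univ_two, hv1, hvt1, hv2, hvt2,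
        hvt34, hv3, hv4, ite_self, if_neg hab, if_neg hap, Finset.sum_const_zero,
        Finset.card_filter, if_true]
      ring
    · simp only [score, recount, Fintype.sum_sum_type, Fin.sum_univ_two, hv1, hvt1, hv2, hvt2,
        hvt34, hv3, hv4, ite_self, if_neg hab.symm, if_neg hbp, Finset.sum_const_zero,
        if_true]
      rw [← Finset.sum_filter, Finset.mul_sum, Finset.sum_mul]
      ring
    · have h1 : (∑ i : Fin ℓ, if Sum.inl i ∈ R then 0 else 2 * X i * ℓ) +
          2 * (∑ i ∈ Finset.univ.filter (fun i => Sum.inl i ∈ R), X i) * ℓ = 2 * y * ℓ := by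
        rw [hy, Finset.mul_sum, Finset.sum_mul, Finset.mul_sum, Finset.sum_mul,
          Finset.sum_filter, ← Finset.sum_add_distrib]
        refine Finset.sum_congr rfl fun i _ => ?_
        split_ifs <;> simp
      have h2 : (∑ j : Fin (2 * z * ℓ), if Sum.inr (Sum.inl j) ∈ R then 0 else 1) +
          (Finset.univ.filter (fun j => Sum.inr (Sum.inl j) ∈ R)).card = 2 * z * ℓ := by
        rw [Finset.card_filter, ← Finset.sum_add_distrib]
        trans ∑ j : Fin (2 * z * ℓ), 1
        · refine Finset.sum_congr rfl fun i _ => ?_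
          split_ifs <;> simp
        · simp
      simp only [score, recount, Fintype.sum_sum_type, Fin.sum_univ_two, hv1, hvt1, hv2, hvt2,
        hvt34, hv3, hv4, ite_self, if_neg hap.symm, if_neg hbp.symm,
        if_true]
      omega
  constructor
  · rintro ⟨R, -, hcard, hw⟩
    obtain ⟨ka, kb, kp⟩ := key R
    have hT : (Finset.univ.filter
        (fun j : Fin (2 * z * ℓ) => Sum.inr (Sum.inl j) ∈ R)).card ≤ R.card := by
      apply Finset.card_le_card_of_injOn (fun j => Sum.inr (Sum.inl j))
      · intro j hj
        simpa using hj
      · intro i _ j _ h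
        simpa using h
    have hb : score (recount v vt R) b ≤ score (recount v vt R) a := by
      rcases hw b hab.symm with h | h
      · exact h.le
      · exact h.1.ge
    have hp : score (recount v vt R) p ≤ score (recount v vt R) a := by
      rcases hw p hap.symm with h | h
      · exact h.le
      · exact h.1.ge
    refine ⟨Finset.univ.filter (fun i => Sum.inl i ∈ R), ?_⟩
    have hs4 : 4 ∣ ∑ i ∈ Finset.univ.filter (fun i => Sum.inl i ∈ R), X i :=
      Finset.dvd_sum fun i _ => hX4 i
    have hy4 : 4 ∣ y := hy ▸ Finset.dvd_sum fun i _ => hX4 i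
    generalize (∑ i ∈ Finset.univ.filter (fun i => Sum.inl i ∈ R), X i) = s at *
    generalize (Finset.univ.filter
        (fun j : Fin (2 * z * ℓ) => Sum.inr (Sum.inl j) ∈ R)).card = t at *
    have ht : t < ℓ := by omega
    have e1 : 2 * s < y + 3 := by
      apply Nat.lt_of_mul_lt_mul_right (a := ℓ)
      nlinarith
    have e2 : 2 * y < y + 2 * s + 4 := by
      apply Nat.lt_of_mul_lt_mul_right (a := ℓ)
      nlinarith
    omega
  · rintro ⟨S, hS⟩
    obtain ⟨ka, kb, kp⟩ := key (S.map ⟨Sum.inl, Sum.inl_injective⟩)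
    have hypos : 0 < y := by
      rw [hy]
      exact Finset.sum_pos (fun i _ => hXpos i) ⟨⟨0, hℓ⟩, Finset.mem_univ _⟩
    have hne : S ≠ Finset.univ := by
      rintro rfl
      omega
    have hlt : S.card < ℓ := by
      simpa using Finset.card_lt_univ_of_notMem
        (Classical.choose_spec (not_forall.mp (mt Finset.eq_univ_iff_forall.mpr hne)))
    refine ⟨S.map ⟨Sum.inl, Sum.inl_injective⟩, by simp, by rw [Finset.card_map]; omega, ?_⟩
    have f1 : Finset.univ.filter (fun i : Fin ℓ =>
        (Sum.inl i : Fin ℓ ⊕ Fin (2 * z * ℓ) ⊕ Fin 2) ∈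
          S.map ⟨Sum.inl, Sum.inl_injective⟩) = S := by
      ext i; simp
    rw [f1, hS] at kb kp
    intro c hc
    left
    have : 2 * y * ℓ = y * ℓ + y * ℓ := by ring
    rcases hC c with rfl | rfl | rfl
    · exact absurd rfl hc
    · omega
    · omega

end PVPartition5
end

section
/- Let X be a multiset of ℓ nonzero integers with Σ_{x∈X} x > 0, let X⁺ = {x ∈ X : x > 0}, X⁻ = {x ∈ X : x < 0}, and y = Σ_{x∈X} 2|x|. Consider the PV election with candidates {a, b, p} and the following districts (votes listed as (a, b, p)): for each x ∈ X⁺ a district with true votes (0, 2x, 0) distorted to (0, 0, 2x); for each x ∈ X⁻ a district with true votes (0, 0, −2x) distorted to (0, −2x, 0); and three undistorted districts with votes (y+1, 0, 0), (0, y − Σ_{x∈X⁺} 2x, 0), and (0, 0, y + Σ_{x∈X⁻} 2x). Then there exists a set R of at most ℓ − 1 distorted districts such that a is the PV winner of the profile recounted on R, if and only if there exists a nonempty subset X' ⊆ X with Σ_{x∈X'} x = 0. -/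
/-!
Statement 7: correctness of the Subset-Sum-based instance in the NP-hardness
proof of PV-Rec for three candidates (Theorem `PV-Rec-hardness` (i)).
The multiset `X` of `ℓ` nonzero integers is modeled as `X : Fin ℓ → ℤ`.
Districts (votes listed `(a, b, p)`): for each `x ∈ X⁺` a district
`(0, 2x, 0)` distorted to `(0, 0, 2x)`; for each `x ∈ X⁻` a district
`(0, 0, −2x)` distorted to `(0, −2x, 0)`; three undistorted districts
`(y+1, 0, 0)`, `(0, y − Σ_{x∈X⁺}2x, 0)`, `(0, 0, y + Σ_{x∈X⁻}2x)`, where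
`y = Σ_{x∈X} 2|x|`. Candidate `a` can be restored by recounting at most
`ℓ − 1` distorted districts iff some nonempty subset of `X` sums to `0`.
-/

namespace PVSubsetSum7

variable {C : Type*}

/-- Total PV score of candidate `a` in profile `v`. -/
def score {D : Type*} [Fintype D] (v : D → C → ℕ) (a : C) : ℕ := ∑ i, v i a

/-- `a` beats `b` under PV (ties broken by the linear order: `b < a` means `a ≻ b`). -/
def beats {D : Type*} [Fintype D] [LT C] (v : D → C → ℕ) (a b : C) : Prop :=
  score v b < score v a ∨ (score v a = score v b ∧ b < a)

/-- `a` is the PV winner of profile `v`. -/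
def winner {D : Type*} [Fintype D] [LT C] (v : D → C → ℕ) (a : C) : Prop :=
  ∀ b, b ≠ a → beats v a b

/-- The recounted profile: true votes on districts in `R`, distorted votes elsewhere. -/
def recount {D : Type*} [DecidableEq D] (v vt : D → C → ℕ) (R : Finset D) : D → C → ℕ :=
  fun i a => if i ∈ R then v i a else vt i a

theorem stmt7 [Fintype C] [LinearOrder C]
    (a b p : C) (hab : a ≠ b) (hap : a ≠ p) (hbp : b ≠ p)
    (hC : ∀ c : C, c = a ∨ c = b ∨ c = p)
    (ℓ : ℕ) (X : Fin ℓ → ℤ) (hX0 : ∀ i, X i ≠ 0) (hXsum : 0 < ∑ i, X i)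
    (y : ℕ) (hy : y = ∑ i, 2 * (X i).natAbs)
    (v vt : (Fin ℓ ⊕ Fin 3) → C → ℕ)
    -- for `x > 0`: true `(0,2x,0)` distorted `(0,0,2x)`; for `x < 0`:
    -- true `(0,0,−2x)` distorted `(0,−2x,0)` (stated uniformly via `Int.toNat`)
    (hv1 : ∀ i : Fin ℓ, ∀ c, v (Sum.inl i) c =
      if c = b then (2 * X i).toNat else if c = p then (-(2 * X i)).toNat else 0)
    (hvt1 : ∀ i : Fin ℓ, ∀ c, vt (Sum.inl i) c =
      if c = p then (2 * X i).toNat else if c = b then (-(2 * X i)).toNat else 0)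
    -- three undistorted districts
    (hv2 : ∀ c, v (Sum.inr 0) c = if c = a then y + 1 else 0)
    (hv3 : ∀ c, v (Sum.inr 1) c =
      if c = b then y - ∑ i, (2 * X i).toNat else 0)
    (hv4 : ∀ c, v (Sum.inr 2) c =
      if c = p then y - ∑ i, (-(2 * X i)).toNat else 0)
    (hvt234 : ∀ j : Fin 3, ∀ c, vt (Sum.inr j) c = v (Sum.inr j) c) :
    (∃ R : Finset (Fin ℓ ⊕ Fin 3),
        (∀ j : Fin 3, Sum.inr j ∉ R) ∧ R.card ≤ ℓ - 1 ∧
        winner (recount v vt R) a) ↔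
      (∃ S : Finset (Fin ℓ), S.Nonempty ∧ ∑ i ∈ S, X i = 0) := by
  have hP : ∑ i, (2 * X i).toNat ≤ y := by
    rw [hy]; exact Finset.sum_le_sum fun i _ => by omega
  have hN : ∑ i, (-(2 * X i)).toNat ≤ y := by
    rw [hy]; exact Finset.sum_le_sum fun i _ => by omega
  have hlpos : 0 < ℓ := by
    rcases Nat.eq_zero_or_pos ℓ with h | h
    · subst h; simp at hXsum
    · exact h
  have key : ∀ R : Finset (Fin ℓ ⊕ Fin 3), (∀ j : Fin 3, Sum.inr j ∉ R) →
      (winner (recount v vt R) a ↔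
        ∑ i ∈ Finset.univ.filter (fun i : Fin ℓ => Sum.inl i ∉ R), X i = 0) := by
    intro R hR
    have ha : score (recount v vt R) a = y + 1 := by
      simp [score, recount, Fintype.sum_sum_type, Fin.sum_univ_three, hR, hvt234, hv1, hvt1,
        hv2, hv3, hv4, hab, hap]
    have hb : (score (recount v vt R) b : ℤ) =
        y - 2 * ∑ i ∈ Finset.univ.filter (fun i : Fin ℓ => Sum.inl i ∉ R), X i := by
      have h1 : score (recount v vt R) b =
          (∑ i : Fin ℓ, if Sum.inl i ∈ R then (2 * X i).toNat else (-(2 * X i)).toNat)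
            + (y - ∑ i, (2 * X i).toNat) := by
        simp [score, recount, Fintype.sum_sum_type, Fin.sum_univ_three, hR, hvt234, hv1, hvt1,
          hv2, hv3, hv4, hab.symm, hbp]
      rw [h1, Nat.cast_add, Nat.cast_sub hP, Nat.cast_sum, Nat.cast_sum, Finset.sum_filter,
        Finset.mul_sum]
      have h2 : (∑ i : Fin ℓ, ((if Sum.inl i ∈ R then (2 * X i).toNat
            else (-(2 * X i)).toNat : ℕ) : ℤ)) =
          ∑ i, ((2 * X i).toNat : ℤ) - ∑ i, 2 * (if Sum.inl i ∉ R then X i else 0) := by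
        rw [← Finset.sum_sub_distrib]
        refine Finset.sum_congr rfl fun i _ => ?_
        by_cases h : Sum.inl i ∈ R <;> simp only [h, if_true, if_false, not_true, not_false_iff] <;>
          omega
      rw [h2]; ring
    have hp : (score (recount v vt R) p : ℤ) =
        y + 2 * ∑ i ∈ Finset.univ.filter (fun i : Fin ℓ => Sum.inl i ∉ R), X i := by
      have h1 : score (recount v vt R) p =
          (∑ i : Fin ℓ, if Sum.inl i ∈ R then (-(2 * X i)).toNat else (2 * X i).toNat)
            + (y - ∑ i, (-(2 * X i)).toNat) := by
        simp [score, recount, Fintype.sum_sum_type, Fin.sum_univ_three, hR, hvt234, hv1, hvt1,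
          hv2, hv3, hv4, hap.symm, hbp.symm]
      rw [h1, Nat.cast_add, Nat.cast_sub hN, Nat.cast_sum, Nat.cast_sum, Finset.sum_filter,
        Finset.mul_sum]
      have h2 : (∑ i : Fin ℓ, ((if Sum.inl i ∈ R then (-(2 * X i)).toNat
            else (2 * X i).toNat : ℕ) : ℤ)) =
          ∑ i, ((-(2 * X i)).toNat : ℤ) + ∑ i, 2 * (if Sum.inl i ∉ R then X i else 0) := by
        rw [← Finset.sum_add_distrib]
        refine Finset.sum_congr rfl fun i _ => ?_
        by_cases h : Sum.inl i ∈ R <;> simp only [h, if_true, if_false, not_true, not_false_iff] <;>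
          omega
      rw [h2]; ring
    constructor
    · intro hw
      have h1 := hw b hab.symm
      have h2 := hw p hap.symm
      unfold beats at h1 h2
      omega
    · intro h0 c hc
      left
      rcases hC c with rfl | rfl | rfl
      · exact absurd rfl hc
      · omega
      · omega
  constructor
  · rintro ⟨R, hR, hcard, hw⟩
    refine ⟨_, ?_, (key R hR).1 hw⟩
    by_contra hne
    rw [Finset.not_nonempty_iff_eq_empty, Finset.filter_eq_empty_iff] at hne
    have hsub : Finset.univ.image (Sum.inl : Fin ℓ → Fin ℓ ⊕ Fin 3) ⊆ R := by
      intro x hx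
      obtain ⟨i, -, rfl⟩ := Finset.mem_image.1 hx
      exact not_not.1 (hne (Finset.mem_univ i))
    have h3 := Finset.card_le_card hsub
    rw [Finset.card_image_of_injective _ Sum.inl_injective, Finset.card_univ,
      Fintype.card_fin] at h3
    omega
  · rintro ⟨S, hS, h0⟩
    have hR : ∀ j : Fin 3, Sum.inr j ∉ Sᶜ.image (Sum.inl : Fin ℓ → Fin ℓ ⊕ Fin 3) := by simp
    refine ⟨Sᶜ.image Sum.inl, hR, ?_, (key _ hR).2 ?_⟩
    · rw [Finset.card_image_of_injective _ Sum.inl_injective, Finset.card_compl,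
        Fintype.card_fin]
      have := hS.card_pos
      omega
    · rw [← h0]
      congr 1
      ext i
      simp

end PVSubsetSum7
end

section
/- Let E be a set with |E| = 3ℓ (ℓ ≥ 1) and let 𝒮 be a collection of s three-element subsets of E whose union is E. Consider the PV election with candidate set {j_e : e ∈ E} ∪ {a, b} and the following districts: for each S ∈ 𝒮 a district D_S whose true votes are 2 for a, 6 for b, 2 for each j_e with e ∉ S, and 0 for each j_e with e ∈ S, distorted so that b gets 0 votes and every other candidate gets 2 votes; and one undistorted district with 6ℓs votes for a, 0 votes for b, and 6ℓs + 1 votes for j_e for every e ∈ E. Then there exists a set R of at most ℓ districts D_S such that a is the PV winner of the profile recounted on R, if and only if there is a sub-collection Q ⊆ 𝒮 with |Q| ≤ ℓ whose union is E (equivalently, E has an exact cover by ℓ sets from 𝒮). -/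
/-!
Statement 8: correctness of the X3C-based instance in the NP-hardness proof of
PV-Rec in unary (Theorem `PV-Rec-hardness` (ii)). Ground set `E` of size `3ℓ`,
collection `𝒮` of `s` three-element subsets covering `E`; candidates
`{j_e : e ∈ E} ∪ {a, b}`. For each `S ∈ 𝒮` a district `D_S` (true votes: 2 for
`a`, 6 for `b`, 2 for each `j_e` with `e ∉ S`, 0 for each `j_e` with `e ∈ S`;
distorted: 0 for `b`, 2 for everyone else) and one undistorted district
(`6ℓs` for `a`, 0 for `b`, `6ℓs + 1` for each `j_e`). Candidate `a` can be
restored by recounting at most `ℓ` districts `D_S` iff `E` is covered by at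
most `ℓ` sets of `𝒮`.
-/

namespace PVX3C8

variable {C : Type*}

/-- Total PV score of candidate `a` in profile `v`. -/
def score {D : Type*} [Fintype D] (v : D → C → ℕ) (a : C) : ℕ := ∑ i, v i a

/-- `a` beats `b` under PV (ties broken by the linear order: `b < a` means `a ≻ b`). -/
def beats {D : Type*} [Fintype D] [LT C] (v : D → C → ℕ) (a b : C) : Prop :=
  score v b < score v a ∨ (score v a = score v b ∧ b < a)

/-- `a` is the PV winner of profile `v`. -/
def winner {D : Type*} [Fintype D] [LT C] (v : D → C → ℕ) (a : C) : Prop :=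
  ∀ b, b ≠ a → beats v a b

/-- The recounted profile: true votes on districts in `R`, distorted votes elsewhere. -/
def recount {D : Type*} [DecidableEq D] (v vt : D → C → ℕ) (R : Finset D) : D → C → ℕ :=
  fun i a => if i ∈ R then v i a else vt i a

theorem stmt8 {E : Type*} [Fintype E] [DecidableEq E] [Fintype C] [LinearOrder C]
    (ℓ s : ℕ) (hℓ : 1 ≤ ℓ) (hE : Fintype.card E = 3 * ℓ)
    (𝒮 : Fin s → Finset E) (h3 : ∀ S, (𝒮 S).card = 3) (hcov : ∀ e : E, ∃ S, e ∈ 𝒮 S)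
    -- the candidates: `j e` for `e ∈ E`, plus `a` and `b`
    (j : E → C) (hj : Function.Injective j)
    (a b : C) (hab : a ≠ b) (hja : ∀ e, j e ≠ a) (hjb : ∀ e, j e ≠ b)
    (hC : ∀ c : C, c = a ∨ c = b ∨ ∃ e, c = j e)
    (v vt : (Fin s ⊕ Fin 1) → C → ℕ)
    -- district `D_S` for each `S ∈ 𝒮`, true votes:
    (hva : ∀ S : Fin s, v (Sum.inl S) a = 2)
    (hvb : ∀ S : Fin s, v (Sum.inl S) b = 6)
    (hvj : ∀ S : Fin s, ∀ e : E, v (Sum.inl S) (j e) = if e ∈ 𝒮 S then 0 else 2)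
    -- district `D_S`, distorted votes: `b` gets 0, everyone else gets 2
    (hvtb : ∀ S : Fin s, vt (Sum.inl S) b = 0)
    (hvto : ∀ S : Fin s, ∀ c, c ≠ b → vt (Sum.inl S) c = 2)
    -- the undistorted district `D₀`
    (hva0 : ∀ i : Fin 1, v (Sum.inr i) a = 6 * ℓ * s)
    (hvb0 : ∀ i : Fin 1, v (Sum.inr i) b = 0)
    (hvj0 : ∀ i : Fin 1, ∀ e : E, v (Sum.inr i) (j e) = 6 * ℓ * s + 1)
    (hvt0 : ∀ i : Fin 1, ∀ c, vt (Sum.inr i) c = v (Sum.inr i) c) :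
    (∃ R : Finset (Fin s), R.card ≤ ℓ ∧
        winner (recount v vt (R.image Sum.inl)) a) ↔
      (∃ Q : Finset (Fin s), Q.card ≤ ℓ ∧ ∀ e : E, ∃ S ∈ Q, e ∈ 𝒮 S) := by
  have sc : ∀ (R : Finset (Fin s)) (c : C), score (recount v vt (R.image Sum.inl)) c =
      (∑ S : Fin s, if S ∈ R then v (Sum.inl S) c else vt (Sum.inl S) c) + v (Sum.inr 0) c := by
    intro R c
    simp [score, recount, hvt0]
  have sa : ∀ R : Finset (Fin s),
      score (recount v vt (R.image Sum.inl)) a = 2 * s + 6 * ℓ * s := by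
    intro R
    rw [sc, hva0]
    have : ∀ S : Fin s, (if S ∈ R then v (Sum.inl S) a else vt (Sum.inl S) a) = 2 := by
      intro S
      rw [hva, hvto S a hab, ite_self]
    simp only [this]
    simp [mul_comm]
  have sb : ∀ R : Finset (Fin s),
      score (recount v vt (R.image Sum.inl)) b = 6 * R.card := by
    intro R
    rw [sc, hvb0]
    simp [hvb, hvtb, mul_comm]
  have sj : ∀ (R : Finset (Fin s)) (e : E),
      score (recount v vt (R.image Sum.inl)) (j e) + 2 * (R.filter (fun S => e ∈ 𝒮 S)).card
        = 2 * s + 6 * ℓ * s + 1 := by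
    intro R e
    rw [sc, hvj0]
    have h1 : 2 * (R.filter (fun S => e ∈ 𝒮 S)).card
        = ∑ S : Fin s, if S ∈ R ∧ e ∈ 𝒮 S then 2 else 0 := by
      rw [← Finset.sum_filter, Finset.sum_const, smul_eq_mul, mul_comm]
      congr 2
      ext S
      simp
    have h2 : (∑ S : Fin s, if S ∈ R then v (Sum.inl S) (j e) else vt (Sum.inl S) (j e))
        + (∑ S : Fin s, if S ∈ R ∧ e ∈ 𝒮 S then 2 else 0) = 2 * s := by
      rw [← Finset.sum_add_distrib]
      have : ∀ S : Fin s, (if S ∈ R then v (Sum.inl S) (j e) else vt (Sum.inl S) (j e))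
          + (if S ∈ R ∧ e ∈ 𝒮 S then 2 else 0) = 2 := by
        intro S
        rw [hvj, hvto S _ (hjb e)]
        by_cases hR : S ∈ R <;> by_cases he : e ∈ 𝒮 S <;> simp [hR, he]
      simp only [this]
      simp [mul_comm]
    omega
  have hs : 1 ≤ s := by
    have : 0 < Fintype.card E := by omega
    obtain ⟨e⟩ := Fintype.card_pos_iff.mp this
    obtain ⟨S, _⟩ := hcov e
    have := S.2
    omega
  constructor
  · rintro ⟨R, hR, hw⟩
    refine ⟨R, hR, fun e => ?_⟩
    have h1 := hw (j e) (hja e)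
    have h2 := sj R e
    have h3 := sa R
    have hpos : 0 < (R.filter (fun S => e ∈ 𝒮 S)).card := by
      unfold beats at h1
      rcases h1 with h1 | ⟨h1, _⟩ <;> omega
    obtain ⟨S, hS⟩ := Finset.card_pos.mp hpos
    rw [Finset.mem_filter] at hS
    exact ⟨S, hS⟩
  · rintro ⟨Q, hQ, hq⟩
    refine ⟨Q, hQ, fun c hc => Or.inl ?_⟩
    rw [sa]
    rcases hC c with rfl | rfl | ⟨e, rfl⟩
    · exact absurd rfl hc
    · rw [sb]
      have : 6 * ℓ * 1 ≤ 6 * ℓ * s := Nat.mul_le_mul_left _ hs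
      omega
    · have h2 := sj Q e
      obtain ⟨S, hS, he⟩ := hq e
      have hpos : 0 < (Q.filter (fun S => e ∈ 𝒮 S)).card :=
        Finset.card_pos.mpr ⟨S, Finset.mem_filter.mpr ⟨hS, he⟩⟩
      omega

end PVX3C8
end

section
/- Let X be a multiset of ℓ ≥ 2 nonzero integers and y = max_{x∈X} 2|x|. Consider the PV election with candidates {a, b, p} and the following districts (votes listed as (a, b, p)): for each x ∈ X a district (2y + 4x, 2y − 4x, 0); ℓ − 1 districts (2y, 2y, 0); for each x ∈ X two districts (y − 2x, y + 2x, 0); and three districts (y, y, 0), (y, y, 0), (0, 0, 1). Then there exists a set M of at most ℓ districts and a profile ṽ agreeing with the true profile outside M and having the same total number of votes in every district, such that p is the PV winner of ṽ, if and only if there exists a nonempty subset X' ⊆ X with Σ_{x∈X'} x = 0. -/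
/-!
Statement 9: correctness of the Subset-Sum-based instance in the NP-hardness
proof of PV-Man with three candidates and defender budget 0
(Theorem `PV-Man-hardness` (i)). The multiset `X` of `ℓ ≥ 2` nonzero integers
is modeled as `X : Fin ℓ → ℤ`, and `y = max_{x∈X} 2|x|`. Districts (votes
`(a, b, p)`): for each `x ∈ X` a district `(2y+4x, 2y−4x, 0)`; `ℓ−1` districts
`(2y, 2y, 0)`; for each `x ∈ X` two districts `(y−2x, y+2x, 0)`; and three
districts `(y,y,0)`, `(y,y,0)`, `(0,0,1)`. The attacker can make `p` the PV
winner by redistributing all votes within at most `ℓ` districts iff some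
nonempty subset of `X` sums to `0`.
-/

namespace PVMan9

variable {C : Type*}

/-- Total PV score of candidate `a` in profile `v`. -/
def score {D : Type*} [Fintype D] (v : D → C → ℕ) (a : C) : ℕ := ∑ i, v i a

/-- `a` beats `b` under PV (ties broken by the linear order: `b < a` means `a ≻ b`). -/
def beats {D : Type*} [Fintype D] [LT C] (v : D → C → ℕ) (a b : C) : Prop :=
  score v b < score v a ∨ (score v a = score v b ∧ b < a)

/-- `a` is the PV winner of profile `v`. -/
def winner {D : Type*} [Fintype D] [LT C] (v : D → C → ℕ) (a : C) : Prop :=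
  ∀ b, b ≠ a → beats v a b

theorem stmt9 [Fintype C] [LinearOrder C]
    (a b p : C) (hab : a ≠ b) (hap : a ≠ p) (hbp : b ≠ p)
    (hC : ∀ c : C, c = a ∨ c = b ∨ c = p)
    (ℓ : ℕ) (hℓ : 2 ≤ ℓ) (X : Fin ℓ → ℤ) (hX0 : ∀ i, X i ≠ 0)
    (y : ℕ) (hy : y = Finset.univ.sup (fun i => 2 * (X i).natAbs))
    (v : (Fin ℓ ⊕ Fin (ℓ - 1) ⊕ (Fin ℓ × Fin 2) ⊕ Fin 3) → C → ℕ)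
    -- set `I₁`: for each `x ∈ X`, votes `(2y + 4x, 2y − 4x, 0)`
    (hv1a : ∀ i : Fin ℓ, v (Sum.inl i) a = (2 * (y : ℤ) + 4 * X i).toNat)
    (hv1b : ∀ i : Fin ℓ, v (Sum.inl i) b = (2 * (y : ℤ) - 4 * X i).toNat)
    (hv1p : ∀ i : Fin ℓ, v (Sum.inl i) p = 0)
    -- set `I₂`: `ℓ − 1` districts with votes `(2y, 2y, 0)`
    (hv2a : ∀ i : Fin (ℓ - 1), v (Sum.inr (Sum.inl i)) a = 2 * y)
    (hv2b : ∀ i : Fin (ℓ - 1), v (Sum.inr (Sum.inl i)) b = 2 * y)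
    (hv2p : ∀ i : Fin (ℓ - 1), v (Sum.inr (Sum.inl i)) p = 0)
    -- set `I₃`: for each `x ∈ X`, two districts with votes `(y − 2x, y + 2x, 0)`
    (hv3a : ∀ i : Fin ℓ, ∀ t : Fin 2, v (Sum.inr (Sum.inr (Sum.inl (i, t)))) a =
      ((y : ℤ) - 2 * X i).toNat)
    (hv3b : ∀ i : Fin ℓ, ∀ t : Fin 2, v (Sum.inr (Sum.inr (Sum.inl (i, t)))) b =
      ((y : ℤ) + 2 * X i).toNat)
    (hv3p : ∀ i : Fin ℓ, ∀ t : Fin 2, v (Sum.inr (Sum.inr (Sum.inl (i, t)))) p = 0)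
    -- set `I₄`: districts `(y, y, 0)`, `(y, y, 0)`, `(0, 0, 1)`
    (hv4 : ∀ t : Fin 3, ∀ c, v (Sum.inr (Sum.inr (Sum.inr t))) c =
      if t.val ≤ 1 then (if c = a ∨ c = b then y else 0)
      else (if c = p then 1 else 0)) :
    (∃ M : Finset (Fin ℓ ⊕ Fin (ℓ - 1) ⊕ (Fin ℓ × Fin 2) ⊕ Fin 3),
        M.card ≤ ℓ ∧
        ∃ vt : (Fin ℓ ⊕ Fin (ℓ - 1) ⊕ (Fin ℓ × Fin 2) ⊕ Fin 3) → C → ℕ,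
          (∀ i ∉ M, ∀ c, vt i c = v i c) ∧
          (∀ i, ∑ c, vt i c = ∑ c, v i c) ∧
          winner vt p) ↔
      (∃ S : Finset (Fin ℓ), S.Nonempty ∧ ∑ i ∈ S, X i = 0) := by
  classical
  have hsumC : ∀ f : C → ℕ, ∑ c, f c = f a + f b + f p := by
    intro f
    have hu : (Finset.univ : Finset C) = {a, b, p} := by
      ext c
      simpa using hC c
    rw [hu, Finset.sum_insert (by simp [hab, hap]), Finset.sum_insert (by simp [hbp]),
      Finset.sum_singleton, add_assoc]
  have hXy : ∀ i, 2 * (X i).natAbs ≤ y := by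
    intro i
    rw [hy]
    exact Finset.le_sup (f := fun i => 2 * (X i).natAbs) (Finset.mem_univ i)
  have hy2 : 2 ≤ y := by
    have h1 := hXy ⟨0, by omega⟩
    have h2 := hX0 ⟨0, by omega⟩
    omega
  have z1a : ∀ i : Fin ℓ, (v (Sum.inl i) a : ℤ) = 2 * y + 4 * X i := by
    intro i
    have := hXy i
    rw [hv1a]; omega
  have z1b : ∀ i : Fin ℓ, (v (Sum.inl i) b : ℤ) = 2 * y - 4 * X i := by
    intro i
    have := hXy i
    rw [hv1b]; omega
  have z3a : ∀ (i : Fin ℓ) (t : Fin 2),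
      (v (Sum.inr (Sum.inr (Sum.inl (i, t)))) a : ℤ) = y - 2 * X i := by
    intro i t
    have := hXy i
    rw [hv3a]; omega
  have z3b : ∀ (i : Fin ℓ) (t : Fin 2),
      (v (Sum.inr (Sum.inr (Sum.inl (i, t)))) b : ℤ) = y + 2 * X i := by
    intro i t
    have := hXy i
    rw [hv3b]; omega
  have z4 : ∀ t : Fin 3, (v (Sum.inr (Sum.inr (Sum.inr t))) a : ℤ) +
      v (Sum.inr (Sum.inr (Sum.inr t))) b ≤ 2 * y := by
    intro t
    rw [hv4, hv4, if_neg hap, if_neg hbp, if_pos (Or.inl rfl), if_pos (Or.inr rfl)]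
    by_cases ht : t.val ≤ 1
    · rw [if_pos ht]; omega
    · rw [if_neg ht]; omega
  have hl1 : ((ℓ - 1 : ℕ) : ℤ) = ℓ - 1 := by omega
  have tota : ∑ d, (v d a : ℤ) = 6 * (y * ℓ) := by
    simp only [Fintype.sum_sum_type, Fintype.sum_prod_type, Fin.sum_univ_two, z1a, z3a, hv2a,
      Fin.sum_univ_three, hv4, Finset.sum_add_distrib, Finset.sum_sub_distrib, ← Finset.mul_sum]
    simp [hap, hl1]
    ring
  have totb : ∑ d, (v d b : ℤ) = 6 * (y * ℓ) := by
    simp only [Fintype.sum_sum_type, Fintype.sum_prod_type, Fin.sum_univ_two, z1b, z3b, hv2b,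
      Fin.sum_univ_three, hv4, Finset.sum_add_distrib, Finset.sum_sub_distrib, ← Finset.mul_sum]
    simp [hbp, hl1]
    ring
  have totp : ∑ d, (v d p : ℤ) = 1 := by
    simp only [Fintype.sum_sum_type, Fintype.sum_prod_type, Fin.sum_univ_two, hv1p, hv2p, hv3p,
      Fin.sum_univ_three, hv4]
    simp [hap.symm, hbp.symm]
  constructor
  · rintro ⟨M, hM, vt, hout, htot, hwin⟩
    have hwa := hwin a hap
    have hwb := hwin b hbp
    have hPA : ∑ d, (vt d a : ℤ) ≤ ∑ d, (vt d p : ℤ) := by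
      have : score vt a ≤ score vt p := by
        rcases hwa with h | h
        · exact h.le
        · exact h.1.ge
      unfold score at this
      exact_mod_cast this
    have hPB : ∑ d, (vt d b : ℤ) ≤ ∑ d, (vt d p : ℤ) := by
      have : score vt b ≤ score vt p := by
        rcases hwb with h | h
        · exact h.le
        · exact h.1.ge
      unfold score at this
      exact_mod_cast this
    have hd : ∀ d, (vt d a : ℤ) + vt d b + vt d p = v d a + v d b + v d p := by
      intro d
      have := htot d
      rw [hsumC, hsumC] at this
      exact_mod_cast this
    have hT : ∑ d, (vt d a : ℤ) + ∑ d, (vt d b : ℤ) + ∑ d, (vt d p : ℤ) = 12 * (y * ℓ) + 1 := by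
      rw [← Finset.sum_add_distrib, ← Finset.sum_add_distrib, Finset.sum_congr rfl (fun d _ => hd d),
        Finset.sum_add_distrib, Finset.sum_add_distrib, tota, totb, totp]
      ring
    have hP : ∑ d, (vt d p : ℤ) ≤ 1 + ∑ d ∈ M, ((v d a : ℤ) + v d b) := by
      rw [← totp, ← Fintype.sum_ite_mem M, ← Finset.sum_add_distrib]
      refine Finset.sum_le_sum fun d _ => ?_
      split_ifs with h
      · have := hd d
        omega
      · rw [hout d h]; simp
    have low : ∀ c, ∑ d, (v d c : ℤ) - ∑ d ∈ M, (v d c : ℤ) ≤ ∑ d, (vt d c : ℤ) := by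
      intro c
      rw [← Fintype.sum_ite_mem M, ← Finset.sum_sub_distrib]
      refine Finset.sum_le_sum fun d _ => ?_
      split_ifs with h
      · simp
      · rw [hout d h]; simp
    have hle : ∀ d, (v d a : ℤ) + v d b ≤ 4 * y := by
      rintro (i | i | ⟨i, t⟩ | t)
      · rw [z1a, z1b]; omega
      · rw [hv2a, hv2b]; omega
      · rw [z3a, z3b]; omega
      · have := z4 t
        omega
    have hge : 4 * ((y : ℤ) * ℓ) ≤ ∑ d ∈ M, ((v d a : ℤ) + v d b) := by omega
    have hcard : ∑ d ∈ M, (4 * y - ((v d a : ℤ) + v d b)) = 4 * (y * M.card) -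
        ∑ d ∈ M, ((v d a : ℤ) + v d b) := by
      rw [Finset.sum_sub_distrib]; simp; ring
    have hnn : 0 ≤ ∑ d ∈ M, (4 * y - ((v d a : ℤ) + v d b)) :=
      Finset.sum_nonneg fun d _ => by have := hle d; omega
    have hMc : M.card = ℓ := by
      refine le_antisymm hM ?_
      have : (y : ℤ) * ℓ ≤ y * M.card := by omega
      have := le_of_mul_le_mul_left this (by omega)
      exact_mod_cast this
    have hfull : ∀ d ∈ M, (v d a : ℤ) + v d b = 4 * y := by
      have h0 : ∑ d ∈ M, (4 * y - ((v d a : ℤ) + v d b)) = 0 := by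
        rw [hMc] at hcard; omega
      rw [Finset.sum_eq_zero_iff_of_nonneg (fun d _ => by have := hle d; omega)] at h0
      intro d hd'
      have := h0 d hd'
      omega
    have hin : ∀ d ∈ M, (∃ i, d = Sum.inl i) ∨ ∃ i, d = Sum.inr (Sum.inl i) := by
      intro d hdM
      have h := hfull d hdM
      rcases d with (i | i | ⟨i, t⟩ | t)
      · exact Or.inl ⟨i, rfl⟩
      · exact Or.inr ⟨i, rfl⟩
      · rw [z3a, z3b] at h; omega
      · exfalso
        have := z4 t
        omega
    let f : (Fin ℓ ⊕ Fin (ℓ - 1) ⊕ (Fin ℓ × Fin 2) ⊕ Fin 3) → ℤ := Sum.elim X (fun _ => 0)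
    have hfS : ∑ d ∈ M, f d = ∑ i ∈ Finset.univ.filter (fun i => Sum.inl i ∈ M), X i := by
      rw [← Fintype.sum_ite_mem M, Fintype.sum_sum_type, Finset.sum_filter]
      simp [f]
    have ha : ∑ d ∈ M, (v d a : ℤ) = 2 * (y * ℓ) + 4 * ∑ d ∈ M, f d := by
      have : ∀ d ∈ M, (v d a : ℤ) = 2 * y + 4 * f d := by
        intro d hdM
        rcases hin d hdM with ⟨i, rfl⟩ | ⟨i, rfl⟩
        · rw [z1a]; rfl
        · rw [hv2a]; simp [f]
      rw [Finset.sum_congr rfl this, Finset.sum_add_distrib, Finset.mul_sum,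
        Finset.sum_const, hMc, nsmul_eq_mul]
      ring
    have hb : ∑ d ∈ M, (v d b : ℤ) = 2 * (y * ℓ) - 4 * ∑ d ∈ M, f d := by
      have : ∀ d ∈ M, (v d b : ℤ) = 2 * y - 4 * f d := by
        intro d hdM
        rcases hin d hdM with ⟨i, rfl⟩ | ⟨i, rfl⟩
        · rw [z1b]; rfl
        · rw [hv2b]; simp [f]
      rw [Finset.sum_congr rfl this, Finset.sum_sub_distrib, Finset.mul_sum,
        Finset.sum_const, hMc, nsmul_eq_mul]
      ring
    have hla := low a
    have hlb := low b
    rw [Finset.sum_add_distrib] at hP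
    refine ⟨Finset.univ.filter (fun i => Sum.inl i ∈ M), ?_, ?_⟩
    · by_contra hne
      rw [Finset.not_nonempty_iff_eq_empty] at hne
      have hsub : M ⊆ Finset.univ.image (fun i : Fin (ℓ - 1) => Sum.inr (Sum.inl i)) := by
        intro d hdM
        rcases hin d hdM with ⟨i, rfl⟩ | ⟨i, rfl⟩
        · have : i ∈ (Finset.univ.filter (fun i => Sum.inl i ∈ M) : Finset (Fin ℓ)) := by
            simpa using hdM
          rw [hne] at this
          simp at this
        · simp
      have := (Finset.card_le_card hsub).trans Finset.card_image_le
      simp at this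
      omega
    · rw [← hfS]; omega
  · rintro ⟨S, hS, hS0⟩
    have hSpos := hS.card_pos
    have hSle : S.card ≤ ℓ := by simpa using S.card_le_univ
    obtain ⟨T, -, hT⟩ := Finset.exists_subset_card_eq
      (s := (Finset.univ : Finset (Fin (ℓ - 1)))) (n := ℓ - S.card) (by simp; omega)
    let M : Finset (Fin ℓ ⊕ Fin (ℓ - 1) ⊕ (Fin ℓ × Fin 2) ⊕ Fin 3) :=
      S.disjSum (T.disjSum ∅)
    have hMa : ∑ d ∈ M, (v d a : ℤ) = 2 * (y * ℓ) := by
      simp only [M, Finset.sum_disjSum, z1a, hv2a, Finset.sum_add_distrib, ← Finset.mul_sum, hS0]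
      simp [hT, hSle]; ring
    have hMb : ∑ d ∈ M, (v d b : ℤ) = 2 * (y * ℓ) := by
      simp only [M, Finset.sum_disjSum, z1b, hv2b, Finset.sum_sub_distrib, ← Finset.mul_sum, hS0]
      simp [hT, hSle]; ring
    refine ⟨M, by simp [M, hT]; omega,
      fun d c => if d ∈ M then (if c = p then v d a + v d b + v d p else 0) else v d c,
      ?_, ?_, ?_⟩
    · intro d hdM c
      simp [hdM]
    · intro d
      rw [hsumC, hsumC]
      by_cases h : d ∈ M <;> simp [h, hap, hbp]
    · have sp : ∑ d, (((if d ∈ M then (if p = p then v d a + v d b + v d p else 0) else v d p : ℕ)) : ℤ)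
          = 4 * (y * ℓ) + 1 := by
        have : ∀ d, (((if d ∈ M then (if p = p then v d a + v d b + v d p else 0) else v d p : ℕ)) : ℤ)
            = v d p + if d ∈ M then (v d a : ℤ) + v d b else 0 := by
          intro d
          by_cases h : d ∈ M
          · simp [h]; ring
          · simp [h]
        rw [Finset.sum_congr rfl (fun d _ => this d), Finset.sum_add_distrib, Fintype.sum_ite_mem,
          Finset.sum_add_distrib, totp, hMa, hMb]
        ring
      have sc : ∀ c, c ≠ p → ∑ d, (((if d ∈ M then (if c = p then v d a + v d b + v d p else 0)
          else v d c : ℕ)) : ℤ) = ∑ d, (v d c : ℤ) - ∑ d ∈ M, (v d c : ℤ) := by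
        intro c hc
        rw [← Fintype.sum_ite_mem M, ← Finset.sum_sub_distrib]
        refine Finset.sum_congr rfl fun d _ => ?_
        split_ifs <;> simp
      intro c hc
      left
      unfold score
      zify
      have h := sc c hc
      push_cast at h sp
      simp only [if_true] at sp ⊢
      rw [h, sp]
      rcases hC c with rfl | rfl | rfl
      · rw [tota, hMa]; omega
      · rw [totb, hMb]; omega
      · exact absurd rfl hc

end PVMan9
end

section
/- Let E be a set with |E| = 3ℓ (ℓ ≥ 1) and let 𝒮 be a collection of s three-element subsets of E whose union is E. Consider the PV election with candidate set {j_e : e ∈ E} ∪ {p} and the following districts: for each S ∈ 𝒮 a district of 9ℓ voters in which each candidate j_e with e ∈ S gets 3ℓ votes and all other candidates get 0 votes; for each e ∈ E, exactly 3ℓs + 9ℓ² − 3ℓ·|{S ∈ 𝒮 : e ∈ S}| single-voter districts whose voter votes for j_e; and one district of 3ℓs − 2ℓ voters all voting for p. Then there exists a set M of at most ℓ districts and a profile ṽ agreeing with the true profile outside M and having the same total number of votes in every district, such that p is the PV winner of ṽ, if and only if E has an exact cover by ℓ sets from 𝒮. -/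
/-!
Statement 10: correctness of the X3C-based instance in the NP-hardness proof
of PV-Man in unary with defender budget 0 (Theorem `PV-Man-hardness` (ii)).
Ground set `E` of size `3ℓ`, collection `𝒮` of `s` three-element subsets
covering `E`; candidates `{j_e : e ∈ E} ∪ {p}`. Districts: for each `S ∈ 𝒮` a
district of `9ℓ` voters where each `j_e`, `e ∈ S`, gets `3ℓ` votes; for each
`e ∈ E` exactly `3ℓs + 9ℓ² − 3ℓ·|{S : e ∈ S}|` single-voter districts voting
for `j_e`; and one district of `3ℓs − 2ℓ` voters voting for `p`. The attacker
can make `p` the PV winner by redistributing all votes within at most `ℓ`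
districts iff `E` has an exact cover by `ℓ` sets of `𝒮`.
-/

namespace PVManX3C10

variable {C : Type*}

/-- Total PV score of candidate `a` in profile `v`. -/
def score {D : Type*} [Fintype D] (v : D → C → ℕ) (a : C) : ℕ := ∑ i, v i a

/-- `a` beats `b` under PV (ties broken by the linear order: `b < a` means `a ≻ b`). -/
def beats {D : Type*} [Fintype D] [LT C] (v : D → C → ℕ) (a b : C) : Prop :=
  score v b < score v a ∨ (score v a = score v b ∧ b < a)

/-- `a` is the PV winner of profile `v`. -/
def winner {D : Type*} [Fintype D] [LT C] (v : D → C → ℕ) (a : C) : Prop :=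
  ∀ b, b ≠ a → beats v a b

theorem stmt10 {E : Type*} [Fintype E] [DecidableEq E] [Fintype C] [LinearOrder C]
    (ℓ s : ℕ) (hℓ : 1 ≤ ℓ) (hE : Fintype.card E = 3 * ℓ)
    (𝒮 : Fin s → Finset E) (h3 : ∀ S, (𝒮 S).card = 3) (hcov : ∀ e : E, ∃ S, e ∈ 𝒮 S)
    -- the candidates: `j e` for `e ∈ E`, plus `p`
    (j : E → C) (hj : Function.Injective j) (p : C) (hjp : ∀ e, j e ≠ p)
    (hC : ∀ c : C, c = p ∨ ∃ e, c = j e)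
    -- `N e` is the number of single-voter districts voting for `j e`
    (N : E → ℕ)
    (hN : ∀ e, N e = 3 * ℓ * s + 9 * ℓ ^ 2 -
      3 * ℓ * (Finset.univ.filter (fun S => e ∈ 𝒮 S)).card)
    (v : (Fin s ⊕ (Σ e : E, Fin (N e)) ⊕ Fin 1) → C → ℕ)
    -- set `I₁`: a district of `9ℓ` voters for each `S ∈ 𝒮`
    (hv1 : ∀ S : Fin s, ∀ e : E, v (Sum.inl S) (j e) = if e ∈ 𝒮 S then 3 * ℓ else 0)
    (hv1p : ∀ S : Fin s, v (Sum.inl S) p = 0)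
    -- set `I₂`: the single-voter districts
    (hv2 : ∀ d : Σ e : E, Fin (N e), ∀ c,
      v (Sum.inr (Sum.inl d)) c = if c = j d.1 then 1 else 0)
    -- set `I₃`: the district `D*` of `3ℓs − 2ℓ` voters voting for `p`
    (hv3 : ∀ i : Fin 1, ∀ c, v (Sum.inr (Sum.inr i)) c =
      if c = p then 3 * ℓ * s - 2 * ℓ else 0) :
    (∃ M : Finset (Fin s ⊕ (Σ e : E, Fin (N e)) ⊕ Fin 1),
        M.card ≤ ℓ ∧
        ∃ vt : (Fin s ⊕ (Σ e : E, Fin (N e)) ⊕ Fin 1) → C → ℕ,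
          (∀ i ∉ M, ∀ c, vt i c = v i c) ∧
          (∀ i, ∑ c, vt i c = ∑ c, v i c) ∧
          winner vt p) ↔
      (∃ Q : Finset (Fin s), Q.card = ℓ ∧
        (∀ S ∈ Q, ∀ T ∈ Q, S ≠ T → Disjoint (𝒮 S) (𝒮 T)) ∧
        (∀ e : E, ∃ S ∈ Q, e ∈ 𝒮 S)) := by
  classical
  -- row totals, split into `p` and the `j e`
  have hsplit : ∀ f : C → ℕ, ∑ c, f c = f p + ∑ e, f (j e) := by
    intro f
    have hu : (Finset.univ : Finset C) = insert p (Finset.univ.image j) := by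
      ext c
      rcases hC c with h | ⟨e, h⟩ <;> simp [h]
    rw [hu, Finset.sum_insert (by simpa using hjp), Finset.sum_image (fun a _ b _ h => hj h)]
  have hrow1 : ∀ S : Fin s, ∑ c, v (Sum.inl S) c = 9 * ℓ := by
    intro S
    rw [hsplit, hv1p]
    simp only [hv1, Finset.sum_ite_mem, Finset.univ_inter, Finset.sum_const, h3, smul_eq_mul]
    ring
  have hrow2 : ∀ d : Σ e : E, Fin (N e), ∑ c, v (Sum.inr (Sum.inl d)) c = 1 := by
    intro d
    simp [hv2]
  have hrow3 : ∀ i : Fin 1, ∑ c, v (Sum.inr (Sum.inr i)) c = 3 * ℓ * s - 2 * ℓ := by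
    intro i
    simp [hv3]
  have hscore : ∀ (w : (Fin s ⊕ (Σ e : E, Fin (N e)) ⊕ Fin 1) → C → ℕ) (c : C),
      score w c = ∑ S, w (Sum.inl S) c + (∑ d, w (Sum.inr (Sum.inl d)) c
        + w (Sum.inr (Sum.inr 0)) c) := by
    intro w c
    simp [score, Fintype.sum_sum_type]
  have hE0 : Nonempty E := by
    rw [← Fintype.card_pos_iff]; omega
  have hs : 1 ≤ s := by
    obtain ⟨e⟩ := hE0
    obtain ⟨S, _⟩ := hcov e
    have := S.2
    omega
  have hls : ℓ ≤ ℓ * s := Nat.le_mul_of_pos_right _ hs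
  have h2 : ∀ e : E, ∑ d : Σ e : E, Fin (N e), v (Sum.inr (Sum.inl d)) (j e) = N e := by
    intro e
    rw [Fintype.sum_sigma, Finset.sum_eq_single e]
    · simp [hv2]
    · intro b _ hb
      refine Finset.sum_eq_zero fun x _ => ?_
      rw [hv2, if_neg (fun h => hb (hj h).symm)]
    · simp
  have hjs : ∀ e : E, ∑ S, v (Sum.inl S) (j e) + N e = 3 * ℓ * s + 9 * ℓ ^ 2 := by
    intro e
    have h1 : ∑ S, v (Sum.inl S) (j e)
        = 3 * ℓ * (Finset.univ.filter (fun S => e ∈ 𝒮 S)).card := by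
      simp only [hv1]
      rw [← Finset.sum_filter, Finset.sum_const, smul_eq_mul, mul_comm]
    have hd : (Finset.univ.filter (fun S => e ∈ 𝒮 S)).card ≤ s := by
      simpa using Finset.card_filter_le (Finset.univ : Finset (Fin s)) (fun S => e ∈ 𝒮 S)
    have := Nat.mul_le_mul_left (3 * ℓ) hd
    rw [h1, hN]
    omega
  constructor
  · rintro ⟨M, hM, vt, hout, htot, hwin⟩
    set Q : Finset (Fin s) := Finset.univ.filter (fun S => Sum.inl S ∈ M) with hQ
    set R : Finset (Σ e : E, Fin (N e)) :=
      Finset.univ.filter (fun d => Sum.inr (Sum.inl d) ∈ M) with hR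
    have hQR : Q.card + R.card ≤ ℓ := by
      have hsub : Q.disjSum (R.disjSum (∅ : Finset (Fin 1))) ⊆ M := by
        intro x hx
        rcases x with S | d | i
        · simpa [hQ] using hx
        · simpa [hR] using hx
        · simp at hx
      have := Finset.card_le_card hsub
      simp only [Finset.card_disjSum, Finset.card_empty] at this
      omega
    have hle : ∀ i c, vt i c ≤ ∑ c, v i c := by
      intro i c
      rw [← htot i]
      exact Finset.single_le_sum (f := vt i) (fun _ _ => Nat.zero_le _) (Finset.mem_univ c)
    have hp : score vt p ≤ 9 * ℓ * Q.card + (R.card + (3 * ℓ * s - 2 * ℓ)) := by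
      rw [hscore]
      refine Nat.add_le_add ?_ (Nat.add_le_add ?_ ?_)
      · have : ∑ S, vt (Sum.inl S) p ≤ ∑ S, if Sum.inl S ∈ M then 9 * ℓ else 0 := by
          refine Finset.sum_le_sum fun S _ => ?_
          split_ifs with h
          · rw [← hrow1 S]; exact hle _ _
          · rw [hout _ h, hv1p]
        rw [← Finset.sum_filter, Finset.sum_const, smul_eq_mul, mul_comm] at this
        exact this
      · have : ∑ d, vt (Sum.inr (Sum.inl d)) p
            ≤ ∑ d, if Sum.inr (Sum.inl d) ∈ M then 1 else 0 := by
          refine Finset.sum_le_sum fun d _ => ?_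
          split_ifs with h
          · exact (hle _ _).trans (hrow2 d).le
          · rw [hout _ h, hv2, if_neg (hjp _).symm]
        rw [← Finset.card_filter] at this
        exact this
      · rw [← hrow3 0]; exact hle _ _
    have hcovQ : ∀ e : E, ∃ S ∈ Q, e ∈ 𝒮 S := by
      intro e
      by_contra! hne
      have hA : ∑ S, v (Sum.inl S) (j e) ≤ ∑ S, vt (Sum.inl S) (j e) := by
        refine Finset.sum_le_sum fun S _ => ?_
        by_cases h : Sum.inl S ∈ M
        · rw [hv1, if_neg (hne S (by simp [hQ, h]))]
          exact Nat.zero_le _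
        · rw [hout _ h]
      have hB : N e ≤ ∑ d, vt (Sum.inr (Sum.inl d)) (j e) + R.card := by
        rw [← h2 e, hR, Finset.card_filter, ← Finset.sum_add_distrib]
        refine Finset.sum_le_sum fun d _ => ?_
        by_cases h : Sum.inr (Sum.inl d) ∈ M
        · rw [hv2, if_pos h]; split_ifs <;> omega
        · rw [hout _ h]; exact Nat.le_add_right _ _
      have hb : score vt (j e) ≤ score vt p := by
        rcases hwin (j e) (hjp e) with h | ⟨h, _⟩
        · exact h.le
        · exact h.ge
      have hsc := hscore vt (j e)
      have hjsum := hjs e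
      have h9 : 9 * ℓ * Q.card + 2 * R.card ≤ 9 * ℓ ^ 2 := by
        have := Nat.mul_le_mul_left (9 * ℓ) hQR
        nlinarith [Nat.zero_le R.card, Nat.mul_le_mul_right R.card hℓ]
      have h6 : 3 * ℓ * s = 3 * (ℓ * s) := by ring
      omega
    have hU : Q.biUnion 𝒮 = Finset.univ := by
      ext e
      simpa using hcovQ e
    have hcU : (Q.biUnion 𝒮).card = 3 * ℓ := by
      rw [hU, Finset.card_univ, hE]
    have hsum : ∀ Q2 : Finset (Fin s), (Q2.biUnion 𝒮).card ≤ 3 * Q2.card := by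
      intro Q2
      refine Finset.card_biUnion_le.trans ?_
      simp [h3, mul_comm]
    have hQc : Q.card = ℓ := by
      have := hsum Q
      omega
    refine ⟨Q, hQc, ?_, hcovQ⟩
    intro S hS T hT hST
    by_contra hnd
    have hTS : T ∈ Q.erase S := Finset.mem_erase.2 ⟨hST.symm, hT⟩
    have e1 : Q.biUnion 𝒮 ⊆ (𝒮 S ∪ 𝒮 T) ∪ ((Q.erase S).erase T).biUnion 𝒮 := by
      intro x hx
      obtain ⟨U, hUQ, hxU⟩ := Finset.mem_biUnion.1 hx
      simp only [Finset.mem_union, Finset.mem_biUnion, Finset.mem_erase]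
      by_cases h : U = S
      · subst h; exact Or.inl (Or.inl hxU)
      · by_cases hUT : U = T
        · subst hUT; exact Or.inl (Or.inr hxU)
        · exact Or.inr ⟨U, ⟨hUT, h, hUQ⟩, hxU⟩
    have e2 := Finset.card_le_card e1
    have e3 := Finset.card_union_le (𝒮 S ∪ 𝒮 T) (((Q.erase S).erase T).biUnion 𝒮)
    have e4 := hsum ((Q.erase S).erase T)
    have e5 := Finset.card_erase_add_one hTS
    have e6 := Finset.card_erase_add_one hS
    have e7 := Finset.card_union_add_card_inter (𝒮 S) (𝒮 T)
    have e8 : 0 < (𝒮 S ∩ 𝒮 T).card := by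
      rw [Finset.card_pos]
      exact Finset.not_disjoint_iff_nonempty_inter.1 hnd
    rw [h3, h3] at e7
    omega
  · rintro ⟨Q, hQc, -, hcovQ⟩
    refine ⟨Q.map Function.Embedding.inl, by simp [hQc],
      fun i c => if i ∈ Q.map Function.Embedding.inl then (if c = p then 9 * ℓ else 0) else v i c,
      ?_, ?_, ?_⟩
    · intro i hi c
      simp only [if_neg hi]
    · intro i
      by_cases hi : i ∈ Q.map Function.Embedding.inl
      · simp only [if_pos hi]
        obtain ⟨S, _, rfl⟩ := Finset.mem_map.1 hi
        rw [Function.Embedding.inl_apply, hrow1 S]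
        simp
      · simp only [if_neg hi]
    · intro b hb
      obtain rfl | ⟨e, rfl⟩ := hC b
      · exact absurd rfl hb
      left
      rw [hscore, hscore]
      have m1 : ∀ S : Fin s, (Sum.inl S : Fin s ⊕ (Σ e : E, Fin (N e)) ⊕ Fin 1) ∈
          Q.map Function.Embedding.inl ↔ S ∈ Q := by
        intro S; simp
      have m2 : ∀ d : (Σ e : E, Fin (N e)) ⊕ Fin 1,
          (Sum.inr d : Fin s ⊕ (Σ e : E, Fin (N e)) ⊕ Fin 1) ∈
          Q.map Function.Embedding.inl ↔ False := by
        intro d; simp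
      simp only [m1, m2, if_false, h2, hv3, hv1p, if_neg (hjp e), if_true]
      have hP : ∑ S, (if S ∈ Q then 9 * ℓ else 0) = 9 * ℓ ^ 2 := by
        simp only [Finset.sum_ite_mem, Finset.univ_inter, Finset.sum_const, hQc, smul_eq_mul]
        ring
      obtain ⟨S0, hS0, heS0⟩ := hcovQ e
      have hJ : ∑ S, (if S ∈ Q then 0 else v (Sum.inl S) (j e)) + 3 * ℓ
          ≤ ∑ S, v (Sum.inl S) (j e) := by
        have h0 : ∑ S, (if S = S0 then 3 * ℓ else 0) = 3 * ℓ := by simp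
        conv_lhs => rw [← h0]
        rw [← Finset.sum_add_distrib]
        refine Finset.sum_le_sum fun S _ => ?_
        by_cases h : S = S0
        · subst h; simp [hS0, hv1, heS0]
        · simp only [if_neg h, add_zero]
          split_ifs <;> omega
      have hjsum := hjs e
      rw [hP]
      have h6 : 3 * ℓ * s = 3 * (ℓ * s) := by ring
      omega

end PVManX3C10
end

section
/- Let X be a finite set of nonzero integers with |X| ≥ ℓ ≥ 1, X⁺ = {x ∈ X : x > 0}, X⁻ = X \ X⁺, and y = Σ_{x∈X} 3|x|. Consider the weighted PD election with candidates {a, b, p}, where each district's weight equals its number of voters, and the following districts (votes listed as (a, b, p)): the set I₁ containing, for each x ∈ X⁺, a district (0, 3x, 0) and, for each x ∈ X⁻, a district (0, 0, −3x); the set I₂ containing one district (0, y+3, 0); and the set I₃ containing three districts (2y+5, 0, 0), (0, y − Σ_{x∈X⁺} 3x, 0), and (0, 0, 2y + 4 + Σ_{x∈X⁻} 3x). The attacker may arbitrarily change all votes in chosen districts of I₁ ∪ I₂ but none in I₃. Then there exists a manipulation (M, ṽ) with M ⊆ I₁ ∪ I₂ and |M| ≤ ℓ + 1 such that p is the PD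 winner of ṽ and no R ⊆ M with |R| ≤ ℓ makes a the PD winner of the recounted profile, if and only if there exists X' ⊆ X with |X'| = ℓ such that Σ_{x∈X''} x ≠ 0 for every nonempty subset X'' ⊆ X'. -/
/-!
Statement 12: correctness of the Sub-Subset-Sum-based instance in the
Σ₂ᴾ-hardness proof of PD-Man for three candidates
(Theorem `PD-Man-hardness`). Candidates `{a, b, p}`; each district's weight
equals its number of voters. Districts (votes `(a, b, p)`): `I₁` has, for each
`x ∈ X⁺`, a district `(0, 3x, 0)` and, for each `x ∈ X⁻`, a district
`(0, 0, −3x)`; `I₂` has one district `(0, y+3, 0)`; `I₃` has three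
unmanipulable districts `(2y+5, 0, 0)`, `(0, y − Σ_{x∈X⁺}3x, 0)` and
`(0, 0, 2y + 4 + Σ_{x∈X⁻}3x)`. The attacker (budget `ℓ+1`, manipulating only
districts of `I₁ ∪ I₂`) has a strategy making `p` win that survives every
recount of at most `ℓ` districts iff some `X' ⊆ X` with `|X'| = ℓ` has no
nonempty zero-sum subset.
-/

namespace PDManSSS12

variable {D C : Type*}

/-- `a` beats `b` inside district `i`. -/
def distBeats [LT C] (v : D → C → ℕ) (i : D) (a b : C) : Prop :=
  v i b < v i a ∨ (v i a = v i b ∧ b < a)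

/-- `a` is the district winner of district `i` in profile `v`. -/
def IsDistWinner [LT C] (v : D → C → ℕ) (i : D) (a : C) : Prop :=
  ∀ b, b ≠ a → distBeats v i a b

open Classical in
/-- Total PD weight of candidate `a`. -/
noncomputable def pdWeight [Fintype D] [LT C] (w : D → ℚ) (v : D → C → ℕ) (a : C) : ℚ :=
  ∑ i, if IsDistWinner v i a then w i else 0

/-- `a` beats `b` under PD (ties broken by the linear order: `b < a` means `a ≻ b`). -/
noncomputable def pdBeats [Fintype D] [LT C] (w : D → ℚ) (v : D → C → ℕ) (a b : C) : Prop :=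
  pdWeight w v b < pdWeight w v a ∨ (pdWeight w v a = pdWeight w v b ∧ b < a)

/-- `a` is the PD winner of profile `v`. -/
noncomputable def pdWinner [Fintype D] [LT C] (w : D → ℚ) (v : D → C → ℕ) (a : C) : Prop :=
  ∀ b, b ≠ a → pdBeats w v a b

/-- The recounted profile: true votes on districts in `R`, distorted votes elsewhere. -/
def recount [DecidableEq D] (v vt : D → C → ℕ) (R : Finset D) : D → C → ℕ :=
  fun i a => if i ∈ R then v i a else vt i a

open Classical in
/-- Contribution of district `i` to the weight of candidate `c`. -/
noncomputable def ct [LT C] (w : D → ℚ) (v : D → C → ℕ) (i : D) (c : C) : ℚ :=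
  if IsDistWinner v i c then w i else 0

theorem pdWeight_eq [Fintype D] [LT C] (w : D → ℚ) (v : D → C → ℕ) (c : C) :
    pdWeight w v c = ∑ i, ct w v i c := rfl

theorem ct_congr [LT C] (w : D → ℚ) (u u' : D → C → ℕ) (i : D) (c : C) (h : u i = u' i) :
    ct w u i c = ct w u' i c := by
  unfold ct IsDistWinner distBeats
  rw [h]

theorem ct_winner [LinearOrder C] (w : D → ℚ) (u : D → C → ℕ) (i : D) (g c : C)
    (h : IsDistWinner u i g) : ct w u i c = if c = g then w i else 0 := by
  unfold ct
  by_cases hc : c = g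
  · subst hc; simp [h]
  · rw [if_neg hc, if_neg]
    intro h'
    have h1 := h c hc
    have h2 := h' g (Ne.symm hc)
    unfold distBeats at h1 h2
    rcases h1 with h1 | ⟨h1, h1'⟩ <;> rcases h2 with h2 | ⟨h2, h2'⟩
    · omega
    · omega
    · omega
    · exact lt_asymm h1' h2'

theorem exists_winner [Fintype C] [LinearOrder C] [Nonempty C] (u : D → C → ℕ) (i : D) :
    ∃ g, IsDistWinner u i g := by
  obtain ⟨g, -, hg⟩ := Finset.exists_max_image (Finset.univ : Finset C)
    (fun c => toLex (u i c, c)) Finset.univ_nonempty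
  refine ⟨g, fun c hc => ?_⟩
  have := hg c (Finset.mem_univ _)
  rw [Prod.Lex.toLex_le_toLex] at this
  rcases this with h | ⟨h, h'⟩
  · exact Or.inl h
  · exact Or.inr ⟨h.symm, lt_of_le_of_ne h' hc⟩

theorem ct_conc [LinearOrder C] (w : D → ℚ) (u : D → C → ℕ) (i : D) (q c : C) (n : ℕ)
    (hwn : w i = n) (h : ∀ c, u i c = if c = q then n else 0) :
    ct w u i c = if c = q then (n : ℚ) else 0 := by
  rcases Nat.eq_zero_or_pos n with hn | hn
  · subst hn
    unfold ct
    simp [hwn]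
  · rw [ct_winner w u i q c, hwn]
    intro d hd
    left
    rw [h, h]
    simp [hd, hn]

theorem recount_weight [Fintype D] [DecidableEq D] [LinearOrder C] (w : D → ℚ)
    (v vt : D → C → ℕ) (M R : Finset D) (hM : ∀ i ∉ M, ∀ c, vt i c = v i c) (c : C) :
    pdWeight w (recount v vt R) c =
      pdWeight w v c + ∑ i ∈ M \ R, (ct w vt i c - ct w v i c) := by
  have : ∀ i, ct w (recount v vt R) i c =
      ct w v i c + if i ∈ M \ R then (ct w vt i c - ct w v i c) else 0 := by
    intro i
    by_cases hR : i ∈ R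
    · rw [ct_congr w _ v i c (by funext d; simp [recount, hR])]
      simp [hR]
    · rw [ct_congr w _ vt i c (by funext d; simp [recount, hR])]
      by_cases hi : i ∈ M
      · simp [hR, hi]
      · rw [ct_congr w vt v i c (by funext d; exact hM i hi d)]
        simp [hi]
  rw [pdWeight_eq, pdWeight_eq, Finset.sum_congr rfl (fun i _ => this i),
    Finset.sum_add_distrib, Finset.sum_ite_mem, Finset.univ_inter]

theorem pdWinner_of [Fintype D] [LinearOrder C] (w : D → ℚ) (u : D → C → ℕ) (a b p : C)
    (hC : ∀ c : C, c = a ∨ c = b ∨ c = p)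
    (h1 : pdWeight w u b < pdWeight w u a) (h2 : pdWeight w u p < pdWeight w u a) :
    pdWinner w u a := by
  intro c hc
  rcases hC c with rfl | rfl | rfl
  · exact absurd rfl hc
  · exact Or.inl h1
  · exact Or.inl h2

theorem not_pdWinner_of [Fintype D] [LinearOrder C] (w : D → ℚ) (u : D → C → ℕ) (a b : C)
    (h1 : pdWeight w u a < pdWeight w u b) : ¬ pdWinner w u a := by
  intro h
  have hne : b ≠ a := by rintro rfl; exact lt_irrefl _ h1
  rcases h b hne with h | ⟨h, -⟩ <;> linarith

theorem stmt12 [Fintype C] [LinearOrder C]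
    (a b p : C) (hab : a ≠ b) (hap : a ≠ p) (hbp : b ≠ p)
    (hC : ∀ c : C, c = a ∨ c = b ∨ c = p)
    (X : Finset ℤ) (hX0 : ∀ x ∈ X, x ≠ 0)
    (ℓ : ℕ) (hℓ1 : 1 ≤ ℓ) (hℓX : ℓ ≤ X.card)
    (y : ℕ) (hy : y = ∑ x ∈ X, 3 * x.natAbs)
    (v : ({ x // x ∈ X } ⊕ Fin 1 ⊕ Fin 3) → C → ℕ)
    -- `I₁`: for `x > 0` votes `(0, 3x, 0)`, for `x < 0` votes `(0, 0, −3x)`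
    (hv1 : ∀ x : { x // x ∈ X }, ∀ c, v (Sum.inl x) c =
      if c = b then (3 * x.val).toNat else if c = p then (-(3 * x.val)).toNat else 0)
    -- `I₂`: one district `(0, y + 3, 0)`
    (hv2 : ∀ i : Fin 1, ∀ c, v (Sum.inr (Sum.inl i)) c = if c = b then y + 3 else 0)
    -- `I₃`: three districts `(2y+5, 0, 0)`, `(0, y − Σ_{x∈X⁺}3x, 0)`,
    -- `(0, 0, 2y + 4 + Σ_{x∈X⁻}3x)`
    (hv3 : ∀ c, v (Sum.inr (Sum.inr 0)) c = if c = a then 2 * y + 5 else 0)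
    (hv4 : ∀ c, v (Sum.inr (Sum.inr 1)) c =
      if c = b then y - ∑ x ∈ X, (3 * x).toNat else 0)
    (hv5 : ∀ c, v (Sum.inr (Sum.inr 2)) c =
      if c = p then 2 * y + 4 - ∑ x ∈ X, (-(3 * x)).toNat else 0)
    -- the weight of each district is its number of voters
    (w : ({ x // x ∈ X } ⊕ Fin 1 ⊕ Fin 3) → ℚ)
    (hw : ∀ i, w i = ∑ c, (v i c : ℚ)) :
    (∃ M : Finset ({ x // x ∈ X } ⊕ Fin 1 ⊕ Fin 3),
        (∀ j : Fin 3, Sum.inr (Sum.inr j) ∉ M) ∧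
        M.card ≤ ℓ + 1 ∧
        ∃ vt : ({ x // x ∈ X } ⊕ Fin 1 ⊕ Fin 3) → C → ℕ,
          (∀ i ∉ M, ∀ c, vt i c = v i c) ∧
          (∀ i, ∑ c, vt i c = ∑ c, v i c) ∧
          pdWinner w vt p ∧
          (∀ R ⊆ M, R.card ≤ ℓ → ¬ pdWinner w (recount v vt R) a)) ↔
      (∃ X' ⊆ X, X'.card = ℓ ∧
        ∀ X'' ⊆ X', X''.Nonempty → ∑ x ∈ X'', x ≠ 0) := by
  classical
  have hne : Nonempty C := ⟨a⟩
  have hPN : (∑ x ∈ X, (3 * x).toNat) + (∑ x ∈ X, (-(3 * x)).toNat) = y := by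
    rw [hy, ← Finset.sum_add_distrib]
    exact Finset.sum_congr rfl fun x _ => by omega
  -- votes of `I₁` districts
  have hpos : ∀ x : {x // x ∈ X}, 0 < x.val → ∀ c, v (Sum.inl x) c =
      if c = b then (3 * x.val).toNat else 0 := by
    intro x hx c
    rw [hv1]
    have : (-(3 * x.val)).toNat = 0 := by omega
    simp [this]
  have hneg : ∀ x : {x // x ∈ X}, x.val < 0 → ∀ c, v (Sum.inl x) c =
      if c = p then (-(3 * x.val)).toNat else 0 := by
    intro x hx c
    rw [hv1]
    have : (3 * x.val).toNat = 0 := by omega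
    rw [this]
    by_cases hc : c = b
    · subst hc; simp [hbp]
    · simp [hc]
  have wconc : ∀ i q (n : ℕ), (∀ c, v i c = if c = q then n else 0) → w i = n := by
    intro i q n h
    rw [hw, Finset.sum_congr rfl (fun c _ => by rw [h c])]
    simp
  have sconc : ∀ i q (n : ℕ), (∀ c, v i c = if c = q then n else 0) → ∑ c, v i c = n := by
    intro i q n h
    rw [Finset.sum_congr rfl (fun c _ => h c)]
    simp
  have t1 : ∀ x : {x // x ∈ X}, ∀ c, ct w v (Sum.inl x) c =
      if c = b then ((3 * x.val).toNat : ℚ) else if c = p then ((-(3 * x.val)).toNat : ℚ)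
        else 0 := by
    intro x c
    rcases lt_or_gt_of_ne (hX0 x x.2) with hx | hx
    · rw [ct_conc w v _ p c _ (wconc _ _ _ (hneg x hx)) (hneg x hx)]
      have : (3 * x.val).toNat = 0 := by omega
      rw [this]
      by_cases hc : c = b
      · subst hc; simp [hbp]
      · simp [hc]
    · rw [ct_conc w v _ b c _ (wconc _ _ _ (hpos x hx)) (hpos x hx)]
      have : (-(3 * x.val)).toNat = 0 := by omega
      simp [this]
  have t2 : ∀ i c, ct w v (Sum.inr (Sum.inl i)) c = if c = b then ((y + 3 : ℕ) : ℚ) else 0 :=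
    fun i c => ct_conc w v _ b c _ (wconc _ _ _ (hv2 i)) (hv2 i)
  have t3 := fun c => ct_conc w v _ a c _ (wconc _ _ _ hv3) hv3
  have t4 := fun c => ct_conc w v _ b c _ (wconc _ _ _ hv4) hv4
  have t5 := fun c => ct_conc w v _ p c _ (wconc _ _ _ hv5) hv5
  have hba := hab.symm
  have hpa := hap.symm
  have hpb := hbp.symm
  have hsumP : ∑ x : {x // x ∈ X}, ((3 * x.val).toNat : ℚ)
      = ((∑ x ∈ X, (3 * x).toNat : ℕ) : ℚ) := by
    rw [← Finset.sum_coe_sort X]; push_cast; rfl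
  have hsumN : ∑ x : {x // x ∈ X}, ((-(3 * x.val)).toNat : ℚ)
      = ((∑ x ∈ X, (-(3 * x)).toNat : ℕ) : ℚ) := by
    rw [← Finset.sum_coe_sort X]; push_cast; rfl
  generalize hP : (∑ x ∈ X, (3 * x).toNat) = P at *
  generalize hN : (∑ x ∈ X, (-(3 * x)).toNat) = N at *
  have hPN' : (P : ℚ) + N = y := by exact_mod_cast hPN
  have Ta : pdWeight w v a = 2 * y + 5 := by
    rw [pdWeight_eq]
    simp only [Fintype.sum_sum_type, Fin.sum_univ_three, Fin.sum_univ_one, t1, t2, t3, t4, t5,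
      hab, hap, if_true, if_false]
    simp
  have Tb : pdWeight w v b = 2 * y + 3 := by
    rw [pdWeight_eq]
    simp only [Fintype.sum_sum_type, Fin.sum_univ_three, Fin.sum_univ_one, t1, t2, t3, t4, t5,
      hba, hbp, if_true, if_false, hsumP]
    rw [Nat.cast_sub (by omega)]
    push_cast
    ring
  have Tp : pdWeight w v p = 2 * y + 4 := by
    rw [pdWeight_eq]
    simp only [Fintype.sum_sum_type, Fin.sum_univ_three, Fin.sum_univ_one, t1, t2, t3, t4, t5,
      hpa, hpb, if_true, if_false, hsumN]
    rw [Nat.cast_sub (by omega)]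
    push_cast
    ring
  -- casts
  have castp : ∀ x : ℤ, 0 < x → ((3 * x).toNat : ℚ) = 3 * x ∧ ((-(3 * x)).toNat : ℚ) = 0 := by
    intro x hx
    have h1 : ((3 * x).toNat : ℤ) = 3 * x := by omega
    have h2 : (-(3 * x)).toNat = 0 := by omega
    exact ⟨by exact_mod_cast h1, by rw [h2]; simp⟩
  have castn : ∀ x : ℤ, x < 0 → ((3 * x).toNat : ℚ) = 0 ∧
      ((-(3 * x)).toNat : ℚ) = -(3 * x) := by
    intro x hx
    have h1 : ((-(3 * x)).toNat : ℤ) = -(3 * x) := by omega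
    have h2 : (3 * x).toNat = 0 := by omega
    exact ⟨by rw [h2]; simp, by exact_mod_cast h1⟩
  constructor
  · rintro ⟨M, hM3, hMc, vt, hvt, hvs, -, hR⟩
    -- every nonempty unrecounted set prevents `a` from winning
    have key : ∀ S ⊆ M, S.Nonempty →
        ¬ (∑ i ∈ S, (ct w vt i b - ct w v i b) ≤ ∑ i ∈ S, (ct w vt i a - ct w v i a) + 1 ∧
          ∑ i ∈ S, (ct w vt i p - ct w v i p) ≤ ∑ i ∈ S, (ct w vt i a - ct w v i a)) := by
      rintro S hS hSn ⟨h1, h2⟩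
      have hc := Finset.card_sdiff_add_card_eq_card hS
      have hSp := hSn.card_pos
      have hMS : M \ (M \ S) = S := by
        rw [Finset.sdiff_sdiff_eq_self hS]
      refine hR (M \ S) Finset.sdiff_subset (by omega) ?_
      apply pdWinner_of w _ a b p hC
      · rw [recount_weight w v vt M _ hvt, recount_weight w v vt M _ hvt, hMS, Ta, Tb]
        linarith
      · rw [recount_weight w v vt M _ hvt, recount_weight w v vt M _ hvt, hMS, Ta, Tp]
        linarith
    have hMne : ℓ + 1 ≤ M.card := by
      by_contra hlt
      refine hR M subset_rfl (by omega) ?_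
      apply pdWinner_of w _ a b p hC
      · rw [recount_weight w v vt M _ hvt, recount_weight w v vt M _ hvt, Ta, Tb]
        simp; linarith
      · rw [recount_weight w v vt M _ hvt, recount_weight w v vt M _ hvt, Ta, Tp]
        simp; linarith
    have flip : ∀ x : {x // x ∈ X}, Sum.inl x ∈ M →
        ct w vt (Sum.inl x) a - ct w v (Sum.inl x) a = 0 ∧
        ct w vt (Sum.inl x) b - ct w v (Sum.inl x) b = -(3 * x.val) ∧
        ct w vt (Sum.inl x) p - ct w v (Sum.inl x) p = 3 * x.val := by
      intro x hx
      have hk := key {Sum.inl x} (by simpa using hx) (by simp)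
      simp only [Finset.sum_singleton] at hk
      obtain ⟨g, hg⟩ := exists_winner vt (Sum.inl x)
      have hg' := fun c => ct_winner w vt _ g c hg
      simp only [hg', t1] at hk ⊢
      rcases lt_or_gt_of_ne (hX0 x x.2) with hx0 | hx0
      · have hwx := wconc _ _ _ (hneg x hx0)
        obtain ⟨e1, e2⟩ := castn _ hx0
        have hq : (x.val : ℚ) < 0 := by exact_mod_cast hx0
        rw [e2] at hwx
        simp only [hwx, e1, e2] at hk ⊢
        rcases hC g with rfl | rfl | rfl
        · refine absurd ?_ hk
          constructor <;> simp only [hab, hap, hba, hpa, hbp, hpb, if_true, if_false] <;>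
            linarith
        · simp [hab, hap, hba, hpa, hbp, hpb]
        · refine absurd ?_ hk
          constructor <;> simp only [hab, hap, hba, hpa, hbp, hpb, if_true, if_false] <;>
            linarith
      · have hwx := wconc _ _ _ (hpos x hx0)
        obtain ⟨e1, e2⟩ := castp _ hx0
        have hq : (0 : ℚ) < x.val := by exact_mod_cast hx0
        rw [e1] at hwx
        simp only [hwx, e1, e2] at hk ⊢
        rcases hC g with rfl | rfl | rfl
        · refine absurd ?_ hk
          constructor <;> simp only [hab, hap, hba, hpa, hbp, hpb, if_true, if_false] <;>
            linarith
        · refine absurd ?_ hk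
          constructor <;> simp only [hab, hap, hba, hpa, hbp, hpb, if_true, if_false] <;>
            linarith
        · simp [hab, hap, hba, hpa, hbp, hpb]
    -- the manipulated elements of `X`
    let Y : Finset {x // x ∈ X} := Finset.univ.filter fun x => Sum.inl x ∈ M
    have hYM : M ⊆ insert (Sum.inr (Sum.inl 0)) (Y.image Sum.inl) := by
      intro i hi
      rcases i with x | i | j
      · simp [Y, hi]
      · have : i = 0 := Subsingleton.elim _ _
        simp [this]
      · exact absurd hi (hM3 j)
    have hYc : ℓ ≤ Y.card := by
      have h1 := Finset.card_le_card hYM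
      have h2 := Finset.card_insert_le (Sum.inr (Sum.inl 0) : {x // x ∈ X} ⊕ Fin 1 ⊕ Fin 3)
        (Y.image Sum.inl)
      have h3 : (Y.image (Sum.inl : _ → {x // x ∈ X} ⊕ Fin 1 ⊕ Fin 3)).card ≤ Y.card :=
        Finset.card_image_le
      omega
    obtain ⟨Z, hZY, hZc⟩ := Finset.exists_subset_card_eq hYc
    refine ⟨Z.map (Function.Embedding.subtype _), ?_, by simpa using hZc, ?_⟩
    · intro x hx
      simp only [Finset.mem_map, Function.Embedding.subtype_apply] at hx
      obtain ⟨z, -, rfl⟩ := hx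
      exact z.2
    · intro X'' hX'' hn h0
      obtain ⟨T, hTZ, rfl⟩ := Finset.subset_map_iff.1 hX''
      have hTM : ∀ x ∈ T, Sum.inl x ∈ M := by
        intro x hx
        have := hZY (hTZ hx)
        simpa [Y] using this
      have hTn : T.Nonempty := by simpa using hn
      rw [Finset.sum_map] at h0
      have h0' : ∑ x ∈ T, (x.val : ℚ) = 0 := by exact_mod_cast h0
      refine key (T.map ⟨Sum.inl, Sum.inl_injective⟩) ?_ (by simpa using hTn) ?_
      · intro i hi
        simp only [Finset.mem_map, Function.Embedding.coeFn_mk] at hi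
        obtain ⟨x, hx, rfl⟩ := hi
        exact hTM x hx
      · simp only [Finset.sum_map, Function.Embedding.coeFn_mk]
        rw [Finset.sum_congr rfl (fun x hx => (flip x (hTM x hx)).1),
          Finset.sum_congr rfl (fun x hx => (flip x (hTM x hx)).2.1),
          Finset.sum_congr rfl (fun x hx => (flip x (hTM x hx)).2.2),
          Finset.sum_neg_distrib, ← Finset.mul_sum, h0']
        simp
  · rintro ⟨X', hX', hc, hz⟩
    let E : Finset {x // x ∈ X} := Finset.univ.filter fun x => x.val ∈ X'
    have hEX : E.map (Function.Embedding.subtype _) = X' := by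
      ext x
      simp only [Finset.mem_map, Function.Embedding.subtype_apply, E, Finset.mem_filter,
        Finset.mem_univ, true_and]
      exact ⟨by rintro ⟨z, hz, rfl⟩; exact hz, fun h => ⟨⟨x, hX' h⟩, h, rfl⟩⟩
    have hEc : E.card = ℓ := by rw [← hc, ← hEX, Finset.card_map]
    let i2 : {x // x ∈ X} ⊕ Fin 1 ⊕ Fin 3 := Sum.inr (Sum.inl 0)
    let M : Finset ({x // x ∈ X} ⊕ Fin 1 ⊕ Fin 3) := insert i2 (E.image Sum.inl)
    let tgt : ({x // x ∈ X} ⊕ Fin 1 ⊕ Fin 3) → C :=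
      Sum.elim (fun x => if 0 < x.val then p else b) (fun _ => p)
    let vt : ({x // x ∈ X} ⊕ Fin 1 ⊕ Fin 3) → C → ℕ := fun i c =>
      if i ∈ M then (if c = tgt i then ∑ d, v i d else 0) else v i c
    have hMc : M.card = ℓ + 1 := by
      rw [Finset.card_insert_of_notMem (by simp [i2]),
        Finset.card_image_of_injective _ Sum.inl_injective, hEc]
    have hvt : ∀ i ∉ M, ∀ c, vt i c = v i c := by
      intro i hi c
      simp [vt, hi]
    have hvtM : ∀ i ∈ M, ∀ c, ct w vt i c = if c = tgt i then w i else 0 := by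
      intro i hi c
      have hwi : w i = ((∑ d, v i d : ℕ) : ℚ) := by rw [hw]; push_cast; rfl
      rw [hwi]
      exact ct_conc w vt i (tgt i) c _ hwi (fun c => by simp [vt, hi])
    have d1 : ∀ x ∈ E, 
        ct w vt (Sum.inl x) a - ct w v (Sum.inl x) a = 0 ∧
        ct w vt (Sum.inl x) b - ct w v (Sum.inl x) b = -(3 * x.val) ∧
        ct w vt (Sum.inl x) p - ct w v (Sum.inl x) p = 3 * x.val := by
      intro x hx
      have hm : Sum.inl x ∈ M := Finset.mem_insert_of_mem (Finset.mem_image_of_mem _ hx)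
      simp only [hvtM _ hm, t1]
      rcases lt_or_gt_of_ne (hX0 x x.2) with hx0 | hx0
      · obtain ⟨e1, e2⟩ := castn _ hx0
        have hn : ¬ 0 < x.val := by omega
        rw [wconc _ _ _ (hneg x hx0), e1, e2]
        simp [tgt, hn, hab, hap, hba, hpa, hbp, hpb]
      · obtain ⟨e1, e2⟩ := castp _ hx0
        rw [wconc _ _ _ (hpos x hx0), e1, e2]
        simp [tgt, hx0, hab, hap, hba, hpa, hbp, hpb]
    have hi2M : i2 ∈ M := Finset.mem_insert_self _ _
    have d2 : ct w vt i2 a - ct w v i2 a = 0 ∧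
        ct w vt i2 b - ct w v i2 b = -(y + 3) ∧
        ct w vt i2 p - ct w v i2 p = y + 3 := by
      simp only [hvtM _ hi2M, i2, t2, wconc _ _ _ (hv2 0)]
      simp [tgt, hab, hap, hba, hpa, hbp, hpb]
    -- weights after the recount, by the set of unrecounted elements
    have dsum : ∀ T ⊆ E, ∀ S : Finset ({x // x ∈ X} ⊕ Fin 1 ⊕ Fin 3), S = T.image Sum.inl →
        ∑ i ∈ S, (ct w vt i a - ct w v i a) = 0 ∧
        ∑ i ∈ S, (ct w vt i b - ct w v i b) = -(3 * ((∑ x ∈ T, x.val : ℤ) : ℚ)) ∧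
        ∑ i ∈ S, (ct w vt i p - ct w v i p) = 3 * ((∑ x ∈ T, x.val : ℤ) : ℚ) := by
      rintro T hT S rfl
      simp only [Finset.sum_image (Sum.inl_injective.injOn)]
      rw [Finset.sum_congr rfl (fun x hx => (d1 x (hT hx)).1),
        Finset.sum_congr rfl (fun x hx => (d1 x (hT hx)).2.1),
        Finset.sum_congr rfl (fun x hx => (d1 x (hT hx)).2.2),
        Finset.sum_neg_distrib, ← Finset.mul_sum]
      push_cast
      simp
    have hlow : ∀ T : Finset {x // x ∈ X}, -(y : ℚ) ≤ 3 * ((∑ x ∈ T, x.val : ℤ) : ℚ) := by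
      intro T
      have h1 : -(y : ℤ) ≤ 3 * ∑ x ∈ T, x.val := by
        have h2 : ∑ x ∈ T, 3 * x.val.natAbs ≤ y := by
          rw [hy, ← Finset.sum_coe_sort X]
          exact Finset.sum_le_sum_of_subset (Finset.subset_univ T)
        have h3 : -((∑ x ∈ T, 3 * x.val.natAbs : ℕ) : ℤ) ≤ 3 * ∑ x ∈ T, x.val := by
          push_cast
          rw [Finset.mul_sum, ← Finset.sum_neg_distrib]
          refine Finset.sum_le_sum fun x _ => ?_
          have := neg_abs_le x.val
          linarith
        omega
      exact_mod_cast h1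
    have hMR : ∀ R, i2 ∉ R → ∃ T ⊆ E, M \ R = insert i2 (T.image Sum.inl) := by
      intro R hR
      refine ⟨E.filter fun x => Sum.inl x ∉ R, Finset.filter_subset _ _, ?_⟩
      ext i
      simp only [M, Finset.mem_sdiff, Finset.mem_insert, Finset.mem_image, Finset.mem_filter]
      constructor
      · rintro ⟨rfl | ⟨x, hx, rfl⟩, h⟩
        · exact Or.inl rfl
        · exact Or.inr ⟨x, ⟨hx, h⟩, rfl⟩
      · rintro (rfl | ⟨x, ⟨hx, h⟩, rfl⟩)
        · exact ⟨Or.inl rfl, hR⟩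
        · exact ⟨Or.inr ⟨x, hx, rfl⟩, h⟩
    -- with `I₂` not recounted, `p` is strictly ahead
    have hA : ∀ R, i2 ∉ R → 
        pdWeight w (recount v vt R) a < pdWeight w (recount v vt R) p ∧
        pdWeight w (recount v vt R) b < pdWeight w (recount v vt R) p := by
      intro R hR
      obtain ⟨T, hT, hS⟩ := hMR R hR
      obtain ⟨s1, s2, s3⟩ := dsum T hT _ rfl
      have hl := hlow T
      have hnot : i2 ∉ T.image (Sum.inl : _ → {x // x ∈ X} ⊕ Fin 1 ⊕ Fin 3) := by simp [i2]
      simp only [recount_weight w v vt M R hvt, hS, Finset.sum_insert hnot, s1, s2, s3, d2, Ta,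
        Tb, Tp]
      constructor <;> linarith
    refine ⟨M, by simp [M, i2], hMc.le, vt, hvt, ?_, ?_, ?_⟩
    · intro i
      by_cases hi : i ∈ M
      · simp [vt, hi]
      · simp [vt, hi]
    · have he : recount v vt ∅ = vt := by funext i c; simp [recount]
      have := hA ∅ (by simp)
      rw [he] at this
      refine pdWinner_of w vt p a b (fun c => ?_) this.1 this.2
      rcases hC c with h | h | h <;> simp [h]
    · intro R hRM hRc
      by_cases hR : i2 ∈ R
      · let T := E.filter fun x => Sum.inl x ∉ R
        have hT : T ⊆ E := Finset.filter_subset _ _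
        have hS : M \ R = T.image Sum.inl := by
          ext i
          simp only [M, T, Finset.mem_sdiff, Finset.mem_insert, Finset.mem_image,
            Finset.mem_filter]
          constructor
          · rintro ⟨rfl | ⟨x, hx, rfl⟩, h⟩
            · exact absurd hR h
            · exact ⟨x, ⟨hx, h⟩, rfl⟩
          · rintro ⟨x, ⟨hx, h⟩, rfl⟩
            exact ⟨Or.inr ⟨x, hx, rfl⟩, h⟩
        have hTn : T.Nonempty := by
          have hcard := Finset.card_sdiff_add_card_eq_card hRM
          have : (M \ R).Nonempty := Finset.card_pos.1 (by omega)
          rw [hS] at this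
          exact Finset.image_nonempty.1 this
        have hne0 : ∑ x ∈ T, x.val ≠ 0 := by
          have := hz (T.map (Function.Embedding.subtype _))
            (by rw [← hEX]; exact Finset.map_subset_map.2 hT) (by simpa using hTn)
          rwa [Finset.sum_map] at this
        obtain ⟨s1, s2, s3⟩ := dsum T hT _ rfl
        rcases lt_or_gt_of_ne hne0 with h | h
        · apply not_pdWinner_of w _ a b
          have h' : ((∑ x ∈ T, x.val : ℤ) : ℚ) ≤ -1 := by
            exact_mod_cast (by omega : (∑ x ∈ T, x.val : ℤ) ≤ -1)
          simp only [recount_weight w v vt M R hvt, hS, s1, s2, Ta, Tb]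
          linarith
        · apply not_pdWinner_of w _ a p
          have h' : (1 : ℚ) ≤ ((∑ x ∈ T, x.val : ℤ) : ℚ) := by
            exact_mod_cast (by omega : 1 ≤ (∑ x ∈ T, x.val : ℤ))
          simp only [recount_weight w v vt M R hvt, hS, s1, s3, Ta, Tp]
          linarith
      · exact not_pdWinner_of w _ a p (hA R hR).1

end PDManSSS12
end

section
/- Let G = (V, E) be a graph with ν = |V|, μ = |E| ≥ 1, and let ℓ be an integer with 1 ≤ ℓ ≤ ν − 2. Consider the weighted PD election with candidates {j_u : u ∈ V} ∪ {j_e : e ∈ E} ∪ {a, p} and the following districts: for each edge e = {x, y} ∈ E, two districts D_{e,x} and D_{e,y} of weight 5, each with 2 voters for j_e and 3 voters for j_x (respectively j_y), in which the attacker may change at most 1 vote; for each u ∈ V a district D_u of weight 5μ with 2μ voters for j_u and 3μ voters for a, in which the attacker may change at most μ votes; and unmanipulable districts: for each e ∈ E one of weight 5μ(ν−ℓ) − 5 whose winner is j_e, for each u ∈ V one of weight 5μ(ν−ℓ−1) whose winner is j_u, and one of weight 5μ(ν−ℓ) + 1 whose winner is p. Then the attacker can change votes, within the per-district limits, in at most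 ν + μ districts so that p becomes the PD winner of the resulting profile, if and only if G has an independent set of size ℓ. -/
/-!
Statement 13: correctness of the Independent-Set-based instance in the
NP-hardness proof of PD-Man in unary with defender budget 0
(Theorem `PD-Man-NPhardness1`). Candidates `{j_u} ∪ {j_e} ∪ {a, p}`.
Districts: for each dart (edge `e` with endpoint `x`) a district `D_{e,x}` of
weight 5 with 2 voters for `j_e` and 3 voters for `j_x`, manipulation limit 1;
for each vertex `u` a district `D_u` of weight `5μ` with `2μ` voters for `j_u`
and `3μ` voters for `a`, manipulation limit `μ`; and unmanipulable (limit 0)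
single-voter districts: for each edge one of weight `5μ(ν−ℓ) − 5` won by
`j_e`, for each vertex one of weight `5μ(ν−ℓ−1)` won by `j_u`, and one of
weight `5μ(ν−ℓ) + 1` won by `p`. The attacker can make `p` the PD winner by
manipulating (within the limits) at most `ν + μ` districts iff `G` has an
independent set of size `ℓ`.
-/

namespace PDManIS13

variable {D C : Type*}

/-- `a` beats `b` inside district `i`. -/
def distBeats [LT C] (v : D → C → ℕ) (i : D) (a b : C) : Prop :=
  v i b < v i a ∨ (v i a = v i b ∧ b < a)

/-- `a` is the district winner of district `i` in profile `v`. -/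
def IsDistWinner [LT C] (v : D → C → ℕ) (i : D) (a : C) : Prop :=
  ∀ b, b ≠ a → distBeats v i a b

open Classical in
/-- Total PD weight of candidate `a`. -/
noncomputable def pdWeight [Fintype D] [LT C] (w : D → ℚ) (v : D → C → ℕ) (a : C) : ℚ :=
  ∑ i, if IsDistWinner v i a then w i else 0

/-- `a` beats `b` under PD (ties broken by the linear order: `b < a` means `a ≻ b`). -/
noncomputable def pdBeats [Fintype D] [LT C] (w : D → ℚ) (v : D → C → ℕ) (a b : C) : Prop :=
  pdWeight w v b < pdWeight w v a ∨ (pdWeight w v a = pdWeight w v b ∧ b < a)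

/-- `a` is the PD winner of profile `v`. -/
noncomputable def pdWinner [Fintype D] [LT C] (w : D → ℚ) (v : D → C → ℕ) (a : C) : Prop :=
  ∀ b, b ≠ a → pdBeats w v a b

lemma winner_unique [LinearOrder C] {v : D → C → ℕ} {i : D} {a b : C}
    (ha : IsDistWinner v i a) (hb : IsDistWinner v i b) : a = b := by
  by_contra h
  have h1 := ha b (fun h' => h h'.symm)
  have h2 := hb a h
  unfold distBeats at h1 h2
  rcases h1 with h1 | ⟨h1, h1'⟩ <;> rcases h2 with h2 | ⟨h2, h2'⟩
  · omega
  · omega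
  · omega
  · exact lt_asymm h1' h2'

lemma winner_exists [Fintype C] [LinearOrder C] (v : D → C → ℕ) (i : D) (c0 : C) :
    ∃ a, IsDistWinner v i a := by
  obtain ⟨a, -, ha⟩ := Finset.exists_max_image (Finset.univ : Finset C)
    (fun c => toLex (v i c, c)) ⟨c0, Finset.mem_univ _⟩
  refine ⟨a, fun b hb => ?_⟩
  have h := ha b (Finset.mem_univ _)
  rw [Prod.Lex.toLex_le_toLex] at h
  rcases h with h | ⟨h, h'⟩
  · exact Or.inl h
  · exact Or.inr ⟨h.symm, lt_of_le_of_ne h' hb⟩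

lemma sum_two [Fintype C] [DecidableEq C] {x y : C} (hxy : x ≠ y) (m n : ℕ) :
    ∑ c, (if c = x then m else if c = y then n else 0) = m + n := by
  have : ∀ c, (if c = x then m else if c = y then n else 0) =
      (if c = x then m else 0) + (if c = y then n else 0) := by
    intro c
    by_cases h : c = x
    · subst h; simp [hxy]
    · simp [h]
  simp [this, Finset.sum_add_distrib]

lemma vt_bounds [Fintype C] {f g : C → ℕ} {k : ℕ} (hs : ∑ c, g c = ∑ c, f c)
    (hk : ∑ c, (g c - f c) ≤ k) (c : C) : g c ≤ f c + k ∧ f c ≤ g c + k := by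
  have h1 : ∑ c, g c + ∑ c, (f c - g c) = ∑ c, f c + ∑ c, (g c - f c) := by
    rw [← Finset.sum_add_distrib, ← Finset.sum_add_distrib]
    exact Finset.sum_congr rfl (fun c _ => by omega)
  have h2 := Finset.single_le_sum (f := fun c => g c - f c) (fun _ _ => Nat.zero_le _)
    (Finset.mem_univ c)
  have h3 := Finset.single_le_sum (f := fun c => f c - g c) (fun _ _ => Nat.zero_le _)
    (Finset.mem_univ c)
  omega

lemma winner_two [Fintype C] [LinearOrder C] {v vt : D → C → ℕ} {i : D} {x y : C} {m n k : ℕ}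
    (hv : ∀ c, v i c = if c = x then m else if c = y then n else 0)
    (hxy : x ≠ y) (hs : ∑ c, vt i c = ∑ c, v i c) (hk : ∑ c, (vt i c - v i c) ≤ k)
    (hkn : 2 * k < n) : IsDistWinner vt i x ∨ IsDistWinner vt i y := by
  obtain ⟨z, hz⟩ := winner_exists vt i x
  by_cases hzx : z = x
  · subst hzx; exact Or.inl hz
  by_cases hzy : z = y
  · subst hzy; exact Or.inr hz
  exfalso
  have h1 := hz y (fun h => hzy h.symm)
  have h2 := (vt_bounds hs hk z).1
  have h3 := (vt_bounds hs hk y).2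
  rw [hv] at h2 h3
  simp only [hzx, hzy, hxy.symm, if_false, if_true] at h2 h3
  unfold distBeats at h1
  omega

lemma winner_single [Fintype C] [LinearOrder C] {v vt : D → C → ℕ} {i : D} {x : C}
    (hv : ∀ c, v i c = if c = x then 1 else 0)
    (hs : ∑ c, vt i c = ∑ c, v i c) (hk : ∑ c, (vt i c - v i c) ≤ 0) :
    IsDistWinner vt i x := by
  intro b hb
  left
  have h1 := vt_bounds hs hk b
  have h2 := vt_bounds hs hk x
  rw [hv] at h1 h2
  simp only [hb, if_false, if_true] at h1 h2
  omega

lemma winner_of_lt [LinearOrder C] {v : D → C → ℕ} {i : D} {x : C}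
    (h : ∀ b, b ≠ x → v i b < v i x) : IsDistWinner v i x :=
  fun b hb => Or.inl (h b hb)

theorem stmt13 {V : Type*} [Fintype V] [DecidableEq V]
    (G : SimpleGraph V) [DecidableRel G.Adj]
    [Fintype C] [LinearOrder C]
    (ν μ ℓ : ℕ) (hν : ν = Fintype.card V) (hμ : μ = G.edgeFinset.card)
    (hμ1 : 1 ≤ μ) (hℓ1 : 1 ≤ ℓ) (hℓν : ℓ ≤ ν - 2)
    -- the candidates: `jV u` for `u ∈ V`, `jE e` for each edge `e`, plus `a` and `p`
    (jV : V → C) (jE : Sym2 V → C) (a p : C)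
    (hjV : Function.Injective jV)
    (hjE : ∀ e ∈ G.edgeFinset, ∀ e' ∈ G.edgeFinset, jE e = jE e' → e = e')
    (hVE : ∀ u, ∀ e ∈ G.edgeFinset, jV u ≠ jE e)
    (haV : ∀ u, a ≠ jV u) (haE : ∀ e ∈ G.edgeFinset, a ≠ jE e)
    (hpV : ∀ u, p ≠ jV u) (hpE : ∀ e ∈ G.edgeFinset, p ≠ jE e) (hap : a ≠ p)
    (hC : ∀ c : C, (∃ u, c = jV u) ∨ (∃ e ∈ G.edgeFinset, c = jE e) ∨ c = a ∨ c = p)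
    -- true votes, weights, and per-district manipulation limits
    (v : (G.Dart ⊕ V ⊕ (↥G.edgeFinset ⊕ V ⊕ Fin 1)) → C → ℕ)
    (w : (G.Dart ⊕ V ⊕ (↥G.edgeFinset ⊕ V ⊕ Fin 1)) → ℚ)
    (γ : (G.Dart ⊕ V ⊕ (↥G.edgeFinset ⊕ V ⊕ Fin 1)) → ℕ)
    -- districts `D_{e,x}` (one per dart): 2 voters for `j_e`, 3 for `j_x`
    (hv1 : ∀ d : G.Dart, ∀ c, v (Sum.inl d) c =
      if c = jE d.edge then 2 else if c = jV d.toProd.1 then 3 else 0)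
    (hw1 : ∀ d : G.Dart, w (Sum.inl d) = 5)
    (hγ1 : ∀ d : G.Dart, γ (Sum.inl d) = 1)
    -- districts `D_u`: `2μ` voters for `j_u`, `3μ` for `a`
    (hv2 : ∀ u : V, ∀ c, v (Sum.inr (Sum.inl u)) c =
      if c = jV u then 2 * μ else if c = a then 3 * μ else 0)
    (hw2 : ∀ u : V, w (Sum.inr (Sum.inl u)) = 5 * μ)
    (hγ2 : ∀ u : V, γ (Sum.inr (Sum.inl u)) = μ)
    -- unmanipulable districts (single voter each), with the prescribed weights
    (hv3 : ∀ e : ↥G.edgeFinset, ∀ c, v (Sum.inr (Sum.inr (Sum.inl e))) c =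
      if c = jE e.val then 1 else 0)
    (hw3 : ∀ e : ↥G.edgeFinset, w (Sum.inr (Sum.inr (Sum.inl e))) =
      5 * (μ : ℚ) * ((ν : ℚ) - ℓ) - 5)
    (hγ3 : ∀ e : ↥G.edgeFinset, γ (Sum.inr (Sum.inr (Sum.inl e))) = 0)
    (hv4 : ∀ u : V, ∀ c, v (Sum.inr (Sum.inr (Sum.inr (Sum.inl u)))) c =
      if c = jV u then 1 else 0)
    (hw4 : ∀ u : V, w (Sum.inr (Sum.inr (Sum.inr (Sum.inl u)))) =
      5 * (μ : ℚ) * ((ν : ℚ) - ℓ - 1))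
    (hγ4 : ∀ u : V, γ (Sum.inr (Sum.inr (Sum.inr (Sum.inl u)))) = 0)
    (hv5 : ∀ i : Fin 1, ∀ c, v (Sum.inr (Sum.inr (Sum.inr (Sum.inr i)))) c =
      if c = p then 1 else 0)
    (hw5 : ∀ i : Fin 1, w (Sum.inr (Sum.inr (Sum.inr (Sum.inr i)))) =
      5 * (μ : ℚ) * ((ν : ℚ) - ℓ) + 1)
    (hγ5 : ∀ i : Fin 1, γ (Sum.inr (Sum.inr (Sum.inr (Sum.inr i)))) = 0) :
    (∃ M : Finset (G.Dart ⊕ V ⊕ (↥G.edgeFinset ⊕ V ⊕ Fin 1)),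
        M.card ≤ ν + μ ∧
        ∃ vt : (G.Dart ⊕ V ⊕ (↥G.edgeFinset ⊕ V ⊕ Fin 1)) → C → ℕ,
          (∀ i ∉ M, ∀ c, vt i c = v i c) ∧
          (∀ i, ∑ c, vt i c = ∑ c, v i c) ∧
          (∀ i, ∑ c, (vt i c - v i c) ≤ γ i) ∧
          pdWinner w vt p) ↔
      (∃ V' : Finset V, V'.card = ℓ ∧ ∀ u ∈ V', ∀ u' ∈ V', ¬ G.Adj u u') := by
  classical
  have hEd : ∀ d : G.Dart, d.edge ∈ G.edgeFinset := fun d => by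
    rw [SimpleGraph.mem_edgeFinset]; exact d.edge_mem
  have hμq : (1 : ℚ) ≤ μ := by exact_mod_cast hμ1
  have core : ∀ vt : (G.Dart ⊕ V ⊕ (↥G.edgeFinset ⊕ V ⊕ Fin 1)) → C → ℕ,
      (∀ i, ∑ c, vt i c = ∑ c, v i c) → (∀ i, ∑ c, (vt i c - v i c) ≤ γ i) →
      (pdWinner w vt p ↔
        ((Finset.univ.filter (fun u => ¬ IsDistWinner vt (Sum.inr (Sum.inl u)) (jV u))).card
            ≤ ν - ℓ ∧
          (∀ d : G.Dart, IsDistWinner vt (Sum.inr (Sum.inl d.toProd.1)) (jV d.toProd.1) →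
            IsDistWinner vt (Sum.inl d) (jE d.edge)) ∧
          (∀ d : G.Dart, ¬ (IsDistWinner vt (Sum.inl d) (jE d.edge) ∧
            IsDistWinner vt (Sum.inl d.symm) (jE d.edge))))) := by
    intro vt hs hk
    choose W hW using fun i => winner_exists vt i p
    have hWi : ∀ i c, IsDistWinner vt i c ↔ W i = c := fun i c =>
      ⟨fun h => winner_unique (hW i) h, fun h => h ▸ hW i⟩
    have W1 : ∀ d : G.Dart, W (Sum.inl d) = jE d.edge ∨ W (Sum.inl d) = jV d.toProd.1 := by
      intro d
      simp only [← hWi]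
      exact winner_two (hv1 d) (hVE _ _ (hEd d)).symm (hs _) (hk _) (by rw [hγ1]; norm_num)
    have W2 : ∀ u : V, W (Sum.inr (Sum.inl u)) = jV u ∨ W (Sum.inr (Sum.inl u)) = a := by
      intro u
      simp only [← hWi]
      exact winner_two (hv2 u) (haV u).symm (hs _) (hk _) (by rw [hγ2]; omega)
    have W3 : ∀ e : ↥G.edgeFinset, W (Sum.inr (Sum.inr (Sum.inl e))) = jE e.val := by
      intro e
      rw [← hWi]
      exact winner_single (hv3 e) (hs _) ((hk _).trans (hγ3 e).le)
    have W4 : ∀ u : V, W (Sum.inr (Sum.inr (Sum.inr (Sum.inl u)))) = jV u := by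
      intro e
      rw [← hWi]
      exact winner_single (hv4 e) (hs _) ((hk _).trans (hγ4 e).le)
    have W5 : ∀ i : Fin 1, W (Sum.inr (Sum.inr (Sum.inr (Sum.inr i)))) = p := by
      intro e
      rw [← hWi]
      exact winner_single (hv5 e) (hs _) ((hk _).trans (hγ5 e).le)
    have hwt : ∀ c, pdWeight w vt c =
        5 * ((Finset.univ.filter (fun d : G.Dart => W (Sum.inl d) = c)).card : ℚ) +
        (5 * μ * ((Finset.univ.filter (fun u : V => W (Sum.inr (Sum.inl u)) = c)).card : ℚ) +
        ((∑ e : ↥G.edgeFinset, if jE e.val = c then 5 * (μ : ℚ) * ((ν : ℚ) - ℓ) - 5 else 0) +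
        ((∑ u : V, if jV u = c then 5 * (μ : ℚ) * ((ν : ℚ) - ℓ - 1) else 0) +
        (if p = c then 5 * (μ : ℚ) * ((ν : ℚ) - ℓ) + 1 else 0)))) := by
      intro c
      unfold pdWeight
      simp only [Fintype.sum_sum_type, hWi, W3, W4, W5, hw1, hw2, hw3, hw4, hw5]
      simp [← Finset.sum_filter, mul_comm]
    have wp : pdWeight w vt p = 5 * (μ : ℚ) * ((ν : ℚ) - ℓ) + 1 := by
      rw [hwt]
      have e1 : (Finset.univ.filter (fun d : G.Dart => W (Sum.inl d) = p)) = ∅ := by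
        ext d
        rcases W1 d with h | h <;> simp [h, (hpV _).symm, (hpE _ (hEd d)).symm]
      have e2 : (Finset.univ.filter (fun u : V => W (Sum.inr (Sum.inl u)) = p)) = ∅ := by
        ext d
        rcases W2 d with h | h <;> simp [h, (hpV _).symm, hap]
      have e3 : ∀ e : ↥G.edgeFinset, jE e.val ≠ p := fun e => (hpE _ e.2).symm
      have e4 : ∀ u, jV u ≠ p := fun e => (hpV _).symm
      simp only [e1, e2, e3, e4]
      simp
    have wa : pdWeight w vt a = 5 * (μ : ℚ) *
        ((Finset.univ.filter (fun u : V => ¬ W (Sum.inr (Sum.inl u)) = jV u)).card : ℚ) := by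
      rw [hwt]
      have e1 : (Finset.univ.filter (fun d : G.Dart => W (Sum.inl d) = a)) = ∅ := by
        ext d
        rcases W1 d with h | h <;> simp [h, (haV _).symm, (haE _ (hEd d)).symm]
      have e2 : (Finset.univ.filter (fun u : V => W (Sum.inr (Sum.inl u)) = a)) =
          (Finset.univ.filter (fun u : V => ¬ W (Sum.inr (Sum.inl u)) = jV u)) := by
        ext d
        rcases W2 d with h | h <;> simp [h, (haV _).symm, haV]
      have e3 : ∀ e : ↥G.edgeFinset, jE e.val ≠ a := fun e => (haE _ e.2).symm
      have e4 : ∀ u, jV u ≠ a := fun e => (haV _).symm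
      simp only [e1, e2, e3, e4]
      simp [hap.symm]
    have wV : ∀ u, pdWeight w vt (jV u) = 5 * (μ : ℚ) * ((ν : ℚ) - ℓ - 1) +
        5 * ((Finset.univ.filter (fun d : G.Dart => d.toProd.1 = u ∧
          ¬ W (Sum.inl d) = jE d.edge)).card : ℚ) +
        (if W (Sum.inr (Sum.inl u)) = jV u then 5 * (μ : ℚ) else 0) := by
      intro u
      rw [hwt]
      have e1 : (Finset.univ.filter (fun d : G.Dart => W (Sum.inl d) = jV u)) =
          (Finset.univ.filter (fun d : G.Dart => d.toProd.1 = u ∧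
          ¬ W (Sum.inl d) = jE d.edge)) := by
        ext d
        rcases W1 d with h | h
        · simp [h, (hVE u _ (hEd d)).symm]
        · simp [h, hVE _ _ (hEd d), hjV.eq_iff]
      have e2 : ((Finset.univ.filter (fun x : V => W (Sum.inr (Sum.inl x)) = jV u)).card : ℚ) =
          if W (Sum.inr (Sum.inl u)) = jV u then 1 else 0 := by
        have : (Finset.univ.filter (fun x : V => W (Sum.inr (Sum.inl x)) = jV u)) =
            if W (Sum.inr (Sum.inl u)) = jV u then {u} else ∅ := by
          ext x
          split_ifs with h'
          · rcases W2 x with h | h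
            · simp [h, hjV.eq_iff]
            · simp only [Finset.mem_filter_univ, Finset.mem_singleton, h, haV, false_iff]
              rintro rfl
              exact haV _ (h.symm.trans h')
          · rcases W2 x with h | h
            · simp only [Finset.mem_filter_univ, h, Finset.notMem_empty, iff_false]
              intro h2
              have := hjV h2
              subst this
              exact h' h
            · simp [h, haV]
        rw [this]
        split_ifs <;> simp
      have e3 : ∀ e : ↥G.edgeFinset, jE e.val ≠ jV u := fun e => (hVE _ _ e.2).symm
      simp only [e1, e2, e3, hpV, hjV.eq_iff]
      simp
      split_ifs <;> ring
    have wE : ∀ e ∈ G.edgeFinset, pdWeight w vt (jE e) = 5 * (μ : ℚ) * ((ν : ℚ) - ℓ) - 5 +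
        5 * ((Finset.univ.filter (fun d : G.Dart => d.edge = e ∧
          W (Sum.inl d) = jE e)).card : ℚ) := by
      intro e he
      rw [hwt]
      have e1 : (Finset.univ.filter (fun d : G.Dart => W (Sum.inl d) = jE e)) =
          (Finset.univ.filter (fun d : G.Dart => d.edge = e ∧
          W (Sum.inl d) = jE e)) := by
        ext d
        rcases W1 d with h | h
        · simp only [Finset.mem_filter_univ, h]
          exact ⟨fun h => ⟨hjE _ (hEd d) _ he h, h⟩, fun h => h.2⟩
        · simp [h, hVE _ _ he]
      have e2 : (Finset.univ.filter (fun u : V => W (Sum.inr (Sum.inl u)) = jE e)) = ∅ := by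
        ext d
        rcases W2 d with h | h <;> simp [h, hVE _ _ he, haE _ he]
      have e3 : ∀ e' : ↥G.edgeFinset, jE e'.val = jE e ↔ e' = ⟨e, he⟩ := fun e' =>
        ⟨fun h => Subtype.ext (hjE _ e'.2 _ he h), fun h => by rw [h]⟩
      have e4 : ∀ u, jV u ≠ jE e := fun u => hVE _ _ he
      simp only [e1, e2, e3, e4, hpE _ he]
      simp
      ring
    simp only [hWi]
    have hcast : ((ν - ℓ : ℕ) : ℚ) = (ν : ℚ) - ℓ := by
      rw [Nat.cast_sub]; omega
    -- integrality: `p` beats `b` iff weight comparison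
    have hbeat : ∀ b, b ≠ p → (∃ n : ℤ, pdWeight w vt b = 5 * n) →
        (pdBeats w vt p b ↔ pdWeight w vt b ≤ 5 * (μ : ℚ) * ((ν : ℚ) - ℓ)) := by
      rintro b - ⟨n, hn⟩
      unfold pdBeats
      rw [wp, hn]
      have hh : 5 * (μ : ℚ) * ((ν : ℚ) - ℓ) = ((5 * ((μ : ℤ) * ((ν : ℤ) - ℓ)) : ℤ) : ℚ) := by
        push_cast; ring
      rw [hh]
      generalize (μ : ℤ) * ((ν : ℤ) - ℓ) = t
      constructor
      · rintro (h | ⟨h, -⟩)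
        · have h' : 5 * n < 5 * t + 1 := by exact_mod_cast h
          have : 5 * n ≤ 5 * t := by omega
          exact_mod_cast this
        · have h' : 5 * t + 1 = 5 * n := by exact_mod_cast h
          omega
      · intro h
        left
        linarith
    have ba : pdBeats w vt p a ↔
        (Finset.univ.filter (fun u : V => ¬ W (Sum.inr (Sum.inl u)) = jV u)).card ≤ ν - ℓ := by
      rw [hbeat a hap ⟨μ * (Finset.univ.filter
        (fun u : V => ¬ W (Sum.inr (Sum.inl u)) = jV u)).card, by rw [wa]; push_cast; ring⟩, wa,
        ← hcast, mul_le_mul_iff_right₀ (by positivity)]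
      exact_mod_cast Iff.rfl
    have bV : ∀ u, pdBeats w vt p (jV u) ↔ (W (Sum.inr (Sum.inl u)) = jV u →
        ∀ d : G.Dart, d.toProd.1 = u → W (Sum.inl d) = jE d.edge) := by
      intro u
      have hdeg : (Finset.univ.filter (fun d : G.Dart => d.toProd.1 = u ∧
          ¬ W (Sum.inl d) = jE d.edge)).card ≤ μ := by
        rw [hμ]
        refine Finset.card_le_card_of_injOn (fun d => d.edge) (fun d _ => hEd d) ?_
        intro d hd d' hd' h
        simp only [Finset.coe_filter, Finset.mem_univ, true_and, Set.mem_setOf_eq] at hd hd'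
        rcases SimpleGraph.dart_edge_eq_iff d d' |>.1 h with h | h
        · exact h
        · exfalso
          have h1 := congrArg (fun d => d.toProd.2) h
          simp at h1
          exact d.adj.ne (hd.1.trans (hd'.1.symm.trans h1.symm))
      have hdegq : ((Finset.univ.filter (fun d : G.Dart => d.toProd.1 = u ∧
          ¬ W (Sum.inl d) = jE d.edge)).card : ℚ) ≤ μ := by exact_mod_cast hdeg
      rw [hbeat _ (hpV u).symm ⟨μ * (ν - ℓ - 1) + (Finset.univ.filter
        (fun d : G.Dart => d.toProd.1 = u ∧ ¬ W (Sum.inl d) = jE d.edge)).card +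
        (if W (Sum.inr (Sum.inl u)) = jV u then μ else 0), by
          rw [wV]; push_cast; split_ifs <;> ring⟩, wV]
      split_ifs with h
      · simp only [h, true_imp_iff]
        constructor
        · intro h1
          have h2 : ((Finset.univ.filter (fun d : G.Dart => d.toProd.1 = u ∧
            ¬ W (Sum.inl d) = jE d.edge)).card : ℚ) ≤ 0 := by linarith
          have h3 : (Finset.univ.filter (fun d : G.Dart => d.toProd.1 = u ∧
            ¬ W (Sum.inl d) = jE d.edge)).card = 0 := by
              have : (Finset.univ.filter (fun d : G.Dart => d.toProd.1 = u ∧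
                ¬ W (Sum.inl d) = jE d.edge)).card ≤ 0 := by exact_mod_cast h2
              omega
          intro d hd
          by_contra hne
          exact Finset.filter_eq_empty_iff.1 (Finset.card_eq_zero.1 h3) (Finset.mem_univ d)
            ⟨hd, hne⟩
        · intro h1
          have h3 : (Finset.univ.filter (fun d : G.Dart => d.toProd.1 = u ∧
            ¬ W (Sum.inl d) = jE d.edge)) = ∅ :=
              Finset.filter_eq_empty_iff.2 (fun d _ h => h.2 (h1 d h.1))
          rw [h3]
          simp
          linarith
      · simp only [h, false_imp_iff, iff_true]
        linarith
    have bE : ∀ e ∈ G.edgeFinset, (pdBeats w vt p (jE e) ↔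
        ∀ d : G.Dart, d.edge = e → ¬ (W (Sum.inl d) = jE e ∧ W (Sum.inl d.symm) = jE e)) := by
      intro e he
      rw [hbeat _ (hpE e he).symm ⟨μ * (ν - ℓ) - 1 + (Finset.univ.filter
        (fun d : G.Dart => d.edge = e ∧ W (Sum.inl d) = jE e)).card, by
          rw [wE e he]; push_cast; ring⟩, wE e he]
      have : (5 * (μ : ℚ) * ((ν : ℚ) - ℓ) - 5 + 5 * ((Finset.univ.filter
        (fun d : G.Dart => d.edge = e ∧ W (Sum.inl d) = jE e)).card : ℚ) ≤
          5 * (μ : ℚ) * ((ν : ℚ) - ℓ)) ↔ (Finset.univ.filter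
        (fun d : G.Dart => d.edge = e ∧ W (Sum.inl d) = jE e)).card ≤ 1 := by
        rw [← Nat.cast_le (α := ℚ)]
        constructor <;> intro h <;> push_cast at * <;> linarith
      rw [this, Finset.card_le_one]
      constructor
      · rintro h d hd ⟨h1, h2⟩
        have := h d (by simp [hd, h1]) d.symm (by simp [hd, h2])
        exact d.symm_ne this.symm
      · intro h d hd d' hd'
        simp only [Finset.mem_filter_univ] at hd hd'
        rcases SimpleGraph.dart_edge_eq_iff d d' |>.1 (hd.1.trans hd'.1.symm) with h' | h'
        · exact h'
        · exfalso
          subst h'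
          exact h d' hd'.1 ⟨hd'.2, hd.2⟩
    constructor
    · intro h
      refine ⟨ba.1 (h a hap), fun d hd => (bV _).1 (h _ (hpV _).symm) hd d rfl, fun d => ?_⟩
      exact (bE _ (hEd d)).1 (h _ (hpE _ (hEd d)).symm) d rfl
    · rintro ⟨h1, h2, h3⟩ b hb
      rcases hC b with ⟨u, rfl⟩ | ⟨e, he, rfl⟩ | rfl | rfl
      · rw [bV]
        rintro hu d rfl
        exact h2 d hu
      · rw [bE e he]
        rintro d rfl
        exact h3 d
      · exact ba.2 h1
      · exact absurd rfl hb
  constructor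
  · rintro ⟨M, -, vt, -, hs, hk, hp⟩
    obtain ⟨h1, h2, h3⟩ := (core vt hs hk).1 hp
    have h4 := Finset.card_filter_add_card_filter_not (s := (Finset.univ : Finset V))
      (fun u => IsDistWinner vt (Sum.inr (Sum.inl u)) (jV u))
    rw [Finset.card_univ, ← hν] at h4
    obtain ⟨S, hS, hSc⟩ := Finset.exists_subset_card_eq (n := ℓ)
      (s := Finset.univ.filter (fun u => IsDistWinner vt (Sum.inr (Sum.inl u)) (jV u))) (by omega)
    refine ⟨S, hSc, fun u hu u' hu' hadj => ?_⟩
    have hu := (Finset.mem_filter.1 (hS hu)).2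
    have hu' := (Finset.mem_filter.1 (hS hu')).2
    let d : G.Dart := ⟨(u, u'), hadj⟩
    refine h3 d ⟨h2 d hu, ?_⟩
    have := h2 d.symm hu'
    rwa [SimpleGraph.Dart.edge_symm] at this
  · rintro ⟨V', hcard, hind⟩
    let vt : (G.Dart ⊕ V ⊕ (↥G.edgeFinset ⊕ V ⊕ Fin 1)) → C → ℕ := fun i c =>
      match i with
      | Sum.inl d => if d.toProd.1 ∈ V' then
          (if c = jE d.edge then 3 else if c = jV d.toProd.1 then 2 else 0) else v (Sum.inl d) c
      | Sum.inr (Sum.inl u) => if u ∈ V' then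
          (if c = jV u then 3 * μ else if c = a then 2 * μ else 0) else v (Sum.inr (Sum.inl u)) c
      | Sum.inr (Sum.inr i) => v (Sum.inr (Sum.inr i)) c
    have t1 : ∀ d c, vt (Sum.inl d) c = if d.toProd.1 ∈ V' then
          (if c = jE d.edge then 3 else if c = jV d.toProd.1 then 2 else 0)
          else v (Sum.inl d) c := fun _ _ => rfl
    have t2 : ∀ u c, vt (Sum.inr (Sum.inl u)) c = if u ∈ V' then
          (if c = jV u then 3 * μ else if c = a then 2 * μ else 0)
          else v (Sum.inr (Sum.inl u)) c := fun _ _ => rfl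
    have t3 : ∀ i c, vt (Sum.inr (Sum.inr i)) c = v (Sum.inr (Sum.inr i)) c := fun _ _ => rfl
    have hne1 : ∀ d : G.Dart, jE d.edge ≠ jV d.toProd.1 := fun d => (hVE _ _ (hEd d)).symm
    have hne2 : ∀ u, jV u ≠ a := fun u => (haV u).symm
    have hs : ∀ i, ∑ c, vt i c = ∑ c, v i c := by
      rintro (d | u | i)
      · simp only [t1]
        split_ifs with h
        · simp only [hv1, sum_two (hne1 d)]
        · rfl
      · simp only [t2]
        split_ifs with h
        · simp only [hv2, sum_two (hne2 u)]; ring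
        · rfl
      · rfl
    have hk : ∀ i, ∑ c, (vt i c - v i c) ≤ γ i := by
      rintro (d | u | i)
      · simp only [t1, hγ1]
        split_ifs with h
        · calc _ ≤ ∑ c, (if c = jE d.edge then 1 else 0) := by
                refine Finset.sum_le_sum fun c _ => ?_
                rw [hv1]; split_ifs <;> simp
            _ ≤ 1 := by simp
        · simp
      · simp only [t2, hγ2]
        split_ifs with h
        · calc _ ≤ ∑ c, (if c = jV u then μ else 0) := by
                refine Finset.sum_le_sum fun c _ => ?_
                rw [hv2]; split_ifs <;> omega
            _ ≤ μ := by simp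
        · simp
      · simp [t3]
    have w1 : ∀ d : G.Dart, IsDistWinner vt (Sum.inl d) (jE d.edge) ↔ d.toProd.1 ∈ V' := by
      intro d
      constructor
      · intro h
        by_contra hn
        have := h _ (hne1 d).symm
        unfold distBeats at this
        simp [t1, hn, hv1, (hne1 d).symm] at this
      · intro h
        refine winner_of_lt fun b hb => ?_
        simp only [t1, h, hb, if_true, if_false]
        split_ifs <;> omega
    have w2 : ∀ u, IsDistWinner vt (Sum.inr (Sum.inl u)) (jV u) ↔ u ∈ V' := by
      intro u
      constructor
      · intro h
        by_contra hn
        have := h _ (haV u)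
        unfold distBeats at this
        simp only [t2, hn, hv2, haV u, if_true, if_false] at this
        omega
      · intro h
        refine winner_of_lt fun b hb => ?_
        simp only [t2, h, hb, if_true, if_false]
        split_ifs <;> omega
    refine ⟨(Finset.univ.filter (fun d : G.Dart => d.toProd.1 ∈ V')).image Sum.inl ∪
      V'.image (fun u => Sum.inr (Sum.inl u)), ?_, vt, ?_, hs, hk, ?_⟩
    · have c1 : (Finset.univ.filter (fun d : G.Dart => d.toProd.1 ∈ V')).card ≤ μ := by
        rw [hμ]
        refine Finset.card_le_card_of_injOn (fun d => d.edge) (fun d _ => hEd d) ?_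
        intro d hd d' hd' h
        simp only [Finset.coe_filter, Finset.mem_univ, true_and, Set.mem_setOf_eq] at hd hd'
        rcases SimpleGraph.dart_edge_eq_iff d d' |>.1 h with h | h
        · exact h
        · exfalso
          subst h
          exact hind _ hd' _ hd d'.adj
      refine (Finset.card_union_le _ _).trans ?_
      have c2 := Finset.card_image_le (s := Finset.univ.filter (fun d : G.Dart => d.toProd.1 ∈ V'))
        (f := (Sum.inl : _ → G.Dart ⊕ V ⊕ (↥G.edgeFinset ⊕ V ⊕ Fin 1)))
      have c3 := Finset.card_image_le (s := V')
        (f := fun u => (Sum.inr (Sum.inl u) : G.Dart ⊕ V ⊕ (↥G.edgeFinset ⊕ V ⊕ Fin 1)))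
      omega
    · rintro (d | u | i) hi c
      · have : d.toProd.1 ∉ V' := fun h => hi (by simp [h])
        rw [t1, if_neg this]
      · have : u ∉ V' := fun h => hi (by simp [h])
        rw [t2, if_neg this]
      · rfl
    · rw [core vt hs hk]
      simp only [w1, w2]
      refine ⟨?_, fun d h => h, ?_⟩
      · have h4 := Finset.card_filter_add_card_filter_not (s := (Finset.univ : Finset V))
          (fun u => u ∈ V')
        rw [Finset.card_univ, ← hν, Finset.filter_univ_mem] at h4
        omega
      · rintro d ⟨h1, h2⟩
        rw [← SimpleGraph.Dart.edge_symm, w1] at h2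
        exact hind _ h1 _ h2 d.adj


end PDManIS13
end

section
/- Let Y be a finite set of positive integers, r an integer with 0 ≤ r ≤ |Y|, and f a positive integer. Let q = |Y| − r and s = (Σ_{y∈Y} y) − f. Then there exists Y' ⊆ Y with |Y'| = r such that Σ_{y∈Y''} y ≠ f for every subset Y'' ⊆ Y', if and only if there exists Z ⊆ Y with |Z| = q such that Σ_{y∈Z} y + Σ_{y∈W} y ≠ s for every subset W ⊆ Y \ Z. -/
/-!
Statement 15: the complementation reformulation of SSS⁺. For a finite set `Y`
of positive integers, `r ≤ |Y|`, and a positive integer `f`, with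
`q = |Y| − r` and `s = (Σ_{y∈Y} y) − f`: there is `Y' ⊆ Y` with `|Y'| = r`
such that no subset of `Y'` sums to `f`, iff there is `Z ⊆ Y` with `|Z| = q`
such that `Σ_{y∈Z} y + Σ_{y∈W} y ≠ s` for every `W ⊆ Y \ Z`.
-/

theorem stmt15 (Y : Finset ℕ) (hY : ∀ y ∈ Y, 0 < y)
    (r : ℕ) (hr : r ≤ Y.card) (f : ℕ) (hf : 0 < f)
    (q : ℕ) (hq : q = Y.card - r)
    (s : ℤ) (hs : s = (∑ y ∈ Y, (y : ℤ)) - f) :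
    (∃ Y' ⊆ Y, Y'.card = r ∧ ∀ Y'' ⊆ Y', ∑ y ∈ Y'', y ≠ f) ↔
      (∃ Z ⊆ Y, Z.card = q ∧
        ∀ W ⊆ Y \ Z, (∑ y ∈ Z, (y : ℤ)) + (∑ y ∈ W, (y : ℤ)) ≠ s) := by
  have key : ∀ A B : Finset ℕ, A ⊆ B →
      (∑ y ∈ B \ A, (y : ℤ)) + ∑ y ∈ A, (y : ℤ) = ∑ y ∈ B, (y : ℤ) :=
    fun A B h => Finset.sum_sdiff h
  constructor
  · rintro ⟨Y', hY', hc, h⟩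
    refine ⟨Y \ Y', Finset.sdiff_subset, ?_, ?_⟩
    · rw [Finset.card_sdiff_of_subset hY', hc, hq]
    · intro W hW he
      rw [Finset.sdiff_sdiff_eq_self hY'] at hW
      apply h (Y' \ W) Finset.sdiff_subset
      have h1 := key Y' Y hY'
      have h2 := key W Y' hW
      zify
      linarith
  · rintro ⟨Z, hZ, hc, h⟩
    refine ⟨Y \ Z, Finset.sdiff_subset, ?_, ?_⟩
    · rw [Finset.card_sdiff_of_subset hZ, hc, hq]
      omega
    · intro V hV he
      apply h ((Y \ Z) \ V) Finset.sdiff_subset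
      have h1 := key Z Y hZ
      have h2 := key V (Y \ Z) hV
      zify at he
      linarith
end

section
/- Let Y be a finite multiset of positive integers, r an integer with 1 ≤ r ≤ |Y|, and f a positive integer. Let q = |Y| − r, z = (Σ_{x∈Y} x) + 1, z' = −f − (q+1)z, and ℓ = |Y| + 2q + 2, and let X be the multiset consisting of all elements of Y together with 2q+1 copies of z and q+1 copies of z'. Then there exists a sub-multiset Y' of Y with |Y'| = r such that Σ_{x∈Y''} x ≠ f for every sub-multiset Y'' of Y', if and only if there exists a sub-multiset X' of X with |X'| = ℓ such that Σ_{x∈X''} x ≠ 0 for every nonempty sub-multiset X'' of X'. -/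
theorem aux_split {A B C : Multiset ℤ} (h : C ≤ A + B) :
    ∃ A' ≤ A, ∃ B' ≤ B, C = A' + B' := by
  classical
  refine ⟨C ∩ A, Multiset.inter_le_right, C - A, tsub_le_iff_left.mpr h, ?_⟩
  rw [add_comm, Multiset.sub_add_inter]

theorem aux_decomp {Y : Multiset ℕ} {m n : ℕ} {z z' : ℤ} {C : Multiset ℤ}
    (h : C ≤ Y.map (Nat.cast : ℕ → ℤ) + Multiset.replicate m z + Multiset.replicate n z') :
    ∃ Y₁ ≤ Y, ∃ b ≤ m, ∃ c ≤ n,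
      C = Y₁.map (Nat.cast : ℕ → ℤ) + Multiset.replicate b z + Multiset.replicate c z' := by
  obtain ⟨A, hA, D, hD, rfl⟩ := aux_split h
  obtain ⟨E, hE, F, hF, rfl⟩ := aux_split hA
  rw [Multiset.le_replicate_iff] at hD hF
  obtain ⟨c, hc, rfl⟩ := hD
  obtain ⟨b, hb, rfl⟩ := hF
  refine ⟨E.map Int.toNat, ?_, b, hb, c, hc, ?_⟩
  · have := Multiset.map_le_map (f := Int.toNat) hE
    simpa [Multiset.map_map, Function.comp_def] using this
  · congr 2
    rw [Multiset.map_map]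
    conv_lhs => rw [← Multiset.map_id E]
    apply Multiset.map_congr rfl
    intro x hx
    have := Multiset.mem_of_le hE hx
    rw [Multiset.mem_map] at this
    obtain ⟨y, -, rfl⟩ := this
    simp

theorem aux_sum (Y : Multiset ℕ) (b c : ℕ) (z z' : ℤ) :
    (Y.map (Nat.cast : ℕ → ℤ) + Multiset.replicate b z + Multiset.replicate c z').sum
      = (Y.sum : ℤ) + b * z + c * z' := by
  simp [Nat.cast_multiset_sum]

theorem aux_sum_le {A B : Multiset ℕ} (h : A ≤ B) : A.sum ≤ B.sum := by
  obtain ⟨C, rfl⟩ := Multiset.le_iff_exists_add.mp h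
  simp

theorem aux_zero {Y : Multiset ℕ} (hY : ∀ y ∈ Y, 0 < y) (h : Y.sum = 0) : Y = 0 := by
  rw [Multiset.eq_zero_iff_forall_notMem]
  intro a ha
  have := hY a ha
  have := Multiset.le_sum_of_mem ha
  omega

theorem aux_cast (Y : Multiset ℕ) :
    (Y.map (fun y => (y : ℤ)) : Multiset ℤ) = Multiset.map (Nat.cast : ℕ → ℤ) Y := by
  simp only [Multiset.map_id', Multiset.bind_def, Multiset.pure_def]
  exact Multiset.bind_singleton _ _

theorem stmt16 (Y : Multiset ℕ) (hY : ∀ y ∈ Y, 0 < y)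
    (r : ℕ) (hr1 : 1 ≤ r) (hr2 : r ≤ Multiset.card Y)
    (f : ℕ) (hf : 0 < f)
    (q : ℕ) (hq : q = Multiset.card Y - r)
    (z z' : ℤ) (hz : z = (Y.sum : ℤ) + 1) (hz' : z' = -(f : ℤ) - (q + 1) * z)
    (X : Multiset ℤ)
    (hX : X = Y.map (fun y => (y : ℤ)) +
      Multiset.replicate (2 * q + 1) z + Multiset.replicate (q + 1) z')
    (ℓ : ℕ) (hℓ : ℓ = Multiset.card Y + 2 * q + 2) :
    (∃ Y' ≤ Y, Multiset.card Y' = r ∧ ∀ Y'' ≤ Y', Y''.sum ≠ f) ↔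
      (∃ X' ≤ X, Multiset.card X' = ℓ ∧
        ∀ X'' ≤ X', X'' ≠ 0 → X''.sum ≠ 0) := by
  rw [aux_cast] at hX
  have hzpos : 0 < z := by rw [hz]; positivity
  constructor
  · rintro ⟨Y', hY', hcard, hno⟩
    by_cases hfz : (f : ℤ) < z
    · refine ⟨Y'.map (Nat.cast : ℕ → ℤ) + Multiset.replicate (2 * q + 1) z
        + Multiset.replicate (q + 1) z', ?_, ?_, ?_⟩
      · rw [hX]
        have := Multiset.map_le_map (f := (Nat.cast : ℕ → ℤ)) hY'
        gcongr
      · simp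
        omega
      · intro X'' hle hne hsum
        obtain ⟨Y₁, hY₁, b, hb, c, hc, rfl⟩ := aux_decomp hle
        rw [aux_sum] at hsum
        have hs := aux_sum_le (hY₁.trans hY')
        have hs' : (Y₁.sum : ℤ) < z := by rw [hz]; omega
        have hs0 : (0 : ℤ) ≤ (Y₁.sum : ℤ) := by positivity
        have hb' : (b : ℤ) ≤ 2 * q + 1 := by exact_mod_cast hb
        have hf' : (0 : ℤ) < f := by exact_mod_cast hf
        rcases Nat.lt_or_ge c 2 with h2 | h2
        · interval_cases c
          · have hbz : (0 : ℤ) ≤ b * z := by positivity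
            have h1 : (b : ℤ) * z = 0 := by simp only [Nat.cast_zero, Nat.cast_one, zero_mul, one_mul, add_zero] at hsum; linarith
            have h3 : Y₁.sum = 0 := by simp only [Nat.cast_zero, Nat.cast_one, zero_mul, one_mul, add_zero] at hsum; omega
            have hb0 : b = 0 := by
              rcases mul_eq_zero.mp h1 with h | h
              · exact_mod_cast h
              · omega
            have := aux_zero (fun y hy => hY y (Multiset.mem_of_le (hY₁.trans hY') hy)) h3
            subst this
            subst hb0
            simp at hne
          · apply hno Y₁ hY₁
            rw [hz'] at hsum
            have key : ((Y₁.sum : ℤ) - f) = ((q : ℤ) + 1 - b) * z := by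
              simp only [Nat.cast_zero, Nat.cast_one, zero_mul, one_mul, add_zero] at hsum; linarith
            have : ((q : ℤ) + 1 - b) = 0 := by
              by_contra hk
              rcases lt_or_gt_of_ne hk with hk | hk
              · nlinarith
              · nlinarith
            rw [this] at key
            omega
        · have h2' : (2 : ℤ) ≤ c := by exact_mod_cast h2
          have e1 : (b : ℤ) * z ≤ (2 * q + 1) * z := by gcongr
          have e2 : (0 : ℤ) < (f : ℤ) + (q + 1) * z := by positivity
          have e3 : 2 * ((f : ℤ) + (q + 1) * z) ≤ c * ((f : ℤ) + (q + 1) * z) := by gcongr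
          rw [hz'] at hsum
          nlinarith
    · push Not at hfz
      refine ⟨Y.map (Nat.cast : ℕ → ℤ) + Multiset.replicate (q + 1) z
        + Multiset.replicate (q + 1) z', ?_, ?_, ?_⟩
      · rw [hX]
        gcongr
        omega
      · simp
        omega
      · intro X'' hle hne hsum
        obtain ⟨Y₁, hY₁, b, hb, c, hc, rfl⟩ := aux_decomp hle
        rw [aux_sum] at hsum
        have hs := aux_sum_le hY₁
        have hs' : (Y₁.sum : ℤ) < z := by rw [hz]; omega
        have hb' : (b : ℤ) ≤ q + 1 := by exact_mod_cast hb
        rcases Nat.eq_zero_or_pos c with h2 | h2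
        · subst h2
          have hbz : (0 : ℤ) ≤ b * z := by positivity
          have h1 : (b : ℤ) * z = 0 := by simp only [Nat.cast_zero, Nat.cast_one, zero_mul, one_mul, add_zero] at hsum; linarith
          have h3 : Y₁.sum = 0 := by simp only [Nat.cast_zero, Nat.cast_one, zero_mul, one_mul, add_zero] at hsum; omega
          have hb0 : b = 0 := by
            rcases mul_eq_zero.mp h1 with h | h
            · exact_mod_cast h
            · omega
          have := aux_zero (fun y hy => hY y (Multiset.mem_of_le hY₁ hy)) h3
          subst this
          subst hb0
          simp at hne
        · have h2' : (1 : ℤ) ≤ c := by exact_mod_cast h2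
          have e1 : (b : ℤ) * z ≤ (q + 1) * z := by gcongr
          have e2 : (0 : ℤ) < (f : ℤ) + (q + 1) * z := by positivity
          have e3 : 1 * ((f : ℤ) + (q + 1) * z) ≤ c * ((f : ℤ) + (q + 1) * z) := by gcongr
          rw [hz'] at hsum
          nlinarith
  · rintro ⟨X', hX', hcard, hno⟩
    rw [hX] at hX'
    obtain ⟨Y₁, hY₁, b, hb, c, hc, rfl⟩ := aux_decomp hX'
    have hc1 := Multiset.card_le_card hY₁
    simp only [Multiset.card_add, Multiset.card_map, Multiset.card_replicate] at hcard
    obtain ⟨Y', hY', hr⟩ : ∃ Y' ≤ Y₁, Multiset.card Y' = r := by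
      have hne : 0 < Multiset.card (Multiset.powersetCard r Y₁) := by
        rw [Multiset.card_powersetCard]
        exact Nat.choose_pos (by omega)
      obtain ⟨T, hT⟩ := Multiset.card_pos_iff_exists_mem.mp hne
      exact ⟨T, Multiset.mem_powersetCard.mp hT⟩
    refine ⟨Y', hY'.trans hY₁, hr, ?_⟩
    intro Y'' hY'' hs
    refine hno (Y''.map (Nat.cast : ℕ → ℤ) + Multiset.replicate (q + 1) z
        + Multiset.replicate 1 z') ?_ ?_ ?_
    · have h1 := Multiset.map_le_map (f := (Nat.cast : ℕ → ℤ)) (hY''.trans hY')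
      exact add_le_add (add_le_add h1 ((Multiset.replicate_le_replicate z).mpr (by omega)))
        ((Multiset.replicate_le_replicate z').mpr (by omega))
    · intro h
      have := congrArg Multiset.card h
      simp at this
    · rw [aux_sum, hs, hz']
      push_cast
      ring
end

section
/- Let Y be a finite multiset of positive integers, f a positive integer, q a nonnegative integer, z = (Σ_{x∈Y} x) + 1, and z' = −f − (q+1)z. Suppose n and n' are natural numbers with n ≤ q + 1 and n' ≤ q + 1, S is a sub-multiset of Y, not all of n, n', and |S| are zero, and n'·z' + n·z + Σ_{x∈S} x = 0. Then n' = 1, n = q + 1, and Σ_{x∈S} x = f. -/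
/-!
Statement 17: the arithmetic forcing lemma from the Σ₂ᴾ-completeness proof of
Sub-Subset Sum. With `z = (Σ_{x∈Y} x) + 1` and `z' = −f − (q+1)z`, any
nonempty zero-sum selection of at most `q+1` copies of `z`, at most `q+1`
copies of `z'`, and a sub-multiset `S` of `Y` must consist of exactly one copy
of `z'`, exactly `q+1` copies of `z`, and a sub-multiset of `Y` summing to `f`.
-/

theorem stmt17 (Y : Multiset ℤ) (hY : ∀ x ∈ Y, 0 < x)
    (f : ℤ) (hf : 0 < f) (q : ℕ)
    (z z' : ℤ) (hz : z = Y.sum + 1) (hz' : z' = -f - (q + 1) * z)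
    (n n' : ℕ) (hn : n ≤ q + 1) (hn' : n' ≤ q + 1)
    (S : Multiset ℤ) (hS : S ≤ Y)
    (hne : ¬(n = 0 ∧ n' = 0 ∧ S = 0))
    (hsum : (n' : ℤ) * z' + (n : ℤ) * z + S.sum = 0) :
    n' = 1 ∧ n = q + 1 ∧ S.sum = f := by
  have hSp : ∀ x ∈ S, 0 < x := fun x hx => hY x (Multiset.mem_of_le hS hx)
  have hs0 : 0 ≤ S.sum := Multiset.sum_nonneg fun x hx => (hSp x hx).le
  have hsY : S.sum ≤ Y.sum := by
    obtain ⟨T, rfl⟩ := Multiset.le_iff_exists_add.1 hS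
    have hT : 0 ≤ T.sum :=
      Multiset.sum_nonneg fun x hx => (hY x (Multiset.mem_add.2 (Or.inr hx))).le
    rw [Multiset.sum_add]
    linarith
  have hsz : S.sum < z := by linarith
  have hzp : 0 < z := by linarith
  have hS0 : S.sum = 0 → S = 0 := by
    intro h
    by_contra hne0
    obtain ⟨a, ha⟩ := Multiset.exists_mem_of_ne_zero hne0
    obtain ⟨T, rfl⟩ := Multiset.exists_cons_of_mem ha
    have h1 := hSp a ha
    have hT : 0 ≤ T.sum :=
      Multiset.sum_nonneg fun x hx => (hSp x (Multiset.mem_cons_of_mem hx)).le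
    rw [Multiset.sum_cons] at h
    linarith
  subst hz'
  have hnz : (n : ℤ) * z ≤ (q + 1) * z :=
    mul_le_mul_of_nonneg_right (by exact_mod_cast hn) hzp.le
  have hn0 : 0 ≤ (n : ℤ) * z := by positivity
  have hqz : 0 ≤ (q : ℤ) * z := by positivity
  obtain h | h | h : n' = 0 ∨ n' = 1 ∨ 2 ≤ n' := by omega
  · exfalso
    subst h
    simp only [Nat.cast_zero, zero_mul, zero_add] at hsum
    have h1 : (n : ℤ) * z = 0 := by linarith
    have h2 : S.sum = 0 := by linarith
    have h3 : n = 0 := by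
      rcases mul_eq_zero.1 h1 with h | h
      · exact_mod_cast h
      · omega
    exact hne ⟨h3, rfl, hS0 h2⟩
  · subst h
    simp only [Nat.cast_one, one_mul] at hsum
    have h1 : n = q + 1 := by
      by_contra hc
      have h2 : (n : ℤ) ≤ q := by exact_mod_cast (by omega : n ≤ q)
      have h3 := mul_le_mul_of_nonneg_right h2 hzp.le
      linarith
    refine ⟨rfl, h1, ?_⟩
    subst h1
    push_cast at hsum
    linarith
  · exfalso
    have h2 : (2 : ℤ) ≤ n' := by exact_mod_cast h
    have h3 : 0 < f + (q + 1) * z := by linarith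
    have h4 := mul_le_mul_of_nonneg_right h2 h3.le
    linarith
end

section
/- Consider the PV election with candidates {a, b, p}, where p is the attacker's preferred candidate, and 12 districts: D₁ with 6 voters all voting for p; D₂ with 3 voters all voting for a; D₃,…,D₈ each with a single voter voting for a; D₉,…,D₁₂ each with a single voter voting for b; the attacker may arbitrarily redistribute all votes in any district he manipulates, with budgets B_A = 2 and B_D = 1 (so SW(a) = 9, SW(p) = 6, SW(b) = 4). Then: (i) for every regular manipulation (M, ṽ) in favor of p with |M| ≤ 2, there exists R ⊆ M with |R| ≤ 1 such that a is the PV winner of the recounted profile; and (ii) there exists a (non-regular) manipulation (M, ṽ) with |M| ≤ 2 — namely, distorting all votes of D₁ to b and all votes of D₂ to p — such that no R ⊆ M with |R| ≤ 1 makes a the PV winner of the recounted profile, while some R ⊆ M with |R| ≤ 1 makes p the PV winner of the recounted profile. Hence the attacker loses with regular manipulations but wins with a non-regular one against a defender who maximizes the true social welfare of the resulting winner. -/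
/-!
Statement 18 (Example: regular manipulations may be suboptimal for the
attacker under PV). Candidates `{a, b, p}`, 12 districts: `D₁` has 6 voters
for `p`, `D₂` has 3 voters for `a`, `D₃,…,D₈` one voter for `a` each,
`D₉,…,D₁₂` one voter for `b` each; budgets `B_A = 2`, `B_D = 1`.
(i) Against every regular manipulation of at most 2 districts the defender can
restore `a` by recounting at most one district; (ii) the non-regular
manipulation that distorts `D₁` in favor of `b` and `D₂` in favor of `p`
leaves the defender unable to make `a` win, while some recount of at most one
district makes `p` win.
-/

namespace PVExample18

variable {C : Type*}

/-- Total PV score of candidate `a` in profile `v`. -/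
def score {D : Type*} [Fintype D] (v : D → C → ℕ) (a : C) : ℕ := ∑ i, v i a

/-- `a` beats `b` under PV (ties broken by the linear order: `b < a` means `a ≻ b`). -/
def beats {D : Type*} [Fintype D] [LT C] (v : D → C → ℕ) (a b : C) : Prop :=
  score v b < score v a ∨ (score v a = score v b ∧ b < a)

/-- `a` is the PV winner of profile `v`. -/
def winner {D : Type*} [Fintype D] [LT C] (v : D → C → ℕ) (a : C) : Prop :=
  ∀ b, b ≠ a → beats v a b

/-- The recounted profile: true votes on districts in `R`, distorted votes elsewhere. -/
def recount {D : Type*} [DecidableEq D] (v vt : D → C → ℕ) (R : Finset D) : D → C → ℕ :=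
  fun i a => if i ∈ R then v i a else vt i a

theorem sum_C [Fintype C] [LinearOrder C]
    (a b p : C) (hab : a ≠ b) (hap : a ≠ p) (hbp : b ≠ p)
    (hC : ∀ c : C, c = a ∨ c = b ∨ c = p) (f : C → ℕ) : ∑ c, f c = f a + f b + f p := by
  have h : (Finset.univ : Finset C) = {a, b, p} := by
    ext c
    simpa using hC c
  rw [h, Finset.sum_insert (by simp [hab, hap]), Finset.sum_pair hbp, add_assoc]

theorem score_split (w : Fin 12 → C → ℕ) (c : C) :
    score w c = w 0 c + w 1 c + w 2 c + w 3 c + w 4 c + w 5 c + w 6 c + w 7 c + w 8 c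
      + w 9 c + w 10 c + w 11 c := by
  simp [score, Fin.sum_univ_succ]
  simp only [add_assoc]

theorem exists_R (M : Finset (Fin 12)) (hM : M.card ≤ 2) :
    ∃ R ⊆ M, R.card ≤ 1 ∧ ∃ j : Fin 12, j ≠ 1 ∧ ∀ i ∈ M, i ∉ R → i = j := by
  have key : ∀ k ∈ M, ∃ j : Fin 12, j ≠ k ∧ ∀ i ∈ M, i ∉ ({k} : Finset (Fin 12)) → i = j := by
    intro k hk
    have h1 : (M.erase k).card ≤ 1 := by
      rw [Finset.card_erase_of_mem hk]; omega
    rcases (M.erase k).eq_empty_or_nonempty with h | ⟨j, hj⟩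
    · obtain ⟨j, hj⟩ := exists_ne k
      refine ⟨j, hj, fun i hi hik => ?_⟩
      have : i ∈ M.erase k := Finset.mem_erase.2 ⟨by simpa using hik, hi⟩
      simp [h] at this
    · refine ⟨j, (Finset.mem_erase.1 hj).1, fun i hi hik => ?_⟩
      exact Finset.card_le_one.1 h1 i (Finset.mem_erase.2 ⟨by simpa using hik, hi⟩) j hj
  by_cases h1 : (1 : Fin 12) ∈ M
  · exact ⟨{1}, by simpa using h1, by simp, key 1 h1⟩
  · rcases M.eq_empty_or_nonempty with h | ⟨k, hk⟩
    · exact ⟨∅, by simp, by simp, 0, by decide, by simp [h]⟩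
    · obtain ⟨j, hj, hj'⟩ := key k hk
      by_cases hj1 : j = 1
      · refine ⟨{k}, by simpa using hk, by simp, 0, by decide, fun i hi hik => ?_⟩
        have := hj' i hi hik
        subst hj1 this
        exact absurd hi h1
      · exact ⟨{k}, by simpa using hk, by simp, j, hj1, hj'⟩

theorem stmt18 [Fintype C] [LinearOrder C]
    (a b p : C) (hab : a ≠ b) (hap : a ≠ p) (hbp : b ≠ p)
    (hC : ∀ c : C, c = a ∨ c = b ∨ c = p)
    (v : Fin 12 → C → ℕ)
    -- `D₁` (index 0): 6 voters for `p`
    (hv0 : ∀ c, v 0 c = if c = p then 6 else 0)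
    -- `D₂` (index 1): 3 voters for `a`
    (hv1 : ∀ c, v 1 c = if c = a then 3 else 0)
    -- `D₃,…,D₈` (indices 2–7): one voter for `a` each
    (hv2 : ∀ i : Fin 12, 2 ≤ i.val → i.val ≤ 7 → ∀ c, v i c = if c = a then 1 else 0)
    -- `D₉,…,D₁₂` (indices 8–11): one voter for `b` each
    (hv3 : ∀ i : Fin 12, 8 ≤ i.val → ∀ c, v i c = if c = b then 1 else 0) :
    -- (i) every regular manipulation of at most 2 districts can be defeated by
    -- recounting at most one district:
    ((∀ M : Finset (Fin 12), M.card ≤ 2 →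
      ∀ vt : Fin 12 → C → ℕ,
        (∀ i ∉ M, ∀ c, vt i c = v i c) →
        (∀ i, ∑ c, vt i c = ∑ c, v i c) →
        (∀ i, ∀ c, c ≠ p → vt i c ≤ v i c) →
        ∃ R ⊆ M, R.card ≤ 1 ∧ winner (recount v vt R) a)
    -- (ii) the non-regular manipulation distorting `D₁` to `b` and `D₂` to `p`
    -- wins for the attacker:
    ∧ (∃ M : Finset (Fin 12), M = {0, 1} ∧
        ∃ vt : Fin 12 → C → ℕ,
          (∀ c, vt 0 c = if c = b then 6 else 0) ∧
          (∀ c, vt 1 c = if c = p then 3 else 0) ∧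
          (∀ i ∉ M, ∀ c, vt i c = v i c) ∧
          (∀ i, ∑ c, vt i c = ∑ c, v i c) ∧
          (∀ R ⊆ M, R.card ≤ 1 → ¬ winner (recount v vt R) a) ∧
          (∃ R ⊆ M, R.card ≤ 1 ∧ winner (recount v vt R) p))) := by
  have e2 := hv2 2 (by decide) (by decide)
  have e3 := hv2 3 (by decide) (by decide)
  have e4 := hv2 4 (by decide) (by decide)
  have e5 := hv2 5 (by decide) (by decide)
  have e6 := hv2 6 (by decide) (by decide)
  have e7 := hv2 7 (by decide) (by decide)
  have e8 := hv3 8 (by decide)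
  have e9 := hv3 9 (by decide)
  have e10 := hv3 10 (by decide)
  have e11 := hv3 11 (by decide)
  constructor
  · intro M hM vt hout hsum hreg
    obtain ⟨R, hRM, hR, j, hj1, hj⟩ := exists_R M hM
    refine ⟨R, hRM, hR, ?_⟩
    have hw : ∀ i, i ≠ j → ∀ c, recount v vt R i c = v i c := by
      intro i hi c
      unfold recount
      split_ifs with h
      · rfl
      · exact hout i (fun hiM => hi (hj i hiM h)) c
    have hs : ∀ i, recount v vt R i a + recount v vt R i b + recount v vt R i p
        = v i a + v i b + v i p := by
      intro i
      have := hsum i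
      rw [sum_C a b p hab hap hbp hC, sum_C a b p hab hap hbp hC] at this
      unfold recount
      split_ifs
      · rfl
      · exact this
    have hr : ∀ i c, c ≠ p → recount v vt R i c ≤ v i c := by
      intro i c hc
      unfold recount
      split_ifs
      · rfl
      · exact hreg i c hc
    generalize recount v vt R = w at hw hs hr
    have hsa : ∀ c, score v c = (if c = p then 6 else 0) + (if c = a then 9 else 0)
        + (if c = b then 4 else 0) := by
      intro c
      rw [score_split, hv0, hv1, e2, e3, e4, e5, e6, e7, e8, e9, e10, e11]
      split_ifs <;> rfl
    have hd : ∀ c, score w c + v j c = score v c + w j c := by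
      intro c
      unfold score
      rw [← Finset.add_sum_erase _ _ (Finset.mem_univ j),
        ← Finset.add_sum_erase (f := fun i => v i c) _ (Finset.mem_univ j),
        Finset.sum_congr rfl (fun i hi => hw i (Finset.mem_erase.1 hi).1 c)]
      ring
    have hva : v j a + v j b ≤ 1 := by
      rcases Nat.lt_or_ge j.val 2 with h | h
      · have : j = 0 := by
          ext
          have : j.val ≠ 1 := fun h => hj1 (Fin.ext h)
          simp; omega
        rw [this, hv0, hv0]; simp [hap, hbp]
      · rcases Nat.lt_or_ge j.val 8 with h' | h'
        · rw [hv2 j h (by omega), hv2 j h (by omega)]; simp [hab.symm]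
        · rw [hv3 j h', hv3 j h']; simp [hab]
    have sa := hsa a
    have sb := hsa b
    have sp := hsa p
    simp [hab, hap, hbp, hab.symm, hap.symm, hbp.symm] at sa sb sp
    have da := hd a
    have db := hd b
    have dp := hd p
    have ra := hr j a hap
    have rb := hr j b hbp
    have ss := hs j
    intro c hc
    left
    rcases hC c with rfl | rfl | rfl
    · exact absurd rfl hc
    · omega
    · omega
  · refine ⟨{0, 1}, rfl, fun i c => if i = 0 then (if c = b then 6 else 0)
      else if i = 1 then (if c = p then 3 else 0) else v i c, ?_, ?_, ?_, ?_, ?_, ?_⟩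
    · intro c; simp
    · intro c; simp
    · intro i hi c
      simp at hi
      simp [hi]
    · intro i
      by_cases h0 : i = 0
      · subst h0; simp [hv0]
      · by_cases h1 : i = 1
        · subst h1; simp [hv1]
        · simp [h0, h1]
    · intro R hR hc hwin
      have hb := hwin b hab.symm
      have hp := hwin p hap.symm
      have hn : ¬ ((0 : Fin 12) ∈ R ∧ (1 : Fin 12) ∈ R) := by
        rintro ⟨h0, h1⟩
        exact absurd (Finset.card_le_one.1 hc 0 h0 1 h1) (by decide)
      unfold beats at hb hp
      simp only [score_split] at hb hp
      by_cases h0 : (0 : Fin 12) ∈ R <;> by_cases h1 : (1 : Fin 12) ∈ R <;>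
        simp [recount, h0, h1, hv0, hv1, e2, e3, e4, e5, e6, e7, e8, e9, e10, e11,
          hab, hap, hbp, hab.symm, hap.symm, hbp.symm] at hb hp hn
    · refine ⟨{0}, by simp, by simp, ?_⟩
      intro c hc
      left
      simp only [score_split]
      rcases hC c with rfl | rfl | rfl
      · simp [recount, hv0, hv1, e2, e3, e4, e5, e6, e7, e8, e9, e10, e11,
          hab, hap, hbp, hab.symm, hap.symm, hbp.symm]
      · simp [recount, hv0, hv1, e2, e3, e4, e5, e6, e7, e8, e9, e10, e11,
          hab, hap, hbp, hab.symm, hap.symm, hbp.symm]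
      · exact absurd rfl hc

end PVExample18
end

section
/- Let v and ṽ be profiles over districts 1,…,k and candidate set C, let ũ ∈ ℕ^C be the vector of total scores under ṽ (ũ_a = Σ_{i=1}^{k} ṽ_{i,a}), and for each district i let v_i, ṽ_i ∈ ℕ^C be its true and distorted vote vectors. Define T(i, ℓ, u) for 0 ≤ i ≤ k, ℓ ≥ 0, and u ∈ ℕ^C recursively by: T(i, ℓ, u) = true if u = ũ; T(i, ℓ, u) = false if u ≠ ũ and (i = 0 or ℓ = 0); and otherwise T(i, ℓ, u) = T(i−1, ℓ, u) ∨ (every coordinate of u − v_i + ṽ_i is nonnegative and T(i−1, ℓ−1, u − v_i + ṽ_i)). Then T(i, ℓ, u) = true if and only if there exists R ⊆ {1, …, i} with |R| ≤ ℓ such that ũ_a + Σ_{j∈R}(v_{j,a} − ṽ_{j,a}) = u_a for every candidate a ∈ C. -/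
/-!
Statement 19: correctness of the dynamic-programming recurrence for the
defender's recounting problem under PV (Theorem `PV-Rec-poly`). Districts are
indexed `0, …, k−1`; `ũ_a = Σ_{j<k} ṽ_{j,a}` is the distorted total score.
`T i ℓ u` holds iff some set `R` of at most `ℓ` of the first `i` districts can
be recounted so that the resulting total score vector is `u`.
-/

namespace PVDynProg19

variable {C : Type*}

/-- The dynamic-programming table: `T v vt ut i ℓ u` is true iff `u = ut`, or
(`i ≥ 1`, `ℓ ≥ 1` and) `T (i-1) ℓ u` holds, or every coordinate of
`u − v_i + ṽ_i` is nonnegative and `T (i-1) (ℓ-1) (u − v_i + ṽ_i)` holds. -/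
def T (v vt : ℕ → C → ℕ) (ut : C → ℤ) : ℕ → ℕ → (C → ℤ) → Prop
  | 0, _, u => u = ut
  | _ + 1, 0, u => u = ut
  | i + 1, ℓ + 1, u =>
      u = ut ∨ T v vt ut i (ℓ + 1) u ∨
        ((∀ a, 0 ≤ u a - (v i a : ℤ) + (vt i a : ℤ)) ∧
          T v vt ut i ℓ (fun a => u a - (v i a : ℤ) + (vt i a : ℤ)))

theorem stmt19 [Fintype C] (k : ℕ) (v vt : ℕ → C → ℕ)
    (ut : C → ℤ) (hut : ∀ a, ut a = ∑ j ∈ Finset.range k, (vt j a : ℤ))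
    (i : ℕ) (hik : i ≤ k) (ℓ : ℕ) (u : C → ℤ) (hu : ∀ a, 0 ≤ u a) :
    T v vt ut i ℓ u ↔
      ∃ R ⊆ Finset.range i, R.card ≤ ℓ ∧
        ∀ a, ut a + ∑ j ∈ R, ((v j a : ℤ) - (vt j a : ℤ)) = u a := by
  clear hu
  induction i generalizing ℓ u with
  | zero =>
    simp only [T, Finset.range_zero, Finset.subset_empty]
    constructor
    · rintro rfl
      exact ⟨∅, rfl, by simp, by simp⟩
    · rintro ⟨R, rfl, -, h⟩
      funext a
      simpa using (h a).symm
  | succ i ih =>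
    have ih := ih (by omega)
    cases ℓ with
    | zero =>
      simp only [T]
      constructor
      · rintro rfl
        exact ⟨∅, by simp, by simp, by simp⟩
      · rintro ⟨R, -, hc, h⟩
        have hR : R = ∅ := Finset.card_eq_zero.mp (by omega)
        subst hR
        funext a
        simpa using (h a).symm
    | succ ℓ =>
      simp only [T]
      rw [ih, ih]
      constructor
      · rintro (rfl | ⟨R, hR, hc, h⟩ | ⟨-, R, hR, hc, h⟩)
        · exact ⟨∅, by simp, by simp, by simp⟩
        · exact ⟨R, hR.trans (Finset.range_mono (Nat.le_succ i)), hc, h⟩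
        · have hi : i ∉ R := fun hm => by simpa using hR hm
          refine ⟨insert i R, ?_, ?_, ?_⟩
          · rw [Finset.range_add_one]
            exact Finset.insert_subset_insert _ hR
          · rw [Finset.card_insert_of_notMem hi]
            omega
          · intro a
            rw [Finset.sum_insert hi]
            have := h a
            linarith
      · rintro ⟨R, hR, hc, h⟩
        by_cases hi : i ∈ R
        · right; right
          have hsub : R.erase i ⊆ Finset.range i := by
            intro j hj
            have h1 := Finset.mem_erase.mp hj
            have h2 := Finset.mem_range.mp (hR h1.2)
            have h3 := h1.1
            exact Finset.mem_range.mpr (by omega)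
          have key : ∀ a, ut a + ∑ j ∈ R.erase i, ((v j a : ℤ) - (vt j a : ℤ))
              = u a - (v i a : ℤ) + (vt i a : ℤ) := by
            intro a
            have h1 := h a
            rw [← Finset.add_sum_erase R _ hi] at h1
            linarith
          refine ⟨?_, R.erase i, hsub, ?_, key⟩
          · intro a
            rw [← key a, hut a, Finset.sum_sub_distrib]
            have h1 : ∑ j ∈ R.erase i, (vt j a : ℤ) ≤ ∑ j ∈ Finset.range k, (vt j a : ℤ) :=
              Finset.sum_le_sum_of_subset_of_nonneg
                (hsub.trans (Finset.range_mono (by omega))) (fun _ _ _ => by positivity)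
            have h2 : 0 ≤ ∑ j ∈ R.erase i, (v j a : ℤ) := by positivity
            linarith
          · rw [Finset.card_erase_of_mem hi]
            omega
        · right; left
          refine ⟨R, ?_, hc, h⟩
          intro j hj
          have h2 := Finset.mem_range.mp (hR hj)
          have h3 : j ≠ i := fun e => hi (e ▸ hj)
          exact Finset.mem_range.mpr (by omega)

end PVDynProg19
end
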